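/- Let n ≥ 1. There is a constant C depending only on n such that the following holds. Let ν be a finite signed Borel measure on ℝ^{n+1} such that ‖∇_x W * ν‖_∞ ≤ 1 and ‖∂_t^{1/2}(W * ν)‖_{*,p} ≤ 1. Let Q ⊂ R ⊂ ℝ^{n+1} be parabolic cubes and let φ be a C² function admissible for Q. Then ∫_R |∂_t^{1/2}(W * (φν))| dm ≤ C ℓ(R)^{n+2}, where φν is the measure with density φ with respect to ν and m is Lebesgue measure on ℝ^{n+1}. -/

import Mathlib

open MeasureTheory Real Set

noncomputable section

/-- The spatial factor `ℝⁿ`. -/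
abbrev Spc (n : ℕ) := EuclideanSpace ℝ (Fin n)

/-- The parabolic space `ℝ^{n+1} = ℝⁿ × ℝ`, points `x̄ = (x, t)`. -/
abbrev Pt (n : ℕ) := Spc n × ℝ

/-- The parabolic norm `|x̄|_p = max (|x|, |t|^{1/2})`. -/
def pnorm {n : ℕ} (p : Pt n) : ℝ := max ‖p.1‖ (Real.sqrt |p.2|)

/-- The parabolic ball of center `c` and radius `r`. -/
def pball {n : ℕ} (c : Pt n) (r : ℝ) : Set (Pt n) := {p | pnorm (p - c) < r}

/-- The heat kernel `W`. -/
def heatW {n : ℕ} (p : Pt n) : ℝ :=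
  if 0 < p.2 then (4 * π * p.2) ^ (-(n : ℝ) / 2) * Real.exp (-‖p.1‖ ^ 2 / (4 * p.2)) else 0

/-- The spatial gradient `∇ₓ W` of the heat kernel. -/
def gradW {n : ℕ} (p : Pt n) : Spc n :=
  if 0 < p.2 then
    (-(1 / (2 * p.2)) * (4 * π * p.2) ^ (-(n : ℝ) / 2) * Real.exp (-‖p.1‖ ^ 2 / (4 * p.2))) • p.1
  else 0

/-- Half time derivative `∂_t^{1/2} f (x,t) = ∫ (f(x,s) - f(x,t))/|s-t|^{3/2} ds`. -/
def halfT {n : ℕ} (f : Pt n → ℝ) (p : Pt n) : ℝ :=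
  ∫ s : ℝ, (f (p.1, s) - f p) / |s - p.2| ^ (3 / 2 : ℝ)

/-- A parabolic cube: product of `n` intervals of length `len` and a time interval
of length `len ^ 2`. -/
structure PCube (n : ℕ) where
  corner : Fin n → ℝ
  time : ℝ
  len : ℝ
  len_pos : 0 < len

/-- The set of points of a parabolic cube. -/
def PCube.toSet {n : ℕ} (Q : PCube n) : Set (Pt n) :=
  {p | (∀ i, p.1 i ∈ Set.Icc (Q.corner i) (Q.corner i + Q.len)) ∧
    p.2 ∈ Set.Icc Q.time (Q.time + Q.len ^ 2)}

/-- The dilation `λQ` of a parabolic cube: same center, side lengths `λ·len` and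
`λ²·len²`. -/
def PCube.dilate {n : ℕ} (Q : PCube n) (lam : ℝ) (h : 0 < lam) : PCube n :=
  ⟨fun i => Q.corner i + Q.len / 2 - lam * Q.len / 2,
    Q.time + Q.len ^ 2 / 2 - lam ^ 2 * Q.len ^ 2 / 2,
    lam * Q.len, mul_pos h Q.len_pos⟩

/-- Second directional derivative in the `i`-th spatial direction. -/
def dir2 {n : ℕ} (φ : Pt n → ℝ) (p : Pt n) (i : Fin n) : ℝ :=
  deriv (fun h : ℝ =>
    deriv (fun h' : ℝ => φ (p.1 + h' • (EuclideanSpace.single i 1 : Spc n), p.2)) h) 0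

/-- Spatial Laplacian `Δₓ φ`. -/
def lapx {n : ℕ} (φ : Pt n → ℝ) (p : Pt n) : ℝ := ∑ i : Fin n, dir2 φ p i

/-- A `C²` function `φ` is admissible for a parabolic cube `Q` if it is supported on `Q`,
`‖∇ₓ φ‖_∞ ≤ 1/ℓ(Q)` and `‖Δₓ φ‖_∞ + ‖∂_t φ‖_∞ ≤ 1/ℓ(Q)²`. -/
def Admissible {n : ℕ} (φ : Pt n → ℝ) (Q : PCube n) : Prop :=
  ContDiff ℝ 2 φ ∧ tsupport φ ⊆ Q.toSet ∧
  (∀ p : Pt n, ‖fderiv ℝ (fun y : Spc n => φ (y, p.2)) p.1‖ ≤ 1 / Q.len) ∧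
  (∀ p : Pt n, |lapx φ p| + |deriv (fun s : ℝ => φ (p.1, s)) p.2| ≤ 1 / Q.len ^ 2)

/-- The parabolic BMO norm of `f` is at most `C`. -/
def ParabBMOLe {n : ℕ} (f : Pt n → ℝ) (C : ℝ) : Prop :=
  ∀ Q : PCube n, ⨍ p in Q.toSet, |f p - ⨍ q in Q.toSet, f q| ≤ C

/-- `‖F‖_{Lip_{1/2,t}} ≤ C` : half-Lipschitz in time. -/
def LipHalfLe {n : ℕ} (F : Pt n → ℝ) (C : ℝ) : Prop :=
  ∀ (x : Spc n) (t u : ℝ), |F (x, t) - F (x, u)| ≤ C * Real.sqrt |t - u|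

/-- Integral of a scalar function against a finite signed measure. -/
def sInt {n : ℕ} (ν : SignedMeasure (Pt n)) (f : Pt n → ℝ) : ℝ :=
  ∫ y, f y ∂ν.toJordanDecomposition.posPart - ∫ y, f y ∂ν.toJordanDecomposition.negPart

/-- Integral of a vector-valued function against a finite signed measure. -/
def vInt {n : ℕ} (ν : SignedMeasure (Pt n)) (f : Pt n → Spc n) : Spc n :=
  ∫ y, f y ∂ν.toJordanDecomposition.posPart - ∫ y, f y ∂ν.toJordanDecomposition.negPart

/-- `W * ν`. -/
def convW {n : ℕ} (ν : SignedMeasure (Pt n)) (p : Pt n) : ℝ :=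
  sInt ν (fun y => heatW (p - y))

/-- `∇ₓ W * ν`. -/
def convGradW {n : ℕ} (ν : SignedMeasure (Pt n)) (p : Pt n) : Spc n :=
  vInt ν (fun y => gradW (p - y))

/-- `W * (φ ν)`, where `φν` is the measure with density `φ` w.r.t. `ν`. -/
def convWd {n : ℕ} (ν : SignedMeasure (Pt n)) (φ : Pt n → ℝ) (p : Pt n) : ℝ :=
  sInt ν (fun y => φ y * heatW (p - y))

/-- `∇ₓ W * (φ ν)`. -/
def convGradWd {n : ℕ} (ν : SignedMeasure (Pt n)) (φ : Pt n → ℝ) (p : Pt n) : Spc n :=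
  vInt ν (fun y => φ y • gradW (p - y))

/-- `W * μ` for a positive measure `μ`. -/
def mconvW {n : ℕ} (μ : Measure (Pt n)) (p : Pt n) : ℝ := ∫ y, heatW (p - y) ∂μ

/-- `∇ₓ W * μ` for a positive measure `μ`. -/
def mconvGradW {n : ℕ} (μ : Measure (Pt n)) (p : Pt n) : Spc n := ∫ y, gradW (p - y) ∂μ

/-- Upper parabolic growth of degree `n+1` with constant `1`. -/
def PGrowth {n : ℕ} (μ : Measure (Pt n)) : Prop :=
  ∀ (c : Pt n) (r : ℝ), 0 < r → μ (pball c r) ≤ ENNReal.ofReal (r ^ (n + 1))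
/-- Truncated kernel `min(1,|ρ|/τ)/|ρ|^{3/2}`. -/
def mker (τ ρ : ℝ) : ℝ := min 1 (|ρ| / τ) / |ρ| ^ (3 / 2 : ℝ)

lemma mker_nonneg {τ : ℝ} (hτ : 0 < τ) (ρ : ℝ) : 0 ≤ mker τ ρ := by
  unfold mker; positivity

lemma mker_measurable (τ : ℝ) : Measurable (mker τ) := by
  unfold mker; fun_prop

lemma mker_abs (τ ρ : ℝ) : mker τ |ρ| = mker τ ρ := by
  unfold mker; rw [abs_abs]

lemma mker_small {τ ρ : ℝ} (hρ : 0 < ρ) (h : ρ ≤ τ) : mker τ ρ = τ⁻¹ * ρ ^ (-1 / 2 : ℝ) := by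
  unfold mker
  have hτ : 0 < τ := lt_of_lt_of_le hρ h
  rw [abs_of_pos hρ, min_eq_right ((div_le_one hτ).2 h)]
  rw [show (-1 / 2 : ℝ) = 1 - 3 / 2 by norm_num, Real.rpow_sub hρ, Real.rpow_one]
  field_simp

lemma mker_large {τ ρ : ℝ} (hτ : 0 < τ) (h : τ < ρ) : mker τ ρ = ρ ^ (-3 / 2 : ℝ) := by
  unfold mker
  have hρ : 0 < ρ := hτ.trans h
  rw [abs_of_pos hρ, min_eq_left ((one_le_div hτ).2 h.le)]
  rw [show (-3 / 2 : ℝ) = - (3 / 2) by norm_num, Real.rpow_neg hρ.le, one_div]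

lemma mker_integrableOn_Ioi {τ : ℝ} (hτ : 0 < τ) :
    IntegrableOn (mker τ) (Ioi 0) ∧ ∫ ρ in Ioi 0, mker τ ρ = 4 / Real.sqrt τ := by
  have hs : IntegrableOn (mker τ) (Ioc 0 τ) := by
    have h1 : IntegrableOn (fun ρ : ℝ => τ⁻¹ * ρ ^ (-1 / 2 : ℝ)) (Ioc 0 τ) := by
      have := (intervalIntegral.intervalIntegrable_rpow' (a := 0) (b := τ)
        (r := (-1 / 2 : ℝ)) (by norm_num)).const_mul τ⁻¹
      rwa [intervalIntegrable_iff_integrableOn_Ioc_of_le hτ.le] at this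
    refine h1.congr_fun ?_ measurableSet_Ioc
    intro ρ hρ
    exact (mker_small hρ.1 hρ.2).symm
  have hl : IntegrableOn (mker τ) (Ioi τ) := by
    refine (integrableOn_Ioi_rpow_of_lt (a := (-3 / 2 : ℝ)) (by norm_num) hτ).congr_fun ?_
      measurableSet_Ioi
    intro ρ hρ
    exact (mker_large hτ hρ).symm
  have hu : Ioc 0 τ ∪ Ioi τ = Ioi (0 : ℝ) := Ioc_union_Ioi_eq_Ioi hτ.le
  refine ⟨hu ▸ hs.union hl, ?_⟩
  rw [← hu, setIntegral_union (Set.Ioc_disjoint_Ioi le_rfl) measurableSet_Ioi hs hl]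
  have e1 : ∫ ρ in Ioc 0 τ, mker τ ρ = 2 / Real.sqrt τ := by
    rw [setIntegral_congr_fun measurableSet_Ioc (g := fun ρ : ℝ => τ⁻¹ * ρ ^ (-1 / 2 : ℝ))
      (fun ρ hρ => mker_small hρ.1 hρ.2), ← intervalIntegral.integral_of_le hτ.le,
      intervalIntegral.integral_const_mul, integral_rpow (Or.inl (by norm_num))]
    norm_num
    rw [← Real.sqrt_eq_rpow]
    have := Real.mul_self_sqrt hτ.le
    have h0 : 0 < Real.sqrt τ := Real.sqrt_pos.2 hτ
    field_simp
    nlinarith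
  have e2 : ∫ ρ in Ioi τ, mker τ ρ = 2 / Real.sqrt τ := by
    rw [setIntegral_congr_fun measurableSet_Ioi (g := fun ρ : ℝ => ρ ^ (-3 / 2 : ℝ))
      (fun ρ hρ => mker_large hτ hρ), integral_Ioi_rpow_of_lt (by norm_num) hτ]
    norm_num
    rw [Real.rpow_neg hτ.le, ← Real.sqrt_eq_rpow]
    ring
  rw [e1, e2]; ring

lemma mker_integrable {τ : ℝ} (hτ : 0 < τ) : Integrable (mker τ) := by
  have h := (mker_integrableOn_Ioi hτ).1
  have h2 : IntegrableOn (mker τ) (Iio 0) := by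
    have := h.comp_neg
    rw [Set.neg_Ioi, neg_zero] at this
    refine this.congr_fun ?_ measurableSet_Iio
    intro ρ _
    show mker τ (-ρ) = mker τ ρ
    rw [← mker_abs, abs_neg, mker_abs]
  have h3 : IntegrableOn (mker τ) (Iic 0) := (integrableOn_Iic_iff_integrableOn_Iio (by simp)).2 h2
  have := h3.union h
  rwa [Iic_union_Ioi, integrableOn_univ] at this

lemma mker_integral {τ : ℝ} (hτ : 0 < τ) : ∫ ρ, mker τ ρ = 8 / Real.sqrt τ := by
  have := integral_comp_abs (f := mker τ)
  simp only [mker_abs] at this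
  rw [this, (mker_integrableOn_Ioi hτ).2]; ring

lemma mker_lintegral {τ : ℝ} (hτ : 0 < τ) :
    ∫⁻ ρ, ENNReal.ofReal (mker τ ρ) = ENNReal.ofReal (8 / Real.sqrt τ) := by
  rw [← mker_integral hτ, ofReal_integral_eq_lintegral_ofReal (mker_integrable hτ)
    (Filter.Eventually.of_forall (mker_nonneg hτ))]

lemma lintegral_rsqrt (a v r : ℝ) (hr : 0 < r) :
    ∫⁻ t in Icc a (a + r ^ 2), ENNReal.ofReal (1 / Real.sqrt |t - v|) ≤ ENNReal.ofReal (9 * r) := by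
  -- pointwise: 1/√|ρ| ≤ r² * mker (r²) ρ + 1/r
  have hp : ∀ ρ : ℝ, 1 / Real.sqrt |ρ| ≤ r ^ 2 * mker (r ^ 2) ρ + 1 / r := by
    intro ρ
    have hr2 : 0 < r ^ 2 := by positivity
    rcases eq_or_ne ρ 0 with rfl | h0
    · have := mker_nonneg hr2 (0 : ℝ)
      simp only [abs_zero, Real.sqrt_zero, div_zero]
      positivity
    have hρ : 0 < |ρ| := abs_pos.2 h0
    rcases le_or_gt |ρ| (r ^ 2) with h | h
    · rw [← mker_abs, mker_small hρ h, ← mul_assoc, mul_inv_cancel₀ hr2.ne', one_mul,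
        show (-1 / 2 : ℝ) = - (1 / 2) by norm_num, Real.rpow_neg hρ.le, ← Real.sqrt_eq_rpow,
        one_div]
      have : 0 ≤ 1 / r := by positivity
      linarith
    · have h1 : r ≤ Real.sqrt |ρ| := by
        rw [← Real.sqrt_sq hr.le]; exact Real.sqrt_le_sqrt h.le
      have : 1 / Real.sqrt |ρ| ≤ 1 / r := one_div_le_one_div_of_le hr h1
      have := mul_nonneg hr2.le (mker_nonneg hr2 ρ)
      linarith
  have hr2 : 0 < r ^ 2 := by positivity
  calc ∫⁻ t in Icc a (a + r ^ 2), ENNReal.ofReal (1 / Real.sqrt |t - v|)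
      ≤ ∫⁻ t in Icc a (a + r ^ 2), (ENNReal.ofReal (r ^ 2 * mker (r ^ 2) (t - v))
          + ENNReal.ofReal (1 / r)) := by
        refine lintegral_mono fun t => ?_
        rw [← ENNReal.ofReal_add (mul_nonneg hr2.le (mker_nonneg hr2 _)) (by positivity)]
        exact ENNReal.ofReal_le_ofReal (hp _)
    _ = (∫⁻ t in Icc a (a + r ^ 2), ENNReal.ofReal (r ^ 2 * mker (r ^ 2) (t - v)))
          + ENNReal.ofReal (1 / r) * ENNReal.ofReal (r ^ 2) := by
        rw [lintegral_add_right _ measurable_const]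
        simp [Real.volume_Icc]
    _ ≤ (∫⁻ t, ENNReal.ofReal (r ^ 2 * mker (r ^ 2) (t - v)))
          + ENNReal.ofReal (1 / r) * ENNReal.ofReal (r ^ 2) := by
        gcongr
        exact Measure.restrict_le_self
    _ = ENNReal.ofReal (r ^ 2 * (8 / Real.sqrt (r ^ 2)))
          + ENNReal.ofReal (1 / r) * ENNReal.ofReal (r ^ 2) := by
        rw [lintegral_sub_right_eq_self (fun t => ENNReal.ofReal (r ^ 2 * mker (r ^ 2) t)) v]
        simp_rw [ENNReal.ofReal_mul hr2.le]
        rw [lintegral_const_mul _ (mker_measurable _).ennreal_ofReal, mker_lintegral hr2]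
    _ = ENNReal.ofReal (9 * r) := by
        rw [← ENNReal.ofReal_mul (by positivity), ← ENNReal.ofReal_add (by positivity)
          (by positivity), Real.sqrt_sq hr.le]
        congr 1; field_simp; ring

lemma concave_gap (a : ℝ) (h0 : 0 < a) (h1 : a < 1) :
    ∃ c : ℝ, 0 < c ∧ ∀ d ρ : ℝ, 0 < d → d / 4 ≤ ρ → ρ ≤ d / 2 →
      (d + 2 * ρ) ^ a + (d - 2 * ρ) ^ a - 2 * d ^ a ≤ - c * d ^ a := by
  have hcont : ContinuousOn (fun x : ℝ => (1 + x) ^ a + (1 - x) ^ a) (Icc (1 / 2) 1) := by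
    apply Continuous.continuousOn
    have := Real.continuous_rpow_const h0.le
    fun_prop
  obtain ⟨x0, hx0, hmax⟩ := isCompact_Icc.exists_isMaxOn (nonempty_Icc.2 (by norm_num)) hcont
  have hlt : (1 + x0) ^ a + (1 - x0) ^ a < 2 := by
    have hx1 : (1 + x0) ∈ Ici (0 : ℝ) := by simp only [mem_Ici]; linarith [hx0.1]
    have hx2 : (1 - x0) ∈ Ici (0 : ℝ) := by simp only [mem_Ici]; linarith [hx0.2]
    have hne : (1 + x0) ≠ 1 - x0 := by intro h; linarith [hx0.1]
    have := (Real.strictConcaveOn_rpow h0 h1).2 hx1 hx2 hne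
      (by norm_num : (0 : ℝ) < 1 / 2) (by norm_num : (0 : ℝ) < 1 / 2) (by norm_num)
    simp only [smul_eq_mul] at this
    rw [show (1 / 2 : ℝ) * (1 + x0) + 1 / 2 * (1 - x0) = 1 by ring, Real.one_rpow] at this
    linarith
  refine ⟨2 - ((1 + x0) ^ a + (1 - x0) ^ a), by linarith, ?_⟩
  intro d ρ hd hl hu
  have hx : 2 * ρ / d ∈ Icc (1 / 2 : ℝ) 1 := by
    constructor
    · rw [le_div_iff₀ hd]; linarith
    · rw [div_le_one hd]; linarith
  have h := hmax hx
  simp only [Set.mem_ofPred_eq] at h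
  have e1 : (d + 2 * ρ) ^ a = d ^ a * (1 + 2 * ρ / d) ^ a := by
    rw [← Real.mul_rpow hd.le (by linarith [hx.1])]
    congr 1; field_simp
  have e2 : (d - 2 * ρ) ^ a = d ^ a * (1 - 2 * ρ / d) ^ a := by
    rw [← Real.mul_rpow hd.le (by linarith [hx.2])]
    congr 1; field_simp
  rw [e1, e2]
  have hda : 0 < d ^ a := Real.rpow_pos_of_pos hd a
  nlinarith

/-- One-dimensional half derivative. -/
def E1 (G : ℝ → ℝ) (t : ℝ) : ℝ := ∫ ρ, (G (t + ρ) - G t) / |ρ| ^ (3 / 2 : ℝ)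

lemma div_ker_le {x B ρ τ : ℝ} (h1 : |x| ≤ B) (h2 : |x| ≤ B * (|ρ| / τ)) :
    |x / |ρ| ^ (3 / 2 : ℝ)| ≤ B * mker τ ρ := by
  unfold mker
  have h3 : 0 ≤ |ρ| ^ (3 / 2 : ℝ) := by positivity
  have hB : 0 ≤ B := (abs_nonneg _).trans h1
  rw [abs_div, abs_of_nonneg h3, mul_div_assoc', mul_min_of_nonneg _ _ hB]
  gcongr
  exact le_min (by simpa using h1) h2

lemma E1_integrable {G : ℝ → ℝ} {B L : ℝ} (hB : ∀ t, |G t| ≤ B)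
    (hL : ∀ t u, |G t - G u| ≤ L * |t - u|) (hG : Continuous G) (t : ℝ) :
    Integrable (fun ρ => (G (t + ρ) - G t) / |ρ| ^ (3 / 2 : ℝ)) := by
  refine Integrable.mono' ((mker_integrable one_pos).const_mul (max (2 * B) L)) ?_ ?_
  · have : Measurable G := hG.measurable
    exact Measurable.aestronglyMeasurable (by fun_prop)
  · refine Filter.Eventually.of_forall fun ρ => ?_
    rw [Real.norm_eq_abs]
    apply div_ker_le
    · calc |G (t + ρ) - G t| ≤ |G (t + ρ)| + |G t| := abs_sub _ _
        _ ≤ 2 * B := by linarith [hB (t + ρ), hB t]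
        _ ≤ _ := le_max_left _ _
    · calc |G (t + ρ) - G t| ≤ L * |t + ρ - t| := hL _ _
        _ = L * (|ρ| / 1) := by ring_nf
        _ ≤ _ := by gcongr; exact le_max_right _ _

lemma E1_symm {G : ℝ → ℝ} {B L : ℝ} (hB : ∀ t, |G t| ≤ B)
    (hL : ∀ t u, |G t - G u| ≤ L * |t - u|) (hG : Continuous G) (t : ℝ) :
    Integrable (fun ρ => (G (t + ρ) + G (t - ρ) - 2 * G t) / |ρ| ^ (3 / 2 : ℝ)) ∧
    ∫ ρ, (G (t + ρ) + G (t - ρ) - 2 * G t) / |ρ| ^ (3 / 2 : ℝ) = 2 * E1 G t := by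
  have h1 := E1_integrable hB hL hG t
  have h2 := h1.comp_neg
  have e : (fun ρ => (G (t + ρ) + G (t - ρ) - 2 * G t) / |ρ| ^ (3 / 2 : ℝ)) =
      fun ρ => (G (t + ρ) - G t) / |ρ| ^ (3 / 2 : ℝ) +
        (G (t + -ρ) - G t) / |-ρ| ^ (3 / 2 : ℝ) := by
    funext ρ
    rw [abs_neg, ← sub_eq_add_neg]; ring
  rw [e]
  refine ⟨h1.add h2, ?_⟩
  rw [integral_add h1 h2, integral_neg_eq_self (fun ρ => (G (t + ρ) - G t) / |ρ| ^ (3 / 2 : ℝ))]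
  unfold E1; ring

lemma exists_max_mod {G : ℝ → ℝ} {B : ℝ} (hB : ∀ t, |G t| ≤ B) (hG : Continuous G)
    (h0 : ∀ η > 0, ∃ T : ℝ, ∀ t, T < |t| → |G t| < η) {M b : ℝ} (hM : 0 < M) (hb : 0 ≤ b)
    {t1 u1 : ℝ}
    (h : 0 < G t1 - G u1 - M * (|t1 - u1| ^ (1 / 2 : ℝ) + b * |t1 - u1| ^ (3 / 4 : ℝ))) :
    ∃ t0 u0, 0 < G t0 - G u0 - M * (|t0 - u0| ^ (1 / 2 : ℝ) + b * |t0 - u0| ^ (3 / 4 : ℝ)) ∧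
      ∀ t u, G t - G u - M * (|t - u| ^ (1 / 2 : ℝ) + b * |t - u| ^ (3 / 4 : ℝ)) ≤
        G t0 - G u0 - M * (|t0 - u0| ^ (1 / 2 : ℝ) + b * |t0 - u0| ^ (3 / 4 : ℝ)) := by
  set Ψ : ℝ × ℝ → ℝ := fun q => G q.1 - G q.2 -
    M * (|q.1 - q.2| ^ (1 / 2 : ℝ) + b * |q.1 - q.2| ^ (3 / 4 : ℝ)) with hΨ
  have hc : Continuous Ψ := by
    have c1 := Real.continuous_rpow_const (q := 1 / 2) (by norm_num)
    have c2 := Real.continuous_rpow_const (q := 3 / 4) (by norm_num)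
    simp only [hΨ]
    fun_prop
  set η := Ψ (t1, u1) with hη
  have hη0 : 0 < η := h
  obtain ⟨T, hT⟩ := h0 (η / 2) (half_pos hη0)
  have hpos : ∀ t u : ℝ, 0 ≤ b * |t - u| ^ (3 / 4 : ℝ) := fun t u => by positivity
  -- superlevel set is bounded
  have hbd : ∀ t u, η ≤ Ψ (t, u) → |t| ≤ |T| + (2 * B / M) ^ 2 ∧ |u| ≤ |T| + (2 * B / M) ^ 2 := by
    intro t u htu
    have h1 : η ≤ G t - G u - M * (|t - u| ^ (1 / 2 : ℝ) + b * |t - u| ^ (3 / 4 : ℝ)) := htu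
    have hw : 0 ≤ M * (|t - u| ^ (1 / 2 : ℝ) + b * |t - u| ^ (3 / 4 : ℝ)) := by positivity
    have h2 : |t - u| ^ (1 / 2 : ℝ) ≤ 2 * B / M := by
      rw [le_div_iff₀ hM]
      have := abs_le.1 (hB t); have := abs_le.1 (hB u)
      nlinarith [hpos t u]
    have h3 : |t - u| ≤ (2 * B / M) ^ 2 := by
      rw [← Real.sqrt_eq_rpow] at h2
      have := Real.sq_sqrt (abs_nonneg (t - u))
      rw [← this]
      gcongr
    have h4 : |t| ≤ T ∨ |u| ≤ T := by
      by_contra hcon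
      push Not at hcon
      have := abs_lt.1 (hT t hcon.1); have := abs_lt.1 (hT u hcon.2)
      linarith
    have h5 := abs_sub_abs_le_abs_sub t u
    have h6 := abs_sub_abs_le_abs_sub u t
    rw [abs_sub_comm] at h6
    have h7 := le_abs_self T
    have h8 : 0 ≤ (2 * B / M) ^ 2 := by positivity
    rcases h4 with h4 | h4 <;> constructor <;> linarith
  set R := |T| + (2 * B / M) ^ 2 with hR
  have hcomp : IsCompact (Icc (-R) R ×ˢ Icc (-R) R) := isCompact_Icc.prod isCompact_Icc
  have hmem1 : (t1, u1) ∈ Icc (-R) R ×ˢ Icc (-R) R := by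
    have := hbd t1 u1 le_rfl
    exact ⟨abs_le.1 this.1, abs_le.1 this.2⟩
  obtain ⟨⟨t0, u0⟩, _, hmax⟩ := hcomp.exists_isMaxOn ⟨_, hmem1⟩ hc.continuousOn
  have hge : η ≤ Ψ (t0, u0) := hmax hmem1
  refine ⟨t0, u0, lt_of_lt_of_le hη0 hge, fun t u => ?_⟩
  by_cases hlev : η ≤ Ψ (t, u)
  · have := hbd t u hlev
    exact hmax (show (t, u) ∈ Icc (-R) R ×ˢ Icc (-R) R from ⟨abs_le.1 this.1, abs_le.1 this.2⟩)
  · exact (not_le.1 hlev).le.trans hge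

theorem maxprin : ∃ C0 : ℝ, 0 < C0 ∧ ∀ (G : ℝ → ℝ) (B L : ℝ), (∀ t, |G t| ≤ B) →
    (∀ t u, |G t - G u| ≤ L * |t - u|) → Continuous G →
    (∀ η > 0, ∃ T : ℝ, ∀ t, T < |t| → |G t| < η) →
    ∀ A b : ℝ, 0 < A → 0 ≤ b →
    (∀ t u, |E1 G t - E1 G u| ≤ A * (1 + b * |t - u| ^ (1 / 4 : ℝ))) →
    ∀ t u, G t - G u ≤ C0 * A * (|t - u| ^ (1 / 2 : ℝ) + b * |t - u| ^ (3 / 4 : ℝ)) := by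
  obtain ⟨c1, hc1, hg1⟩ := concave_gap (1 / 2) (by norm_num) (by norm_num)
  obtain ⟨c2, hc2, hg2⟩ := concave_gap (3 / 4) (by norm_num) (by norm_num)
  set c := min c1 c2 with hc
  have hc0 : 0 < c := lt_min hc1 hc2
  refine ⟨16 / c, by positivity, ?_⟩
  intro G B L hB hL hG h0 A b hA hb hE
  by_contra hcon
  push Not at hcon
  obtain ⟨t1, u1, h1⟩ := hcon
  set M := 16 / c * A with hMdef
  have hM : 0 < M := by positivity
  obtain ⟨t0, u0, hpos, hmax⟩ := exists_max_mod hB hG h0 hM hb (t1 := t1) (u1 := u1) (by linarith)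
  set d := |t0 - u0| with hd
  have hd0 : 0 < d := by
    rw [hd, abs_pos, sub_ne_zero]
    rintro rfl
    have : 0 ≤ M * (d ^ (1 / 2 : ℝ) + b * d ^ (3 / 4 : ℝ)) := by positivity
    linarith
  obtain ⟨i1, e1⟩ := E1_symm hB hL hG t0
  obtain ⟨i2, e2⟩ := E1_symm hB hL hG u0
  set w : ℝ := d ^ (1 / 2 : ℝ) + b * d ^ (3 / 4 : ℝ) with hw
  have hw0 : 0 < w := by positivity
  set κ : ℝ := -(M * c * w) / d ^ (3 / 2 : ℝ) with hκ
  have h_integrable : Integrable (Set.indicator (Icc (d / 4) (d / 2)) (fun _ : ℝ => κ)) := by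
    rw [integrable_indicator_iff measurableSet_Icc]
    exact integrableOn_const (by simp)
  have hdiff : ∫ ρ, ((G (t0 + ρ) + G (t0 - ρ) - 2 * G t0) / |ρ| ^ (3 / 2 : ℝ) -
      (G (u0 + ρ) + G (u0 - ρ) - 2 * G u0) / |ρ| ^ (3 / 2 : ℝ)) ≤
      ∫ ρ, Set.indicator (Icc (d / 4) (d / 2)) (fun _ : ℝ => κ) ρ := by
    refine integral_mono (i1.sub i2) h_integrable fun ρ => ?_
    simp only
    rw [← sub_div]
    by_cases hρ : ρ ∈ Icc (d / 4) (d / 2)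
    · rw [Set.indicator_of_mem hρ, hκ]
      have hρ0 : 0 < ρ := by linarith [hρ.1]
      have a1 := hmax (t0 + ρ) (u0 - ρ)
      have a2 := hmax (t0 - ρ) (u0 + ρ)
      have key : (|t0 + ρ - (u0 - ρ)| = d + 2 * ρ ∧ |t0 - ρ - (u0 + ρ)| = d - 2 * ρ) ∨
          (|t0 + ρ - (u0 - ρ)| = d - 2 * ρ ∧ |t0 - ρ - (u0 + ρ)| = d + 2 * ρ) := by
        rcases abs_cases (t0 - u0) with ⟨h, h'⟩ | ⟨h, h'⟩
        · left
          rw [hd, h]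
          rw [← hd] at *
          constructor
          · rw [abs_of_nonneg] <;> linarith [hρ.2]
          · rw [abs_of_nonneg] <;> linarith [hρ.2]
        · right
          rw [hd, h]
          rw [← hd] at *
          constructor
          · rw [abs_of_nonpos] <;> linarith [hρ.2]
          · rw [abs_of_nonpos] <;> linarith [hρ.2]
      have g1 := hg1 d ρ hd0 hρ.1 hρ.2
      have g2 := hg2 d ρ hd0 hρ.1 hρ.2
      have p1 : 0 < d ^ (1 / 2 : ℝ) := by positivity
      have p2 : 0 < d ^ (3 / 4 : ℝ) := by positivity
      have g1' : (d + 2 * ρ) ^ (1 / 2 : ℝ) + (d - 2 * ρ) ^ (1 / 2 : ℝ) - 2 * d ^ (1 / 2 : ℝ) ≤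
          - c * d ^ (1 / 2 : ℝ) := by
        have : c ≤ c1 := min_le_left _ _
        nlinarith
      have g2' : (d + 2 * ρ) ^ (3 / 4 : ℝ) + (d - 2 * ρ) ^ (3 / 4 : ℝ) - 2 * d ^ (3 / 4 : ℝ) ≤
          - c * d ^ (3 / 4 : ℝ) := by
        have : c ≤ c2 := min_le_right _ _
        nlinarith
      have g3 := mul_le_mul_of_nonneg_left g2' hb
      have hnum : G (t0 + ρ) + G (t0 - ρ) - 2 * G t0 - (G (u0 + ρ) + G (u0 - ρ) - 2 * G u0) ≤
          -(M * c * w) := by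
        have hsum : ((d + 2 * ρ) ^ (1 / 2 : ℝ) + (d - 2 * ρ) ^ (1 / 2 : ℝ) - 2 * d ^ (1 / 2 : ℝ))
          + b * ((d + 2 * ρ) ^ (3 / 4 : ℝ) + (d - 2 * ρ) ^ (3 / 4 : ℝ) - 2 * d ^ (3 / 4 : ℝ))
            ≤ - (c * w) := by
          rw [hw]; linarith
        have hsum2 := mul_le_mul_of_nonneg_left hsum hM.le
        rcases key with ⟨k1, k2⟩ | ⟨k1, k2⟩ <;> rw [k1] at a1 <;> rw [k2] at a2 <;> linarith
      have q1 : |ρ| ^ (3 / 2 : ℝ) ≤ d ^ (3 / 2 : ℝ) := by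
        apply Real.rpow_le_rpow (abs_nonneg _) _ (by norm_num)
        rw [abs_of_pos hρ0]; linarith [hρ.2]
      have q0 : 0 < |ρ| ^ (3 / 2 : ℝ) := Real.rpow_pos_of_pos (abs_pos.2 hρ0.ne') _
      have hMw : 0 < M * c * w := by positivity
      calc _ ≤ -(M * c * w) / |ρ| ^ (3 / 2 : ℝ) := by gcongr
        _ ≤ _ := by
          rw [neg_div, neg_div, neg_le_neg_iff]
          gcongr
    · rw [Set.indicator_of_notMem hρ]
      apply div_nonpos_of_nonpos_of_nonneg _ (by positivity)
      have a1 := hmax (t0 + ρ) (u0 + ρ)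
      have a2 := hmax (t0 - ρ) (u0 - ρ)
      rw [show t0 + ρ - (u0 + ρ) = t0 - u0 by ring] at a1
      rw [show t0 - ρ - (u0 - ρ) = t0 - u0 by ring] at a2
      linarith
  rw [integral_sub i1 i2, e1, e2, integral_indicator measurableSet_Icc, setIntegral_const] at hdiff
  have hvol : volume.real (Icc (d / 4) (d / 2)) = d / 4 := by
    rw [Real.volume_real_Icc_of_le (by linarith)]; ring
  rw [hvol, smul_eq_mul] at hdiff
  have hEE := (abs_le.1 (hE t0 u0)).1
  rw [← hd] at hEE
  have r1 : d * d ^ (1 / 2 : ℝ) = d ^ (3 / 2 : ℝ) := by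
    nth_rewrite 1 [← Real.rpow_one d]
    rw [← Real.rpow_add hd0]; norm_num
  have r2 : d * d ^ (3 / 4 : ℝ) = d ^ (3 / 2 : ℝ) * d ^ (1 / 4 : ℝ) := by
    nth_rewrite 1 [← Real.rpow_one d]
    rw [← Real.rpow_add hd0, ← Real.rpow_add hd0]; norm_num
  have hk : d / 4 * κ = - (4 * A * (1 + b * d ^ (1 / 4 : ℝ))) := by
    have hp : 0 < d ^ (3 / 2 : ℝ) := by positivity
    rw [hκ, hMdef, hw]
    field_simp
    linear_combination (-16) * r1 - 16 * b * r2
  rw [hk] at hdiff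
  have : 0 < A * (1 + b * d ^ (1 / 4 : ℝ)) := by positivity
  linarith

instance ptHaar (n : ℕ) : (volume : Measure (Pt n)).IsAddHaarMeasure :=
  inferInstanceAs ((volume : Measure (Spc n)).prod (volume : Measure ℝ)).IsAddHaarMeasure

/-- Spatial cube. -/
def sbox {n : ℕ} (c : Fin n → ℝ) (l : ℝ) : Set (Spc n) :=
  {x | ∀ i, x i ∈ Set.Icc (c i) (c i + l)}

lemma sbox_eq {n : ℕ} (c : Fin n → ℝ) (l : ℝ) :
    sbox c l = (MeasurableEquiv.toLp 2 (Fin n → ℝ)).symm ⁻¹'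
      (Set.pi univ fun i => Set.Icc (c i) (c i + l)) := by
  ext x; simp [sbox, Set.mem_pi, -Set.pi_univ_Icc]

lemma sbox_measurable {n : ℕ} (c : Fin n → ℝ) (l : ℝ) : MeasurableSet (sbox c l) := by
  rw [sbox_eq]
  exact (MeasurableEquiv.measurable _) (MeasurableSet.univ_pi fun i => measurableSet_Icc)

lemma sbox_volume {n : ℕ} (c : Fin n → ℝ) (l : ℝ) :
    volume (sbox c l) = ENNReal.ofReal l ^ n := by
  rw [sbox_eq, ((EuclideanSpace.volume_preserving_symm_measurableEquiv_toLp (Fin n))).measure_preimage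
    (MeasurableSet.univ_pi fun i => measurableSet_Icc).nullMeasurableSet, volume_pi_pi]
  simp [Real.volume_Icc]

lemma PCube.toSet_eq {n : ℕ} (Q : PCube n) :
    Q.toSet = sbox Q.corner Q.len ×ˢ Set.Icc Q.time (Q.time + Q.len ^ 2) := by
  ext p; simp [PCube.toSet, sbox]

lemma PCube.measurable {n : ℕ} (Q : PCube n) : MeasurableSet Q.toSet := by
  rw [Q.toSet_eq]; exact (sbox_measurable _ _).prod measurableSet_Icc

lemma PCube.volume_eq {n : ℕ} (Q : PCube n) :
    volume Q.toSet = ENNReal.ofReal (Q.len ^ (n + 2)) := by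
  rw [Q.toSet_eq, Measure.volume_eq_prod, Measure.prod_prod, sbox_volume, Real.volume_Icc,
    add_sub_cancel_left, ← ENNReal.ofReal_pow Q.len_pos.le,
    ← ENNReal.ofReal_mul (pow_nonneg Q.len_pos.le _), pow_add]

lemma PCube.volume_real {n : ℕ} (Q : PCube n) :
    volume.real Q.toSet = Q.len ^ (n + 2) := by
  rw [Measure.real, Q.volume_eq, ENNReal.toReal_ofReal (pow_nonneg Q.len_pos.le _)]

lemma PCube.volume_ne_zero {n : ℕ} (Q : PCube n) : volume Q.toSet ≠ 0 := by
  rw [Q.volume_eq]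
  simpa using pow_pos Q.len_pos (n + 2)

lemma PCube.volume_ne_top {n : ℕ} (Q : PCube n) : volume Q.toSet ≠ ⊤ := by
  rw [Q.volume_eq]; simp

instance PCube.finiteRestrict {n : ℕ} (Q : PCube n) :
    IsFiniteMeasure (volume.restrict Q.toSet) :=
  ⟨by rw [Measure.restrict_apply_univ]; exact lt_top_iff_ne_top.2 Q.volume_ne_top⟩

lemma PCube.average_eq {n : ℕ} (Q : PCube n) (f : Pt n → ℝ) :
    ⨍ p in Q.toSet, f p = (Q.len ^ (n + 2))⁻¹ * ∫ p in Q.toSet, f p := by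
  rw [setAverage_eq, Q.volume_real, smul_eq_mul]

/-- time translate -/
def PCube.shift {n : ℕ} (Q : PCube n) (d : ℝ) : PCube n :=
  ⟨Q.corner, Q.time + d, Q.len, Q.len_pos⟩

/-- dilation fixing the corner -/
def PCube.dil {n : ℕ} (Q : PCube n) (k : ℕ) : PCube n :=
  ⟨Q.corner, Q.time, 2 ^ k * Q.len, mul_pos (by positivity) Q.len_pos⟩

lemma bmo_step {n : ℕ} {D : Pt n → ℝ} (hD : ∀ Q : PCube n, IntegrableOn D Q.toSet)
    (hB : ParabBMOLe D 1) (Q Q' : PCube n) (hs : Q.toSet ⊆ Q'.toSet) (hl : Q'.len = 2 * Q.len) :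
    |(⨍ p in Q.toSet, D p) - ⨍ p in Q'.toSet, D p| ≤ 2 ^ (n + 2) := by
  have h := hB Q'
  set c := ⨍ p in Q'.toSet, D p
  have hq : 0 < Q.len ^ (n + 2) := pow_pos Q.len_pos _
  have i' : IntegrableOn (fun p => |D p - c|) Q'.toSet :=
    ((hD Q').sub (integrableOn_const (Q'.volume_ne_top))).abs
  have e : (⨍ p in Q.toSet, D p) - c = (Q.len ^ (n + 2))⁻¹ * ∫ p in Q.toSet, (D p - c) := by
    rw [Q.average_eq, integral_sub (hD Q) (integrableOn_const (Q.volume_ne_top)),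
      setIntegral_const, Q.volume_real, smul_eq_mul]
    field_simp
  rw [e, abs_mul, abs_of_pos (inv_pos.2 hq)]
  rw [Q'.average_eq, hl, mul_pow] at h
  have h1 : |∫ p in Q.toSet, (D p - c)| ≤ ∫ p in Q'.toSet, |D p - c| :=
    (abs_integral_le_integral_abs).trans
      (setIntegral_mono_set i' (Filter.Eventually.of_forall fun p => abs_nonneg _)
        (Filter.Eventually.of_forall hs))
  rw [inv_mul_le_iff₀ (by positivity)] at h
  rw [inv_mul_le_iff₀ hq]
  linarith

lemma PCube.dil_subset {n : ℕ} (Q : PCube n) (k : ℕ) : (Q.dil k).toSet ⊆ (Q.dil (k + 1)).toSet := by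
  have := Q.len_pos
  have h1 : 2 ^ k * Q.len ≤ 2 ^ (k + 1) * Q.len := by gcongr <;> norm_num
  have h2 : (2 ^ k * Q.len) ^ 2 ≤ (2 ^ (k + 1) * Q.len) ^ 2 := by gcongr
  rintro p ⟨hp, hp2⟩
  refine ⟨fun i => ⟨(hp i).1, (hp i).2.trans ?_⟩, hp2.1, hp2.2.trans ?_⟩ <;>
  simp only [PCube.dil] <;> linarith

lemma bmo_dil {n : ℕ} {D : Pt n → ℝ} (hD : ∀ Q : PCube n, IntegrableOn D Q.toSet)
    (hB : ParabBMOLe D 1) (Q : PCube n) (k : ℕ) :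
    |(⨍ p in Q.toSet, D p) - ⨍ p in (Q.dil k).toSet, D p| ≤ k * 2 ^ (n + 2) := by
  induction k with
  | zero => simp [PCube.dil, PCube.toSet]
  | succ k ih =>
    have h := bmo_step hD hB (Q.dil k) (Q.dil (k + 1)) (Q.dil_subset k) (by simp [PCube.dil]; ring)
    have := abs_sub_le (⨍ p in Q.toSet, D p) (⨍ p in (Q.dil k).toSet, D p)
      (⨍ p in (Q.dil (k+1)).toSet, D p)
    push_cast
    linarith

lemma bmo_shift {n : ℕ} {D : Pt n → ℝ} (hD : ∀ Q : PCube n, IntegrableOn D Q.toSet)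
    (hB : ParabBMOLe D 1) (Q : PCube n) (d : ℝ) (hd : 0 ≤ d) :
    |(⨍ p in Q.toSet, D p) - ⨍ p in (Q.shift d).toSet, D p| ≤
      5 * 2 ^ (n + 2) * (1 + (d / Q.len ^ 2) ^ (1 / 4 : ℝ)) := by
  have hl := Q.len_pos
  set x := d / Q.len ^ 2 with hx
  have hx0 : 0 ≤ x := by positivity
  set y := x ^ (1 / 4 : ℝ) with hy
  have hy0 : 0 ≤ y := by positivity
  have hy4 : y ^ 4 = x := by
    rw [hy, ← Real.rpow_natCast, ← Real.rpow_mul hx0]; norm_num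
  have hex : ∃ k : ℕ, x ≤ 4 ^ k := by
    obtain ⟨k, hk⟩ := pow_unbounded_of_one_lt x (by norm_num : (1 : ℝ) < 4)
    exact ⟨k, hk.le⟩
  classical
  set k := Nat.find hex with hk
  have hk1 : x ≤ 4 ^ k := Nat.find_spec hex
  have hk2 : (2 * k + 2 : ℝ) ≤ 5 * (1 + y) := by
    rcases Nat.eq_zero_or_pos k with h0 | h0
    · rw [h0]; push_cast; linarith
    · have h1 : ¬ x ≤ 4 ^ (k - 1) := Nat.find_min hex (by omega)
      push Not at h1
      obtain ⟨m, hm⟩ : ∃ m, k = m + 1 := ⟨k - 1, by omega⟩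
      rw [hm] at h1 ⊢
      simp only [Nat.add_sub_cancel] at h1
      have h2 : (1 + m * 0.4 : ℝ) ≤ y := by
        by_contra hc
        push Not at hc
        have b := one_add_mul_le_pow (by norm_num : (-2 : ℝ) ≤ 0.4) m
        have : y ^ 4 ≤ ((1 + 0.4 : ℝ) ^ m) ^ 4 := by gcongr; linarith
        rw [hy4, ← pow_mul, mul_comm, pow_mul] at this
        have h3 : ((1 + 0.4 : ℝ) ^ 4) ^ m ≤ 4 ^ m := by gcongr; norm_num
        linarith
      push_cast
      linarith
  have hsub : ((Q.shift d).dil k).toSet ⊆ (Q.dil (k + 1)).toSet := by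
    have h1 : 2 ^ k * Q.len ≤ 2 ^ (k + 1) * Q.len := by gcongr <;> norm_num
    have h2 : d + (2 ^ k * Q.len) ^ 2 ≤ (2 ^ (k + 1) * Q.len) ^ 2 := by
      have : d ≤ 4 ^ k * Q.len ^ 2 := by
        rw [← div_le_iff₀ (by positivity)]; exact hk1
      have e : ((4 : ℝ) ^ k) = (2 ^ k) ^ 2 := by rw [← pow_mul, mul_comm, pow_mul]; norm_num
      rw [e] at this
      have h3 : 0 ≤ ((2 : ℝ) ^ k) ^ 2 * Q.len ^ 2 := by positivity
      rw [pow_succ (2 : ℝ) k]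
      nlinarith
    rintro p ⟨hp, hp2⟩
    refine ⟨fun i => ⟨(hp i).1, (hp i).2.trans ?_⟩, le_trans ?_ hp2.1, hp2.2.trans ?_⟩ <;>
    simp only [PCube.dil, PCube.shift] <;> linarith
  have s1 := bmo_dil hD hB Q (k + 1)
  have s2 := bmo_dil hD hB (Q.shift d) k
  have s3 := bmo_step hD hB _ _ hsub (by simp [PCube.dil, PCube.shift]; ring)
  rw [abs_le] at *
  push_cast at *
  have hp : (0 : ℝ) < 2 ^ (n + 2) := by positivity
  have := mul_le_mul_of_nonneg_right hk2 hp.le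
  constructor <;> linarith [s1.1, s1.2, s2.1, s2.2, s3.1, s3.2]

lemma halfT_eq_E1 {n : ℕ} (F : Pt n → ℝ) (p : Pt n) :
    halfT F p = E1 (fun s => F (p.1, s)) p.2 := by
  unfold halfT E1
  rw [← integral_add_left_eq_self _ p.2]
  simp


open Filter Topology

/-- The filter `|t| → ∞`. -/
def absTop : Filter ℝ := Filter.comap (fun t : ℝ => |t|) Filter.atTop

instance : absTop.IsCountablyGenerated := by unfold absTop; infer_instance

lemma absTop_basis {G : ℝ → ℝ} (h : Filter.Tendsto G absTop (nhds 0)) :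
    ∀ η > 0, ∃ T : ℝ, ∀ t, T < |t| → |G t| < η := by
  intro η hη
  have := (Metric.tendsto_nhds.1 h) η hη
  simp only [dist_zero_right, Real.norm_eq_abs] at this
  unfold absTop at this
  rw [Filter.eventually_comap] at this
  obtain ⟨T, hT⟩ := Filter.eventually_atTop.1 this
  exact ⟨T, fun t ht => hT |t| ht.le t rfl⟩

/-- time translation is measure preserving -/
lemma shift_setIntegral {n : ℕ} (Q : PCube n) (f : Pt n → ℝ) (t : ℝ) :
    ∫ q in Q.toSet, f (q.1, q.2 + t) = ∫ q in (Q.shift t).toSet, f q := by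
  have hm : MeasurePreserving (fun q : Pt n => q + ((0 : Spc n), t)) volume volume :=
    measurePreserving_add_right _ _
  have he : MeasurableEmbedding (fun q : Pt n => q + ((0 : Spc n), t)) :=
    measurableEmbedding_addRight _
  have e : Q.toSet = (fun q : Pt n => q + ((0 : Spc n), t)) ⁻¹' (Q.shift t).toSet := by
    ext p; simp [PCube.toSet, PCube.shift]
    intro h h2
    constructor <;> intro h3 <;> linarith
  rw [← hm.setIntegral_preimage_emb he f, ← e]
  refine setIntegral_congr_fun Q.measurable fun q _ => ?_
  change f _ = f _
  congr 1
  ext1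
  · exact (add_zero q.1).symm
  · rfl

lemma nice_E1_bound {n : ℕ} {F : Pt n → ℝ} {B L : ℝ} (hB : ∀ p, |F p| ≤ B)
    (hL : ∀ p q : Pt n, |F p - F q| ≤ ‖p.1 - q.1‖ + L * |p.2 - q.2|) (x : Spc n) (t ρ : ℝ) :
    |(F (x, t + ρ) - F (x, t)) / |ρ| ^ (3 / 2 : ℝ)| ≤ max (2 * B) L * mker 1 ρ := by
  apply div_ker_le
  · calc |F (x, t + ρ) - F (x, t)| ≤ |F (x, t + ρ)| + |F (x, t)| := abs_sub _ _
      _ ≤ 2 * B := by linarith [hB (x, t + ρ), hB (x, t)]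
      _ ≤ _ := le_max_left _ _
  · calc |F (x, t + ρ) - F (x, t)| ≤ ‖x - x‖ + L * |t + ρ - t| := hL _ _
      _ = L * (|ρ| / 1) := by simp
      _ ≤ _ := by gcongr; exact le_max_right _ _

lemma nice_cont {n : ℕ} {F : Pt n → ℝ} {L : ℝ}
    (hL : ∀ p q : Pt n, |F p - F q| ≤ ‖p.1 - q.1‖ + L * |p.2 - q.2|) : Continuous F := by
  have : LipschitzWith (1 + |L|).toNNReal F := by
    apply LipschitzWith.of_dist_le_mul
    intro p q
    rw [Real.dist_eq, Real.coe_toNNReal _ (by positivity), dist_eq_norm, Prod.norm_def]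
    have h1 := le_max_left ‖(p - q).1‖ ‖(p - q).2‖
    have h2 := le_max_right ‖(p - q).1‖ ‖(p - q).2‖
    set m := max ‖(p - q).1‖ ‖(p - q).2‖
    have h3 := hL p q
    simp only [Prod.fst_sub, Prod.snd_sub, Real.norm_eq_abs] at h1 h2
    have h4 : L * |p.2 - q.2| ≤ |L| * m :=
      mul_le_mul (le_abs_self L) h2 (abs_nonneg _) (abs_nonneg _)
    linarith
  exact this.continuous

lemma sbox_dist {n : ℕ} {x y : Spc n} {l : ℝ} (hl : 0 ≤ l) (h : ∀ i, |x i - y i| ≤ l) :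
    ‖x - y‖ ≤ √n * l := by
  rw [EuclideanSpace.norm_eq]
  calc √(∑ i, ‖(x - y) i‖ ^ 2) ≤ √(∑ i : Fin n, l ^ 2) := by
        apply Real.sqrt_le_sqrt
        apply Finset.sum_le_sum
        intro i _
        have := h i
        simp only [PiLp.sub_apply, Real.norm_eq_abs]
        gcongr
    _ = _ := by simp [Real.sqrt_mul, Real.sqrt_sq hl]

theorem nice_half (n : ℕ) : ∃ C : ℝ, 0 < C ∧ ∀ (F : Pt n → ℝ) (B L : ℝ), (∀ p, |F p| ≤ B) →
    (∀ p q : Pt n, |F p - F q| ≤ ‖p.1 - q.1‖ + L * |p.2 - q.2|) →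
    (∀ x, Tendsto (fun t => F (x, t)) absTop (𝓝 0)) →
    ParabBMOLe (halfT F) 1 →
    ∀ x t u, |F (x, t) - F (x, u)| ≤ C * √|t - u| := by
  obtain ⟨C0, hC0, hmp⟩ := maxprin
  set A : ℝ := 5 * 2 ^ (n + 2) with hA
  have hA0 : 0 < A := by positivity
  refine ⟨2 * (√n + 3 * C0 * A) + 1, by positivity, ?_⟩
  intro F B L hB hL h0 hbmo
  have hcont := nice_cont hL
  have hD : ∀ Q : PCube n, IntegrableOn (halfT F) Q.toSet := by
    intro Q
    have hmeas : StronglyMeasurable (halfT F) := by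
      have : halfT F = fun p => E1 (fun s => F (p.1, s)) p.2 := funext (halfT_eq_E1 F)
      rw [this]; unfold E1
      apply StronglyMeasurable.integral_prod_right
      apply Measurable.stronglyMeasurable
      have := hcont.measurable
      fun_prop
    apply Integrable.mono' (integrable_const (∫ ρ, max (2 * B) L * mker 1 ρ)) hmeas.aestronglyMeasurable
    refine Eventually.of_forall fun p => ?_
    rw [halfT_eq_E1]
    exact norm_integral_le_of_norm_le ((mker_integrable one_pos).const_mul _)
      (Eventually.of_forall fun ρ => nice_E1_bound hB hL p.1 p.2 ρ)
  have hL0 : 0 ≤ |L| := abs_nonneg L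
  -- crude bound
  have hB0 : 0 ≤ B := (abs_nonneg _).trans (hB 0)
  have crude : ∀ x t u, |F (x, t) - F (x, u)| ≤ (2 * B + |L|) * √|t - u| := by
    intro x t u
    have h1 : |F (x, t) - F (x, u)| ≤ 2 * B :=
      (abs_sub _ _).trans (by linarith [hB (x, t), hB (x, u)])
    have h2 : |F (x, t) - F (x, u)| ≤ |L| * |t - u| := by
      have := hL (x, t) (x, u)
      simp only [sub_self, norm_zero, zero_add] at this
      exact this.trans (by gcongr; exact le_abs_self L)
    have hs := Real.sq_sqrt (abs_nonneg (t - u))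
    have hs0 := Real.sqrt_nonneg |t - u|
    rcases le_total 1 (√|t - u|) with h | h
    · nlinarith
    · rw [← hs] at h2
      nlinarith
  -- improvement
  have step : ∀ M0 : ℝ, 0 ≤ M0 → (∀ x t u, |F (x, t) - F (x, u)| ≤ M0 * √|t - u|) →
      ∀ x t u, |F (x, t) - F (x, u)| ≤ (M0 / 2 + (√n / 2 + 3 * C0 * A)) * √|t - u| := by
    intro M0 hM0 hM x
    suffices hone : ∀ t u, F (x, t) - F (x, u) ≤ (M0 / 2 + (√n / 2 + 3 * C0 * A)) * √|t - u| by
      intro t u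
      rw [abs_le]
      have := hone u t
      rw [abs_sub_comm] at this
      exact ⟨by linarith, hone t u⟩
    intro t u
    rcases eq_or_ne t u with rfl | htu
    · simp
    set d := |t - u| with hd
    have hd0 : 0 < d := abs_pos.2 (sub_ne_zero.2 htu)
    have hl : 0 < √d / 4 := by positivity
    set l := √d / 4 with hldef
    set Q : PCube n := ⟨fun i => x i, 0, l, hl⟩ with hQ
    have : IsProbabilityMeasure ((volume.restrict Q.toSet univ)⁻¹ • volume.restrict Q.toSet) := by
      have : NeZero (volume.restrict Q.toSet) :=
        ⟨by intro h; exact Q.volume_ne_zero (Measure.restrict_eq_zero.1 h)⟩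
      infer_instance
    set P := (volume.restrict Q.toSet univ)⁻¹ • volume.restrict Q.toSet with hP
    have hPae : ∀ᵐ q ∂P, q ∈ Q.toSet := by
      have : P ≪ volume.restrict Q.toSet := Measure.smul_absolutelyContinuous
      exact this.ae_le (ae_restrict_mem Q.measurable)
    set G : ℝ → ℝ := fun t => ∫ q, F (q.1, q.2 + t) ∂P with hG
    have h_integrable : ∀ t, Integrable (fun q : Pt n => F (q.1, q.2 + t)) P := fun t =>
      Integrable.mono' (integrable_const B)
        (Continuous.aestronglyMeasurable (by fun_prop)) (Eventually.of_forall fun q => hB _)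
    have bnd : ∀ (f : Pt n → ℝ) (c : ℝ), (∀ q ∈ Q.toSet, |f q| ≤ c) → |∫ q, f q ∂P| ≤ c := by
      intro f c hf
      have := norm_integral_le_of_norm_le_const (μ := P) (f := f) (C := c)
        (by filter_upwards [hPae] with q hq using hf q hq)
      simpa using this
    have hGB : ∀ t, |G t| ≤ B := fun t => bnd _ _ fun q _ => hB _
    have hGL : ∀ t u, |G t - G u| ≤ |L| * |t - u| := by
      intro t u
      simp only [hG]
      rw [← integral_sub (h_integrable t) (h_integrable u)]
      apply bnd
      intro q _
      have := hL (q.1, q.2 + t) (q.1, q.2 + u)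
      simp only [sub_self, norm_zero, zero_add, add_sub_add_left_eq_sub] at this
      exact this.trans (by gcongr; exact le_abs_self L)
    have hGc : Continuous G := by
      have : LipschitzWith (|L|).toNNReal G := by
        apply LipschitzWith.of_dist_le_mul
        intro p q
        rw [Real.dist_eq, Real.dist_eq, Real.coe_toNNReal _ hL0]
        exact hGL p q
      exact this.continuous
    have hG0 : Tendsto G absTop (𝓝 0) := by
      have : Tendsto G absTop (𝓝 (∫ q : Pt n, (0 : ℝ) ∂P)) := by
        apply tendsto_integral_filter_of_dominated_convergence (fun _ => B)
        · exact Eventually.of_forall fun t => (h_integrable t).aestronglyMeasurable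
        · exact Eventually.of_forall fun t => Eventually.of_forall fun q => hB _
        · exact integrable_const _
        · refine Eventually.of_forall fun q => ?_
          refine (h0 q.1).comp ?_
          unfold absTop
          rw [tendsto_comap_iff]
          have h1 : Tendsto (fun t : ℝ => |t|) (comap (fun t : ℝ => |t|) atTop) atTop :=
            tendsto_comap
          refine tendsto_atTop_mono' _ ?_ (tendsto_atTop_add_const_right _ (-|q.2|) h1)
          refine Eventually.of_forall fun t => ?_
          have := abs_sub_abs_le_abs_sub t (-q.2)
          rw [abs_neg, sub_neg_eq_add, add_comm t] at this
          simpa [sub_eq_add_neg] using this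
      simpa using this
    have hE : ∀ t, E1 G t = ⨍ q in (Q.shift t).toSet, halfT F q := by
      intro t
      have e1 : ⨍ q in (Q.shift t).toSet, halfT F q = ∫ q, halfT F (q.1, q.2 + t) ∂P := by
        rw [PCube.average_eq, ← shift_setIntegral, show (Q.shift t).len = Q.len from rfl,
          ← Q.average_eq]; rfl
      rw [e1]
      have e2 : ∀ q : Pt n, halfT F (q.1, q.2 + t) =
          ∫ ρ, (F (q.1, q.2 + t + ρ) - F (q.1, q.2 + t)) / |ρ| ^ (3 / 2 : ℝ) := fun q => by
        rw [halfT_eq_E1]; rfl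
      simp_rw [e2]
      rw [integral_integral_swap]
      · unfold E1
        congr 1
        funext ρ
        simp only [hG]
        rw [← integral_sub (h_integrable _) (h_integrable _), ← integral_div]
        simp only [add_assoc]
      · refine Integrable.mono' (g := fun z : Pt n × ℝ => 1 * (max (2 * B) L * mker 1 z.2)) ?_ ?_ ?_
        · exact Integrable.mul_prod (f := fun _ : Pt n => (1 : ℝ)) (integrable_const 1)
            ((mker_integrable one_pos).const_mul _)
        · apply Measurable.aestronglyMeasurable
          have := hcont.measurable
          simp only [Function.uncurry_def]
          fun_prop
        · refine Eventually.of_forall fun z => ?_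
          rw [one_mul]
          exact nice_E1_bound hB hL z.1.1 (z.1.2 + t) z.2
    have hEE : ∀ t u, |E1 G t - E1 G u| ≤ A * (1 + (l ^ (-(1 / 2) : ℝ)) * |t - u| ^ (1 / 4 : ℝ)) := by
      have key : ∀ t u, u ≤ t → |E1 G t - E1 G u| ≤
          A * (1 + (l ^ (-(1 / 2) : ℝ)) * |t - u| ^ (1 / 4 : ℝ)) := by
        intro t u hut
        rw [hE, hE, abs_sub_comm]
        have hsh : Q.shift t = (Q.shift u).shift (t - u) := by
          simp [PCube.shift]
        rw [hsh]
        refine (bmo_shift hD hbmo (Q.shift u) (t - u) (by linarith)).trans (le_of_eq ?_)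
        rw [hA, abs_of_nonneg (by linarith : (0:ℝ) ≤ t - u)]
        congr 2
        show ((t - u) / l ^ 2) ^ (1 / 4 : ℝ) = _
        rw [Real.div_rpow (by linarith) (by positivity), Real.rpow_neg hl.le,
          ← Real.rpow_natCast, ← Real.rpow_mul hl.le]
        norm_num
        rw [div_eq_inv_mul]
      intro t u
      rcases le_total u t with h | h
      · exact key t u h
      · rw [abs_sub_comm (E1 G t), abs_sub_comm t]; exact key u t h
    have hfin := hmp G B |L| hGB hGL hGc (absTop_basis hG0) A (l ^ (-(1 / 2) : ℝ)) hA0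
      (by positivity) hEE t u
    rw [← hd] at hfin
    have clos : ∀ t, |F (x, t) - G t| ≤ (√n + M0) * l := by
      intro t
      have : F (x, t) - G t = ∫ q, (F (x, t) - F (q.1, q.2 + t)) ∂P := by
        rw [integral_sub (integrable_const _) (h_integrable t)]; simp [hG]
      rw [this]
      apply bnd
      intro q hq
      have h1 : |F (x, t) - F (q.1, t)| ≤ √n * l := by
        have := hL (x, t) (q.1, t)
        simp only [sub_self, abs_zero, mul_zero, add_zero] at this
        refine this.trans (sbox_dist hl.le fun i => ?_)
        have := hq.1 i
        simp only [hQ] at this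
        rw [abs_le]; constructor <;> linarith [this.1, this.2]
      have h2 : |F (q.1, t) - F (q.1, q.2 + t)| ≤ M0 * l := by
        refine (hM q.1 t (q.2 + t)).trans ?_
        gcongr
        apply Real.sqrt_le_iff.2 ⟨hl.le, ?_⟩
        have := hq.2
        simp only [hQ] at this
        rw [abs_le]; constructor <;> nlinarith [this.1, this.2]
      have := abs_sub_le (F (x, t)) (F (q.1, t)) (F (q.1, q.2 + t))
      linarith
    have c1 := clos t
    have c2 := clos u
    rw [abs_le] at c1 c2
    have hr : d ^ (1 / 2 : ℝ) + l ^ (-(1 / 2) : ℝ) * d ^ (3 / 4 : ℝ) = 3 * √d := by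
      have e1 : d = √d ^ (2 : ℝ) := by
        rw [Real.rpow_two, Real.sq_sqrt hd0.le]
      have e2 : d ^ (3 / 4 : ℝ) = √d ^ (3 / 2 : ℝ) := by
        conv_lhs => rw [e1]
        rw [← Real.rpow_mul (Real.sqrt_nonneg d)]; norm_num
      have e3 : l ^ (-(1 / 2) : ℝ) = 2 * √d ^ (-(1 / 2) : ℝ) := by
        rw [hldef, Real.div_rpow (Real.sqrt_nonneg d) (by norm_num), show (4 : ℝ) = 2 ^ (2 : ℝ) by norm_num,
          ← Real.rpow_mul (by norm_num)]
        norm_num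
        ring
      rw [e2, e3, mul_assoc, ← Real.rpow_add (by positivity), ← Real.sqrt_eq_rpow]
      norm_num
      ring
    rw [hr] at hfin
    rw [hldef] at c1 c2
    nlinarith [c1.1, c1.2, c2.1, c2.2]
  -- iterate : the infimum of admissible M0
  intro x t u
  set K := √n / 2 + 3 * C0 * A with hK
  have hK0 : 0 ≤ K := by positivity
  have iter : ∀ k : ℕ, ∀ x t u, |F (x, t) - F (x, u)| ≤
      ((2 * B + |L|) / 2 ^ k + 2 * K) * √|t - u| := by
    intro k
    induction k with
    | zero =>
      intro x t u
      refine (crude x t u).trans ?_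
      refine mul_le_mul_of_nonneg_right ?_ (Real.sqrt_nonneg _)
      rw [pow_zero, div_one]; linarith
    | succ k ih =>
      intro x t u
      refine (step _ (by positivity) ih x t u).trans (le_of_eq ?_)
      rw [pow_succ]; ring
  obtain ⟨k, hk⟩ := pow_unbounded_of_one_lt (2 * B + |L|) (by norm_num : (1 : ℝ) < 2)
  refine (iter k x t u).trans ?_
  refine mul_le_mul_of_nonneg_right ?_ (Real.sqrt_nonneg _)
  have : (2 * B + |L|) / 2 ^ k ≤ 1 := by
    rw [div_le_one (by positivity)]; exact hk.le
  have hs := Real.sqrt_nonneg (n : ℝ)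
  rw [hK]
  linarith

lemma heatW_nonneg {n : ℕ} (p : Pt n) : 0 ≤ heatW p := by
  unfold heatW; split_ifs with h
  · positivity
  · exact le_rfl

lemma heatW_measurable {n : ℕ} : Measurable (heatW : Pt n → ℝ) := by
  unfold heatW
  refine Measurable.ite (measurableSet_lt measurable_const measurable_snd) ?_ measurable_const
  fun_prop

lemma gradW_measurable {n : ℕ} : Measurable (gradW : Pt n → Spc n) := by
  unfold gradW
  refine Measurable.ite (measurableSet_lt measurable_const measurable_snd) ?_ measurable_const
  fun_prop

lemma heatW_of_nonpos {n : ℕ} (x : Spc n) {t : ℝ} (ht : t ≤ 0) : heatW (x, t) = 0 := by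
  simp [heatW, not_lt.2 ht]

lemma heatW_integral {n : ℕ} {t : ℝ} (ht : 0 < t) : ∫ x : Spc n, heatW (x, t) = 1 := by
  have hb : 0 < 1 / (4 * t) := by positivity
  have h := GaussianFourier.integral_rexp_neg_mul_sq_norm (V := Spc n) hb
  have e : ∀ x : Spc n, heatW (x, t) = (4 * π * t) ^ (-(n : ℝ) / 2) * rexp (-(1 / (4 * t)) * ‖x‖ ^ 2) := by
    intro x
    simp only [heatW, ht, if_true]
    congr 2; ring
  simp_rw [e]
  rw [integral_const_mul, h]
  simp only [finrank_euclideanSpace, Fintype.card_fin]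
  rw [show π / (1 / (4 * t)) = 4 * π * t by field_simp, ← Real.rpow_add (by positivity)]
  ring_nf
  simp

lemma heatW_integrable {n : ℕ} (t : ℝ) : Integrable (fun x : Spc n => heatW (x, t)) := by
  rcases lt_or_ge 0 t with ht | ht
  · exact Integrable.of_integral_ne_zero (by rw [heatW_integral ht]; norm_num)
  · simp only [heatW_of_nonpos _ ht]; exact integrable_zero _ _ _

lemma heatW_lintegral_le {n : ℕ} (t : ℝ) : ∫⁻ x : Spc n, ENNReal.ofReal (heatW (x, t)) ≤ 1 := by
  rcases lt_or_ge 0 t with ht | ht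
  · rw [← ofReal_integral_eq_lintegral_ofReal (heatW_integrable t)
      (Eventually.of_forall fun x => heatW_nonneg _), heatW_integral ht]; simp
  · simp [heatW_of_nonpos _ ht]

lemma gradW_norm_le {n : ℕ} (x : Spc n) {t : ℝ} (ht : 0 < t) :
    ‖gradW (x, t)‖ ≤ 2 ^ ((n : ℝ) / 2) * (1 / √t) * heatW (x, 2 * t) := by
  have h2 : 0 < 2 * t := by positivity
  simp only [gradW, heatW, ht, h2, if_true]
  rw [norm_smul, Real.norm_eq_abs, abs_mul, abs_mul, abs_neg, abs_of_pos (by positivity : 0 < 1 / (2 * t)),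
    abs_of_pos (by positivity : 0 < (4 * π * t) ^ (-(n : ℝ) / 2)), abs_of_pos (Real.exp_pos _)]
  have e1 : (4 * π * (2 * t)) ^ (-(n : ℝ) / 2) = 2 ^ (-((n : ℝ) / 2)) * (4 * π * t) ^ (-(n : ℝ) / 2) := by
    rw [show 4 * π * (2 * t) = 2 * (4 * π * t) by ring, Real.mul_rpow (by norm_num) (by positivity),
      neg_div]
  have e2 : rexp (-‖x‖ ^ 2 / (4 * t)) = rexp (-‖x‖ ^ 2 / (4 * (2 * t))) * rexp (-(‖x‖ ^ 2 / (8 * t))) := by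
    rw [← Real.exp_add]; congr 1; field_simp; ring
  have e3 : ‖x‖ * rexp (-(‖x‖ ^ 2 / (8 * t))) ≤ 2 * √t := by
    rw [Real.exp_neg, ← div_eq_mul_inv, div_le_iff₀ (Real.exp_pos _)]
    have h1 := Real.add_one_le_exp (‖x‖ ^ 2 / (8 * t))
    have hs : 0 < √t := Real.sqrt_pos.2 ht
    have hsq := Real.sq_sqrt ht.le
    calc ‖x‖ ≤ 2 * √t * (‖x‖ ^ 2 / (8 * t) + 1) := by
          rw [← hsq]; field_simp
          rw [Real.sqrt_sq hs.le]
          nlinarith [sq_nonneg (‖x‖ - 2 * √t), norm_nonneg x]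
      _ ≤ _ := by gcongr
  rw [e1, e2]
  have e4 : (2 : ℝ) ^ ((n : ℝ) / 2) * 2 ^ (-((n : ℝ) / 2)) = 1 := by
    rw [← Real.rpow_add (by norm_num)]; simp
  set a := (4 * π * t) ^ (-(n : ℝ) / 2)
  set b := rexp (-‖x‖ ^ 2 / (4 * (2 * t)))
  have ha : 0 < a := by positivity
  have hb : 0 < b := Real.exp_pos _
  calc 1 / (2 * t) * a * (b * rexp (-(‖x‖ ^ 2 / (8 * t)))) * ‖x‖
      = 1 / (2 * t) * a * b * (‖x‖ * rexp (-(‖x‖ ^ 2 / (8 * t)))) := by ring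
    _ ≤ 1 / (2 * t) * a * b * (2 * √t) := by gcongr
    _ = (2 ^ ((n : ℝ) / 2) * 2 ^ (-((n : ℝ) / 2))) * (1 / √t) * (a * b) := by
        rw [e4]
        have hs : 0 < √t := Real.sqrt_pos.2 ht
        have hsq := Real.sq_sqrt ht.le
        field_simp
        nlinarith
    _ = _ := by ring

lemma gradW_lintegral_le {n : ℕ} (t : ℝ) (ht : t ≠ 0) :
    ∫⁻ x : Spc n, ENNReal.ofReal ‖gradW (x, t)‖ ≤
      ENNReal.ofReal (2 ^ ((n : ℝ) / 2)) * ENNReal.ofReal (1 / √|t|) := by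
  rcases lt_or_gt_of_ne ht with h | h
  · have : ∀ x : Spc n, gradW (x, t) = 0 := fun x => by simp [gradW, not_lt.2 h.le]
    simp [this]
  · rw [abs_of_pos h, ← ENNReal.ofReal_mul (by positivity)]
    calc ∫⁻ x : Spc n, ENNReal.ofReal ‖gradW (x, t)‖
        ≤ ∫⁻ x : Spc n, ENNReal.ofReal (2 ^ ((n : ℝ) / 2) * (1 / √t)) *
            ENNReal.ofReal (heatW (x, 2 * t)) := by
          gcongr with x
          rw [← ENNReal.ofReal_mul (by positivity)]
          exact ENNReal.ofReal_le_ofReal (gradW_norm_le x h)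
      _ ≤ ENNReal.ofReal (2 ^ ((n : ℝ) / 2) * (1 / √t)) * 1 := by
          rw [lintegral_const_mul' _ _ ENNReal.ofReal_ne_top]
          gcongr
          exact heatW_lintegral_le _
      _ = _ := mul_one _

lemma heatW_diff_aux {n : ℕ} {s t : ℝ} (hs : 0 < s) (hst : s ≤ t) :
    ∫ x : Spc n, |heatW (x, s) - heatW (x, t)| ≤ 2 * ((t / s) ^ n - 1) := by
  have ht : 0 < t := hs.trans_le hst
  set R := (t / s) ^ n with hR
  have h1 : 1 ≤ t / s := by rw [le_div_iff₀ hs]; linarith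
  have hR1 : 1 ≤ R := one_le_pow₀ h1
  have hle : ∀ x : Spc n, heatW (x, s) ≤ R * heatW (x, t) := by
    intro x
    simp only [heatW, hs, ht, if_true]
    rw [← mul_assoc]
    have e : (4 * π * s) ^ (-(n : ℝ) / 2) ≤ R * (4 * π * t) ^ (-(n : ℝ) / 2) := by
      have : (4 * π * s) ^ (-(n : ℝ) / 2) = (t / s) ^ ((n : ℝ) / 2) * (4 * π * t) ^ (-(n : ℝ) / 2) := by
        rw [show 4 * π * s = (t / s)⁻¹ * (4 * π * t) by field_simp,
          Real.mul_rpow (by positivity) (by positivity), Real.inv_rpow (by positivity), neg_div,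
          Real.rpow_neg (by positivity), inv_inv]
      rw [this]
      gcongr
      rw [hR, ← Real.rpow_natCast]
      apply Real.rpow_le_rpow_of_exponent_le h1
      have : (0 : ℝ) ≤ n := Nat.cast_nonneg n
      linarith
    gcongr ?_ * ?_
    apply Real.exp_le_exp.2
    rw [neg_div, neg_div]
    apply neg_le_neg
    gcongr
  have i1 := heatW_integrable (n := n) s
  have i2 := heatW_integrable (n := n) t
  calc ∫ x : Spc n, |heatW (x, s) - heatW (x, t)|
      ≤ ∫ x : Spc n, ((2 * R - 1) * heatW (x, t) - heatW (x, s)) := by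
        refine integral_mono (i1.sub i2).abs ((i2.const_mul _).sub i1) fun x => ?_
        simp only
        have := hle x
        have h0 := heatW_nonneg (x, t)
        rw [abs_le]; constructor <;> nlinarith
    _ = 2 * (R - 1) := by
        rw [integral_sub (i2.const_mul _) i1, integral_const_mul, heatW_integral ht, heatW_integral hs]
        ring

lemma pow_aux (n : ℕ) {y : ℝ} (h0 : 0 ≤ y) (h1 : y ≤ 1) : (1 + 2 * y) ^ n ≤ 1 + y * (3 ^ n - 1) := by
  induction n with
  | zero => simp
  | succ k ih =>
    have : (1 : ℝ) ≤ 3 ^ k := one_le_pow₀ (by norm_num)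
    rw [pow_succ, pow_succ]
    nlinarith [mul_nonneg h0 (by linarith : (0 : ℝ) ≤ 3 ^ k - 1),
      mul_nonneg (mul_nonneg h0 (by linarith : (0 : ℝ) ≤ 3 ^ k - 1)) (by linarith : 0 ≤ 1 - y)]

lemma heatW_diff_le {n : ℕ} {s t : ℝ} (ht : t ≠ 0) :
    ∫ x : Spc n, |heatW (x, s) - heatW (x, t)| ≤ 4 * 3 ^ n * min 1 (|s - t| / |t|) := by
  have i1 := heatW_integrable (n := n) s
  have i2 := heatW_integrable (n := n) t
  have h3 : (1 : ℝ) ≤ 3 ^ n := one_le_pow₀ (by norm_num)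
  have le1 : ∀ s : ℝ, ∫ x : Spc n, heatW (x, s) ≤ 1 := by
    intro s
    rcases lt_or_ge 0 s with h | h
    · rw [heatW_integral h]
    · simp [heatW_of_nonpos _ h]
  have two : ∫ x : Spc n, |heatW (x, s) - heatW (x, t)| ≤ 2 := by
    calc _ ≤ ∫ x : Spc n, (heatW (x, s) + heatW (x, t)) := by
          refine integral_mono (i1.sub i2).abs (i1.add i2) fun x => ?_
          simp only
          refine (abs_sub _ _).trans ?_
          rw [abs_of_nonneg (heatW_nonneg _), abs_of_nonneg (heatW_nonneg _)]
      _ ≤ 2 := by rw [integral_add i1 i2]; linarith [le1 s, le1 t]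
  by_cases hbig : 1 / 2 ≤ min 1 (|s - t| / |t|)
  · nlinarith
  · push Not at hbig
    have hmin : min 1 (|s - t| / |t|) = |s - t| / |t| := by
      rcases min_choice 1 (|s - t| / |t|) with h | h
      · rw [h] at hbig; norm_num at hbig
      · exact h
    rw [hmin] at hbig ⊢
    have ht0 : 0 < |t| := abs_pos.2 ht
    have hlt : |s - t| < |t| / 2 := by rw [div_lt_iff₀ ht0] at hbig; linarith
    rcases lt_or_gt_of_ne ht with h | h
    · rw [abs_of_neg h] at hlt
      have hs : s ≤ 0 := by
        have := (abs_lt.1 hlt).2; linarith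
      simp [heatW_of_nonpos _ hs, heatW_of_nonpos _ h.le]
      positivity
    · rw [abs_of_pos h] at hlt hbig ⊢
      have hs : t / 2 < s := by have := (abs_lt.1 hlt).1; linarith
      have hs0 : 0 < s := by linarith
      set y := |s - t| / t with hy
      have hy0 : 0 ≤ y := by positivity
      have hpow := pow_aux n hy0 (by linarith)
      have fin : ∀ a b : ℝ, 0 < a → a ≤ b → t / 2 ≤ a → b - a = |s - t| →
          2 * ((b / a) ^ n - 1) ≤ 4 * 3 ^ n * y := by
        intro a b ha hab hta he
        have : b / a ≤ 1 + 2 * y := by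
          rw [div_le_iff₀ ha]
          have : |s - t| = y * t := by rw [hy]; field_simp
          nlinarith
        have h4 : (b / a) ^ n ≤ (1 + 2 * y) ^ n := pow_le_pow_left₀ (div_nonneg (ha.le.trans hab) ha.le) this n
        nlinarith
      rcases le_total s t with hst | hst
      · refine (heatW_diff_aux hs0 hst).trans (fin s t hs0 hst hs.le ?_)
        rw [abs_sub_comm, abs_of_nonneg (by linarith)]
      · have := heatW_diff_aux (n := n) h hst
        simp_rw [abs_sub_comm (heatW (_, t))] at this
        refine this.trans (fin t s h hst (by linarith) ?_)
        rw [abs_of_nonneg (by linarith)]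

/-- The kernel of the absolute half time derivative of the heat kernel. -/
def heatK {n : ℕ} (p : Pt n) : ENNReal :=
  ∫⁻ ρ : ℝ, ENNReal.ofReal (|heatW (p.1, p.2 + ρ) - heatW p| / |ρ| ^ (3 / 2 : ℝ))

lemma heatK_measurable {n : ℕ} : Measurable (heatK : Pt n → ENNReal) := by
  unfold heatK
  apply Measurable.lintegral_prod_right' (f := fun z : Pt n × ℝ => ENNReal.ofReal (|heatW (z.1.1, z.1.2 + z.2) - heatW z.1| / |z.2| ^ (3 / 2 : ℝ)))
  have := heatW_measurable (n := n)
  fun_prop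

lemma heatK_lintegral_le {n : ℕ} (t : ℝ) (ht : t ≠ 0) :
    ∫⁻ x : Spc n, heatK (x, t) ≤ ENNReal.ofReal (32 * 3 ^ n) * ENNReal.ofReal (1 / √|t|) := by
  have hm := heatW_measurable (n := n)
  unfold heatK
  rw [lintegral_lintegral_swap (by
    apply Measurable.aemeasurable
    simp only [Function.uncurry_def]
    fun_prop)]
  have ht0 : 0 < |t| := abs_pos.2 ht
  calc _ ≤ ∫⁻ ρ : ℝ, ENNReal.ofReal (4 * 3 ^ n) * ENNReal.ofReal (mker |t| ρ) := by
        gcongr with ρ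
        rw [← ENNReal.ofReal_mul (by positivity)]
        have hi : Integrable (fun x : Spc n => |heatW (x, t + ρ) - heatW (x, t)| / |ρ| ^ (3 / 2 : ℝ)) :=
          ((heatW_integrable _).sub (heatW_integrable _)).abs.div_const _
        rw [← ofReal_integral_eq_lintegral_ofReal hi (Eventually.of_forall fun x => by positivity),
          integral_div]
        apply ENNReal.ofReal_le_ofReal
        unfold mker
        rw [mul_div_assoc']
        gcongr
        have := heatW_diff_le (n := n) (s := t + ρ) ht
        rwa [add_sub_cancel_left] at this
    _ = _ := by
        rw [lintegral_const_mul' _ _ ENNReal.ofReal_ne_top, mker_lintegral ht0,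
          ← ENNReal.ofReal_mul (by positivity), ← ENNReal.ofReal_mul (by positivity)]
        congr 1; ring

/-- time strip -/
def strip {n : ℕ} (a r : ℝ) : Set (Pt n) := univ ×ˢ Icc a (a + r ^ 2)

lemma strip_measurable {n : ℕ} (a r : ℝ) : MeasurableSet (strip a r : Set (Pt n)) :=
  MeasurableSet.univ.prod measurableSet_Icc

lemma lintegral_strip_conv {n : ℕ} {k : Pt n → ENNReal} (hk : Measurable k) {g : ℝ → ENNReal}
    (hkg : ∀ t : ℝ, t ≠ 0 → ∫⁻ x : Spc n, k (x, t) ≤ g t) (a r : ℝ) {M : ENNReal}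
    (hg : ∀ v, ∫⁻ t in Icc a (a + r ^ 2), g (t - v) ≤ M) (μ : Measure (Pt n)) [SFinite μ] :
    ∫⁻ p in strip a r, ∫⁻ z, k (p - z) ∂μ ≤ M * μ univ := by
  rw [lintegral_lintegral_swap (by
    apply Measurable.aemeasurable
    simp only [Function.uncurry_def]
    fun_prop)]
  rw [← lintegral_const]
  gcongr with z
  unfold strip
  rw [Measure.volume_eq_prod, ← Measure.prod_restrict, Measure.restrict_univ,
    lintegral_prod_symm' _ (by fun_prop)]
  refine le_trans ?_ (hg z.2)
  apply lintegral_mono_ae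
  refine ae_restrict_of_ae ?_
  have : ∀ᵐ t : ℝ, t ≠ z.2 := by simp [ae_iff]
  filter_upwards [this] with t ht
  have e : ∫⁻ x : Spc n, k ((x, t) - z) = ∫⁻ x : Spc n, k (x, t - z.2) := by
    rw [← lintegral_sub_right_eq_self (fun x : Spc n => k (x, t - z.2)) z.1]
    rfl
  rw [e]
  exact hkg _ (sub_ne_zero.2 ht)

lemma strip_rsqrt {n : ℕ} {k : Pt n → ENNReal} (hk : Measurable k) {c : ENNReal}
    (hkg : ∀ t : ℝ, t ≠ 0 → ∫⁻ x : Spc n, k (x, t) ≤ c * ENNReal.ofReal (1 / √|t|)) (a r : ℝ)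
    (hr : 0 < r) (μ : Measure (Pt n)) [SFinite μ] :
    ∫⁻ p in strip a r, ∫⁻ z, k (p - z) ∂μ ≤ c * ENNReal.ofReal (9 * r) * μ univ := by
  apply lintegral_strip_conv hk hkg
  intro v
  rw [lintegral_const_mul]
  · gcongr
    exact lintegral_rsqrt a v r hr
  · fun_prop

lemma strip_W {n : ℕ} (a r : ℝ) (μ : Measure (Pt n)) [SFinite μ] :
    ∫⁻ p in strip a r, ∫⁻ z, ENNReal.ofReal (heatW (p - z)) ∂μ ≤ ENNReal.ofReal (r ^ 2) * μ univ := by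
  apply lintegral_strip_conv (k := fun p => ENNReal.ofReal (heatW p)) (g := fun _ => 1)
  · have := heatW_measurable (n := n)
    fun_prop
  · intro t _
    exact heatW_lintegral_le t
  · intro v
    simp

lemma strip_gradW {n : ℕ} (a r : ℝ) (hr : 0 < r) (μ : Measure (Pt n)) [SFinite μ] :
    ∫⁻ p in strip a r, ∫⁻ z, ENNReal.ofReal ‖gradW (p - z)‖ ∂μ ≤
      ENNReal.ofReal (2 ^ ((n : ℝ) / 2)) * ENNReal.ofReal (9 * r) * μ univ := by
  apply strip_rsqrt (k := fun p => ENNReal.ofReal ‖gradW p‖) _ _ a r hr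
  · have := gradW_measurable (n := n)
    fun_prop
  · exact gradW_lintegral_le

lemma strip_K {n : ℕ} (a r : ℝ) (hr : 0 < r) (μ : Measure (Pt n)) [SFinite μ] :
    ∫⁻ p in strip a r, ∫⁻ z, heatK (p - z) ∂μ ≤
      ENNReal.ofReal (32 * 3 ^ n) * ENNReal.ofReal (9 * r) * μ univ :=
  strip_rsqrt heatK_measurable heatK_lintegral_le a r hr μ

/-- `W * (σ μ)` -/
def cW {n : ℕ} (μ : Measure (Pt n)) (σ : Pt n → ℝ) (p : Pt n) : ℝ := ∫ z, σ z * heatW (p - z) ∂μ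
/-- `∇ W * (σ μ)` -/
def cG {n : ℕ} (μ : Measure (Pt n)) (σ : Pt n → ℝ) (p : Pt n) : Spc n :=
  ∫ z, σ z • gradW (p - z) ∂μ

attribute [fun_prop] heatW_measurable gradW_measurable heatK_measurable mker_measurable

lemma cW_sm {n : ℕ} (μ : Measure (Pt n)) [SFinite μ] {σ : Pt n → ℝ} (hσ : Measurable σ) :
    StronglyMeasurable (cW μ σ) := by
  unfold cW
  apply StronglyMeasurable.integral_prod_right
    (f := fun (p : Pt n) (z : Pt n) => σ z * heatW (p - z))
  apply Measurable.stronglyMeasurable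
  simp only [Function.uncurry_def]
  have := heatW_measurable (n := n)
  fun_prop

lemma cG_sm {n : ℕ} (μ : Measure (Pt n)) [SFinite μ] {σ : Pt n → ℝ} (hσ : Measurable σ) :
    StronglyMeasurable (cG μ σ) := by
  unfold cG
  apply StronglyMeasurable.integral_prod_right
    (f := fun (p : Pt n) (z : Pt n) => σ z • gradW (p - z))
  apply Measurable.stronglyMeasurable
  simp only [Function.uncurry_def]
  have := gradW_measurable (n := n)
  fun_prop

lemma ae_lt_top_of_strip {n : ℕ} {f : Pt n → ENNReal} (hf : Measurable f)
    (h : ∀ a r : ℝ, 0 < r → ∫⁻ p in strip a r, f p ≠ ⊤) : ∀ᵐ p, f p < ⊤ := by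
  have hk : ∀ k : ℕ, ∀ᵐ p, p ∈ strip (n := n) (-((k : ℝ) + 1)) (k + 2) → f p < ⊤ := by
    intro k
    have := ae_lt_top hf (h (-((k : ℝ) + 1)) (k + 2) (by positivity))
    rwa [ae_restrict_iff' (strip_measurable _ _)] at this
  filter_upwards [ae_all_iff.2 hk] with p hp
  obtain ⟨k, hk⟩ := exists_nat_gt |p.2|
  apply hp k
  have h1 := abs_le.1 hk.le
  refine ⟨mem_univ _, ?_, ?_⟩
  · linarith
  · nlinarith [abs_nonneg p.2]

lemma ae_integrable_W {n : ℕ} (μ : Measure (Pt n)) [IsFiniteMeasure μ] :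
    ∀ᵐ p, Integrable (fun z => heatW (p - z)) μ := by
  have hm := heatW_measurable (n := n)
  have : ∀ᵐ p : Pt n, ∫⁻ z, ENNReal.ofReal (heatW (p - z)) ∂μ < ⊤ := by
    apply ae_lt_top_of_strip
    · apply Measurable.lintegral_prod_right' (f := fun z : Pt n × Pt n => ENNReal.ofReal (heatW (z.1 - z.2)))
      fun_prop
    · intro a r _
      refine ne_top_of_le_ne_top ?_ (strip_W a r μ)
      exact ENNReal.mul_ne_top ENNReal.ofReal_ne_top (measure_ne_top _ _)
  filter_upwards [this] with p hp
  refine ⟨Measurable.aestronglyMeasurable (by fun_prop), ?_⟩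
  rw [hasFiniteIntegral_iff_ofReal (Eventually.of_forall fun z => heatW_nonneg _)]
  exact hp

lemma ae_integrable_G {n : ℕ} (μ : Measure (Pt n)) [IsFiniteMeasure μ] :
    ∀ᵐ p, Integrable (fun z => gradW (p - z)) μ := by
  have hm := gradW_measurable (n := n)
  have : ∀ᵐ p : Pt n, ∫⁻ z, ENNReal.ofReal ‖gradW (p - z)‖ ∂μ < ⊤ := by
    apply ae_lt_top_of_strip
    · apply Measurable.lintegral_prod_right' (f := fun z : Pt n × Pt n => ENNReal.ofReal ‖gradW (z.1 - z.2)‖)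
      fun_prop
    · intro a r hr
      refine ne_top_of_le_ne_top ?_ (strip_gradW a r hr μ)
      exact ENNReal.mul_ne_top (ENNReal.mul_ne_top ENNReal.ofReal_ne_top ENNReal.ofReal_ne_top) (measure_ne_top _ _)
  filter_upwards [this] with p hp
  refine ⟨Measurable.aestronglyMeasurable (by fun_prop), ?_⟩
  rw [hasFiniteIntegral_iff_norm]
  exact hp

lemma Integrable.sig_mul {n : ℕ} {μ : Measure (Pt n)} {σ : Pt n → ℝ} (hσ : Measurable σ)
    {B : ℝ} (h1 : ∀ z, |σ z| ≤ B) {f : Pt n → ℝ} (hf : Integrable f μ) :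
    Integrable (fun z => σ z * f z) μ :=
  hf.bdd_mul (c := B) hσ.aestronglyMeasurable (Eventually.of_forall h1)

lemma ae_line {n : ℕ} {P : Pt n → Prop} (h : ∀ᵐ p, P p) :
    ∀ᵐ p : Pt n, ∀ᵐ s : ℝ, P (p.1, s) := by
  have h1 : ∀ᵐ x : Spc n, ∀ᵐ s : ℝ, P (x, s) := Measure.ae_ae_of_ae_prod h
  exact (Measure.quasiMeasurePreserving_fst (μ := (volume : Measure (Spc n)))
    (ν := (volume : Measure ℝ))).ae h1

lemma ae_line_add {n : ℕ} {P : Pt n → Prop} (h : ∀ᵐ p, P p) :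
    ∀ᵐ p : Pt n, ∀ᵐ ρ : ℝ, P (p.1, p.2 + ρ) := by
  filter_upwards [ae_line h] with p hp
  exact (measurePreserving_add_left volume p.2).quasiMeasurePreserving.ae hp

lemma halfT_congr_ae {n : ℕ} {F F' : Pt n → ℝ} (h : F =ᵐ[volume] F') :
    halfT F =ᵐ[volume] halfT F' := by
  filter_upwards [h, ae_line h] with p h1 h2
  unfold halfT
  apply integral_congr_ae
  filter_upwards [h2] with s hs
  rw [hs, h1]

lemma bmo_congr_ae {n : ℕ} {D D' : Pt n → ℝ} (h : D =ᵐ[volume] D') {c : ℝ} (hb : ParabBMOLe D c) :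
    ParabBMOLe D' c := by
  intro Q
  have e1 : ⨍ q in Q.toSet, D q = ⨍ q in Q.toSet, D' q := by
    rw [Q.average_eq, Q.average_eq, integral_congr_ae (ae_restrict_of_ae h)]
  have e2 : ⨍ p in Q.toSet, |D p - ⨍ q in Q.toSet, D q| = ⨍ p in Q.toSet, |D' p - ⨍ q in Q.toSet, D' q| := by
    rw [e1, Q.average_eq (fun p => |D p - _|), Q.average_eq (fun p => |D' p - _|)]
    congr 1
    apply integral_congr_ae
    filter_upwards [ae_restrict_of_ae h] with p hp
    rw [hp]
  rw [← e2]; exact hb Q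

/-- absolute half derivative -/
def absHalf {n : ℕ} (F : Pt n → ℝ) (p : Pt n) : ENNReal :=
  ∫⁻ ρ : ℝ, ENNReal.ofReal (|F (p.1, p.2 + ρ) - F p| / |ρ| ^ (3 / 2 : ℝ))

lemma absHalf_measurable {n : ℕ} {F : Pt n → ℝ} (hF : Measurable F) : Measurable (absHalf F) := by
  unfold absHalf
  apply Measurable.lintegral_prod_right' (f := fun z : Pt n × ℝ => ENNReal.ofReal (|F (z.1.1, z.1.2 + z.2) - F z.1| / |z.2| ^ (3 / 2 : ℝ)))
  fun_prop

lemma absHalf_cW_le {n : ℕ} (μ : Measure (Pt n)) [IsFiniteMeasure μ] {σ : Pt n → ℝ} (hσ : Measurable σ)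
    (h1 : ∀ z, |σ z| ≤ 1) : ∀ᵐ p, absHalf (cW μ σ) p ≤ ∫⁻ z, heatK (p - z) ∂μ := by
  filter_upwards [ae_integrable_W μ, ae_line_add (ae_integrable_W μ)] with p hp hl
  unfold absHalf heatK
  rw [lintegral_lintegral_swap (by
    apply Measurable.aemeasurable
    simp only [Function.uncurry_def]
    have := heatW_measurable (n := n)
    fun_prop)]
  apply lintegral_mono_ae
  filter_upwards [hl] with ρ hρ
  have hm := heatW_measurable (n := n)
  have e : cW μ σ (p.1, p.2 + ρ) - cW μ σ p =
      ∫ z, σ z * (heatW ((p - z).1, (p - z).2 + ρ) - heatW (p - z)) ∂μ := by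
    unfold cW
    rw [← integral_sub (Integrable.sig_mul hσ h1 hρ) (Integrable.sig_mul hσ h1 hp)]
    congr 1
    funext z
    rw [← mul_sub]
    congr 3
    ext1
    · rfl
    · simp; ring
  have hk : 0 ≤ |ρ| ^ (3 / 2 : ℝ) := by positivity
  rw [e]
  have e2 : |∫ z, σ z * (heatW ((p - z).1, (p - z).2 + ρ) - heatW (p - z)) ∂μ| / |ρ| ^ (3 / 2 : ℝ) =
      ‖∫ z, σ z * (heatW ((p - z).1, (p - z).2 + ρ) - heatW (p - z)) / |ρ| ^ (3 / 2 : ℝ) ∂μ‖ := by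
    rw [integral_div, norm_div, Real.norm_eq_abs, Real.norm_eq_abs, abs_of_nonneg hk]
  rw [e2]
  refine (ENNReal.ofReal_le_ofReal (norm_integral_le_lintegral_norm _)).trans ?_
  refine ENNReal.ofReal_toReal_le.trans (lintegral_mono fun z => ?_)
  apply ENNReal.ofReal_le_ofReal
  rw [norm_div, norm_mul, Real.norm_eq_abs, Real.norm_eq_abs, Real.norm_eq_abs, abs_of_nonneg hk]
  gcongr
  exact mul_le_of_le_one_left (abs_nonneg _) (h1 z)

lemma halfT_abs_le {n : ℕ} (F : Pt n → ℝ) (p : Pt n) : ENNReal.ofReal |halfT F p| ≤ absHalf F p := by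
  rw [halfT_eq_E1]
  unfold E1 absHalf
  have := norm_integral_le_lintegral_norm (μ := volume)
    (fun ρ => (F (p.1, p.2 + ρ) - F (p.1, p.2)) / |ρ| ^ (3 / 2 : ℝ))
  refine (ENNReal.ofReal_le_ofReal this).trans ?_
  refine ENNReal.ofReal_toReal_le.trans (lintegral_mono fun ρ => ?_)
  apply ENNReal.ofReal_le_ofReal
  rw [norm_div, Real.norm_eq_abs, Real.norm_eq_abs, abs_of_nonneg (by positivity : 0 ≤ |ρ| ^ (3 / 2 : ℝ))]

/-- normalized Lebesgue measure on a ball around the origin -/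
def pav (n : ℕ) (δ : ℝ) : Measure (Pt n) :=
  (volume (Metric.closedBall (0 : Pt n) δ))⁻¹ • volume.restrict (Metric.closedBall (0 : Pt n) δ)

lemma ball_vol_ne_zero (n : ℕ) {δ : ℝ} (hδ : 0 < δ) : volume (Metric.closedBall (0 : Pt n) δ) ≠ 0 :=
  (Metric.measure_closedBall_pos volume _ hδ).ne'

lemma ball_vol_ne_top (n : ℕ) (δ : ℝ) : volume (Metric.closedBall (0 : Pt n) δ) ≠ ⊤ :=
  (measure_closedBall_lt_top).ne

lemma pav_prob (n : ℕ) {δ : ℝ} (hδ : 0 < δ) : IsProbabilityMeasure (pav n δ) := by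
  constructor
  unfold pav
  rw [Measure.smul_apply, Measure.restrict_apply_univ, smul_eq_mul]
  exact ENNReal.inv_mul_cancel (ball_vol_ne_zero n hδ) (ball_vol_ne_top n δ)

lemma pav_ac (n : ℕ) (δ : ℝ) : pav n δ ≪ volume :=
  (Measure.smul_absolutelyContinuous).trans Measure.restrict_le_self.absolutelyContinuous

/-- translates of a.e. statements -/
lemma ae_translate {n : ℕ} {P : Pt n → Prop} (h : ∀ᵐ p, P p) (p : Pt n) (δ : ℝ) :
    ∀ᵐ q ∂(pav n δ), P (p + q) :=
  (pav_ac n δ).ae_le ((measurePreserving_add_left volume p).quasiMeasurePreserving.ae h)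

lemma pav_le {n : ℕ} (δ : ℝ) (hδ : 0 < δ) (f : Pt n → ENNReal) (p : Pt n) :
    ∫⁻ q, f (p + q) ∂(pav n δ) ≤ (volume (Metric.closedBall (0 : Pt n) δ))⁻¹ *
      ∫⁻ q in strip (p.2 - δ) (√(2 * δ)), f q := by
  unfold pav
  rw [lintegral_smul_measure, smul_eq_mul]
  refine mul_le_mul' le_rfl ?_
  have hmp : MeasurePreserving (fun q : Pt n => p + q) volume volume := measurePreserving_add_left _ _
  have he : MeasurableEmbedding (fun q : Pt n => p + q) := measurableEmbedding_addLeft _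
  rw [← hmp.setLIntegral_comp_preimage_emb he f (strip (p.2 - δ) (√(2 * δ)))]
  apply lintegral_mono_set
  intro q hq
  rw [Metric.mem_closedBall, dist_zero_right] at hq
  have := (norm_snd_le q).trans hq
  rw [Real.norm_eq_abs, abs_le] at this
  refine ⟨mem_univ _, ?_, ?_⟩
  · simp only [Prod.snd_add]; linarith
  · rw [Real.sq_sqrt (by linarith)]
    simp only [Prod.snd_add]; linarith

/-- the mollification -/
def moll {n : ℕ} (F : Pt n → ℝ) (δ : ℝ) (p : Pt n) : ℝ := ∫ q, F (p + q) ∂(pav n δ)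

lemma moll_eq {n : ℕ} (F : Pt n → ℝ) (δ : ℝ) (p : Pt n) :
    moll F δ p = ⨍ q in Metric.closedBall p δ, F q := by
  have hmp : MeasurePreserving (fun q : Pt n => p + q) volume volume := measurePreserving_add_left _ _
  have he : MeasurableEmbedding (fun q : Pt n => p + q) := measurableEmbedding_addLeft _
  have e : (fun q : Pt n => p + q) ⁻¹' Metric.closedBall p δ = Metric.closedBall 0 δ := by
    ext q; simp [dist_eq_norm]
  unfold moll pav
  rw [integral_smul_measure, setAverage_eq, ← hmp.setIntegral_preimage_emb he F (Metric.closedBall p δ), Measure.real,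
    ← hmp.measure_preimage_emb he (Metric.closedBall p δ), e, ENNReal.toReal_inv]

section
variable {n : ℕ} {F : Pt n → ℝ} {M M' : ENNReal} {δ : ℝ}

lemma moll_integrable (hF : Measurable F) (hM : M ≠ ⊤)
    (h2 : ∀ a r : ℝ, 0 < r → ∫⁻ p in strip a r, ENNReal.ofReal |F p| ≤ ENNReal.ofReal (r ^ 2) * M)
    (hδ : 0 < δ) (p : Pt n) : Integrable (fun q => F (p + q)) (pav n δ) := by
  refine ⟨Measurable.aestronglyMeasurable (by fun_prop), ?_⟩
  rw [hasFiniteIntegral_iff_norm]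
  refine lt_of_le_of_lt (pav_le δ hδ (fun q => ENNReal.ofReal |F q|) p) ?_
  refine ENNReal.mul_lt_top (ENNReal.inv_lt_top.2 (pos_iff_ne_zero.2 (ball_vol_ne_zero n hδ))) ?_
  refine lt_of_le_of_lt (h2 _ _ (by positivity)) ?_
  exact ENNReal.mul_lt_top ENNReal.ofReal_lt_top hM.lt_top

lemma moll_bdd (hM : M ≠ ⊤)
    (h2 : ∀ a r : ℝ, 0 < r → ∫⁻ p in strip a r, ENNReal.ofReal |F p| ≤ ENNReal.ofReal (r ^ 2) * M)
    (hδ : 0 < δ) : ∃ B : ℝ, ∀ p, |moll F δ p| ≤ B := by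
  refine ⟨((volume (Metric.closedBall (0 : Pt n) δ))⁻¹ * (ENNReal.ofReal (√(2 * δ) ^ 2) * M)).toReal, ?_⟩
  intro p
  unfold moll
  rw [← Real.norm_eq_abs]
  refine (norm_integral_le_lintegral_norm _).trans ?_
  apply ENNReal.toReal_mono
  · exact ENNReal.mul_ne_top (ENNReal.inv_ne_top.2 (ball_vol_ne_zero n hδ))
      (ENNReal.mul_ne_top ENNReal.ofReal_ne_top hM)
  · refine (pav_le δ hδ (fun q => ENNReal.ofReal |F q|) p).trans ?_
    gcongr
    exact h2 _ _ (by positivity)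

lemma moll_tLip (hF : Measurable F) (hM : M ≠ ⊤)
    (h2 : ∀ a r : ℝ, 0 < r → ∫⁻ p in strip a r, ENNReal.ofReal |F p| ≤ ENNReal.ofReal (r ^ 2) * M)
    (hδ : 0 < δ) : ∃ L : ℝ, 0 ≤ L ∧ ∀ x t u, |moll F δ (x, t) - moll F δ (x, u)| ≤ L * |t - u| := by
  set c : ℝ := ((volume (Metric.closedBall (0 : Pt n) δ))⁻¹).toReal with hc
  have hc0 : 0 ≤ c := ENNReal.toReal_nonneg
  refine ⟨c * (2 * M.toReal), by positivity, ?_⟩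
  have h_integrable : ∀ a r : ℝ, 0 < r → IntegrableOn (fun p => |F p|) (strip (n := n) a r) ∧
      ∫ p in strip (n := n) a r, |F p| ≤ r ^ 2 * M.toReal := by
    intro a r hr
    have h := h2 a r hr
    have hi : IntegrableOn (fun p => |F p|) (strip (n := n) a r) := by
      refine ⟨Measurable.aestronglyMeasurable (by fun_prop), ?_⟩
      rw [hasFiniteIntegral_iff_ofReal (Eventually.of_forall fun p => abs_nonneg _)]
      exact lt_of_le_of_lt h (ENNReal.mul_lt_top ENNReal.ofReal_lt_top hM.lt_top)
    refine ⟨hi, ?_⟩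
    rw [integral_eq_lintegral_of_nonneg_ae (Eventually.of_forall fun p => abs_nonneg _) hi.aestronglyMeasurable]
    refine (ENNReal.toReal_mono (ENNReal.mul_ne_top ENNReal.ofReal_ne_top hM) h).trans ?_
    rw [ENNReal.toReal_mul, ENNReal.toReal_ofReal (by positivity)]
  have key : ∀ x t u, u < t → |moll F δ (x, t) - moll F δ (x, u)| ≤ c * (2 * M.toReal) * |t - u| := by
    intro x t u hut
    have hball : ∀ p : Pt n, moll F δ p = c * ∫ q in Metric.closedBall p δ, F q := by
      intro p
      rw [moll_eq, setAverage_eq, smul_eq_mul, hc, ENNReal.toReal_inv, Measure.real]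
      congr 3
      have hmp : MeasurePreserving (fun q : Pt n => p + q) volume volume := measurePreserving_add_left _ _
      rw [← hmp.measure_preimage_emb (measurableEmbedding_addLeft _)]
      congr 1
      ext q; simp [dist_eq_norm]
    have hbi : ∀ p : Pt n, IntegrableOn F (Metric.closedBall p δ) := by
      intro p
      have h := (h_integrable (p.2 - δ) (√(2 * δ)) (by positivity)).1
      have h' : IntegrableOn F (strip (n := n) (p.2 - δ) (√(2 * δ))) :=
        (integrable_norm_iff hF.aestronglyMeasurable).1 h
      refine h'.mono_set ?_
      intro q hq
      rw [Metric.mem_closedBall, dist_eq_norm] at hq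
      have := (norm_snd_le (q - p)).trans hq
      rw [Real.norm_eq_abs, abs_le, Prod.snd_sub] at this
      refine ⟨mem_univ _, ?_, ?_⟩
      · linarith
      · rw [Real.sq_sqrt (by linarith)]; linarith
    set d := t - u with hd
    have hd0 : 0 < d := by linarith
    have hsd : 0 < √d := Real.sqrt_pos.2 hd0
    rw [hball, hball, ← mul_sub, abs_mul, abs_of_nonneg hc0, mul_assoc]
    gcongr
    rw [← integral_indicator measurableSet_closedBall, ← integral_indicator measurableSet_closedBall,
      ← integral_sub ((integrable_indicator_iff measurableSet_closedBall).2 (hbi _))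
        ((integrable_indicator_iff measurableSet_closedBall).2 (hbi _))]
    have s1 := h_integrable (u - δ) (√d) hsd
    have s2 := h_integrable (u + δ) (√d) hsd
    rw [Real.sq_sqrt hd0.le] at s1 s2
    have hm1 := strip_measurable (n := n) (u - δ) (√d)
    have hm2 := strip_measurable (n := n) (u + δ) (√d)
    calc |∫ q, ((Metric.closedBall ((x, t) : Pt n) δ).indicator F q - (Metric.closedBall ((x, u) : Pt n) δ).indicator F q)|
        ≤ ∫ q, ((strip (u - δ) (√d)).indicator (fun p : Pt n => |F p|) q +
            (strip (u + δ) (√d)).indicator (fun p : Pt n => |F p|) q) := by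
          rw [← Real.norm_eq_abs]
          refine norm_integral_le_of_norm_le (((integrable_indicator_iff hm1).2 s1.1).add
            ((integrable_indicator_iff hm2).2 s2.1)) (Eventually.of_forall fun q => ?_)
          have mem1 : ∀ s : ℝ, q ∈ Metric.closedBall ((x, s) : Pt n) δ ↔ ‖q.1 - x‖ ≤ δ ∧ |q.2 - s| ≤ δ := by
            intro s
            rw [Metric.mem_closedBall, dist_eq_norm, Prod.norm_def, max_le_iff]; rfl
          have st : ∀ a : ℝ, q ∈ strip (n := n) a (√d) ↔ a ≤ q.2 ∧ q.2 ≤ a + d := by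
            intro a; simp [strip, Real.sq_sqrt hd0.le]
          classical
          rw [Real.norm_eq_abs]
          simp only [Set.indicator_apply, mem1, st]
          simp only [abs_le (b := δ)]
          have := abs_nonneg (F q)
          split_ifs with a1 a2 a3 a4 a5 a6 a7 a8 a9 <;> simp only [sub_self, sub_zero, zero_sub, abs_neg, abs_zero, add_zero, zero_add] <;> try linarith
          all_goals exfalso
          all_goals grind
      _ ≤ 2 * M.toReal * |d| := by
          rw [integral_add ((integrable_indicator_iff hm1).2 s1.1) ((integrable_indicator_iff hm2).2 s2.1),
            integral_indicator hm1, integral_indicator hm2, abs_of_pos hd0]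
          linarith [s1.2, s2.2]
  intro x t u
  rcases lt_trichotomy u t with h | h | h
  · exact key x t u h
  · simp [h]
  · rw [abs_sub_comm (moll F δ (x, t)), abs_sub_comm t]; exact key x u t h

lemma moll_halfT (hF : Measurable F) (hM : M ≠ ⊤)
    (h2 : ∀ a r : ℝ, 0 < r → ∫⁻ p in strip a r, ENNReal.ofReal |F p| ≤ ENNReal.ofReal (r ^ 2) * M)
    (hM' : M' ≠ ⊤)
    (h3 : ∀ a r : ℝ, 0 < r → ∫⁻ p in strip a r, absHalf F p ≤ ENNReal.ofReal r * M')
    (hδ : 0 < δ) (p : Pt n) : halfT (moll F δ) p = ∫ q, halfT F (p + q) ∂(pav n δ) := by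
  have := pav_prob n hδ
  rw [halfT_eq_E1]
  have e2 : ∀ q : Pt n, halfT F (p + q) =
      ∫ ρ, (F ((p + q).1, (p + q).2 + ρ) - F (p + q)) / |ρ| ^ (3 / 2 : ℝ) := fun q => by
    rw [halfT_eq_E1]; rfl
  simp_rw [e2]
  rw [integral_integral_swap]
  · unfold E1
    congr 1
    funext ρ
    unfold moll
    rw [← integral_sub (moll_integrable hF hM h2 hδ _) (moll_integrable hF hM h2 hδ _), ← integral_div]
    congr 1
    funext q
    congr 3
    ext1
    · rfl
    · simp; ring
  · refine ⟨?_, ?_⟩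
    · apply Measurable.aestronglyMeasurable
      simp only [Function.uncurry_def]
      fun_prop
    · rw [hasFiniteIntegral_iff_norm, lintegral_prod _ (by
        apply Measurable.aemeasurable
        simp only [Function.uncurry_def]
        fun_prop)]
      have : ∀ q : Pt n, ∫⁻ ρ : ℝ, ENNReal.ofReal ‖Function.uncurry (fun (q : Pt n) (ρ : ℝ) =>
          (F ((p + q).1, (p + q).2 + ρ) - F (p + q)) / |ρ| ^ (3 / 2 : ℝ)) (q, ρ)‖ = absHalf F (p + q) := by
        intro q
        unfold absHalf
        congr 1
        funext ρ
        simp only [Function.uncurry_apply_pair]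
        rw [norm_div, Real.norm_eq_abs, Real.norm_eq_abs, abs_of_nonneg (by positivity : 0 ≤ |ρ| ^ (3 / 2 : ℝ))]
      simp_rw [this]
      refine lt_of_le_of_lt (pav_le δ hδ (absHalf F) p) ?_
      refine ENNReal.mul_lt_top (ENNReal.inv_lt_top.2 (pos_iff_ne_zero.2 (ball_vol_ne_zero n hδ))) ?_
      refine lt_of_le_of_lt (h3 _ _ (by positivity)) ?_
      exact ENNReal.mul_lt_top ENNReal.ofReal_lt_top hM'.lt_top

lemma halfT_sm (hF : Measurable F) : StronglyMeasurable (halfT F) := by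
  have : halfT F = fun p => E1 (fun s => F (p.1, s)) p.2 := funext (halfT_eq_E1 F)
  rw [this]; unfold E1
  apply StronglyMeasurable.integral_prod_right
  apply Measurable.stronglyMeasurable
  fun_prop

/-- translate -/
def PCube.trans (Q : PCube n) (q : Pt n) : PCube n :=
  ⟨fun i => Q.corner i + q.1 i, Q.time + q.2, Q.len, Q.len_pos⟩

lemma trans_setIntegral (Q : PCube n) (f : Pt n → ℝ) (q : Pt n) :
    ∫ p in Q.toSet, f (p + q) = ∫ p in (Q.trans q).toSet, f p := by
  have hm : MeasurePreserving (fun p : Pt n => p + q) volume volume :=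
    measurePreserving_add_right _ _
  have he : MeasurableEmbedding (fun p : Pt n => p + q) :=
    measurableEmbedding_addRight _
  have e : Q.toSet = (fun p : Pt n => p + q) ⁻¹' (Q.trans q).toSet := by
    ext p; simp only [PCube.toSet, PCube.trans, Set.mem_preimage, Set.mem_ofPred_eq, Set.mem_Icc,
      Prod.fst_add, Prod.snd_add, PiLp.add_apply]
    refine and_congr (forall_congr' fun i => and_congr ?_ ?_) (and_congr ?_ ?_) <;>
    constructor <;> intro h <;> linarith
  rw [← hm.setIntegral_preimage_emb he f, ← e]

lemma trans_average (Q : PCube n) (f : Pt n → ℝ) (q : Pt n) :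
    ⨍ p in Q.toSet, f (p + q) = ⨍ p in (Q.trans q).toSet, f p := by
  rw [PCube.average_eq, PCube.average_eq, trans_setIntegral]; rfl

lemma moll_bmo (hF : Measurable F) (hM : M ≠ ⊤)
    (h2 : ∀ a r : ℝ, 0 < r → ∫⁻ p in strip a r, ENNReal.ofReal |F p| ≤ ENNReal.ofReal (r ^ 2) * M)
    (hM' : M' ≠ ⊤)
    (h3 : ∀ a r : ℝ, 0 < r → ∫⁻ p in strip a r, absHalf F p ≤ ENNReal.ofReal r * M')
    (hδ : 0 < δ) (hb : ParabBMOLe (halfT F) 1) : ParabBMOLe (halfT (moll F δ)) 1 := by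
  have := pav_prob n hδ
  set D := halfT F with hD
  have hDm : Measurable D := (halfT_sm hF).measurable
  have e : halfT (moll F δ) = fun p => ∫ q, D (p + q) ∂(pav n δ) :=
    funext fun p => moll_halfT hF hM h2 hM' h3 hδ p
  rw [e]
  intro Q
  have hbd : ∀ p : Pt n, ∫⁻ q, ENNReal.ofReal |D (p + q)| ∂(pav n δ) ≤
      (volume (Metric.closedBall (0 : Pt n) δ))⁻¹ * (ENNReal.ofReal (√(2 * δ)) * M') := by
    intro p
    calc _ ≤ ∫⁻ q, absHalf F (p + q) ∂(pav n δ) := lintegral_mono fun q => halfT_abs_le F _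
      _ ≤ _ := by
        refine (pav_le δ hδ (absHalf F) p).trans ?_
        gcongr
        exact h3 _ _ (by positivity)
  have hconst : (volume (Metric.closedBall (0 : Pt n) δ))⁻¹ * (ENNReal.ofReal (√(2 * δ)) * M') ≠ ⊤ :=
    ENNReal.mul_ne_top (ENNReal.inv_ne_top.2 (ball_vol_ne_zero n hδ))
      (ENNReal.mul_ne_top ENNReal.ofReal_ne_top hM')
  have I1 : Integrable (fun z : Pt n × Pt n => D (z.1 + z.2)) ((volume.restrict Q.toSet).prod (pav n δ)) := by
    refine ⟨Measurable.aestronglyMeasurable (by fun_prop), ?_⟩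
    rw [hasFiniteIntegral_iff_norm, lintegral_prod _ (by
      apply Measurable.aemeasurable; fun_prop)]
    refine lt_of_le_of_lt (lintegral_mono fun p => hbd p) ?_
    rw [lintegral_const]
    exact ENNReal.mul_lt_top hconst.lt_top (measure_lt_top _ _)
  have hlen := pow_pos Q.len_pos (n + 2)
  set m : Pt n → ℝ := fun q => ⨍ p in Q.toSet, D (p + q) with hm
  have hm' : m = fun q => (Q.len ^ (n + 2))⁻¹ * ∫ p in Q.toSet, D (p + q) := by
    funext q; simp only [hm]; rw [Q.average_eq]
  have I2 : Integrable m (pav n δ) := by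
    rw [hm']; exact (I1.integral_prod_right).const_mul _
  have em : ⨍ p in Q.toSet, ∫ q, D (p + q) ∂(pav n δ) = ∫ q, m q ∂(pav n δ) := by
    rw [Q.average_eq, hm', integral_const_mul]
    congr 1
    exact integral_integral_swap I1
  rw [em]
  have I3 : Integrable (fun z : Pt n × Pt n => D (z.1 + z.2) - m z.2) ((volume.restrict Q.toSet).prod (pav n δ)) := by
    refine I1.sub ?_
    have := Integrable.mul_prod (f := fun _ : Pt n => (1 : ℝ)) (μ := volume.restrict Q.toSet) (integrable_const 1) I2
    simpa using this
  rw [Q.average_eq]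
  have hfin : ∫ q, (⨍ p in Q.toSet, |D (p + q) - m q|) ∂(pav n δ) ≤ 1 := by
    calc _ ≤ ∫ q, (1 : ℝ) ∂(pav n δ) := by
          apply integral_mono_of_nonneg
          · refine Eventually.of_forall fun q => ?_
            simp only [Pi.zero_apply]
            rw [Q.average_eq]
            have := setIntegral_nonneg (μ := volume) Q.measurable (fun p _ => abs_nonneg (D (p + q) - m q))
            positivity
          · exact integrable_const _
          · refine Eventually.of_forall fun q => ?_
            have := hb (Q.trans q)
            rw [← trans_average, ← trans_average] at this
            exact this
      _ = 1 := by simp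
  refine le_trans ?_ hfin
  simp_rw [Q.average_eq]
  rw [integral_const_mul]
  gcongr
  rw [← integral_integral_swap (f := fun p q => |D (p + q) - m q|) I3.abs]
  apply integral_mono_ae
  · exact (I1.integral_prod_left.sub (integrable_const _)).abs
  · exact I3.abs.integral_prod_left
  · filter_upwards [I1.prod_right_ae, I3.prod_right_ae] with p hp1 hp3
    rw [← integral_sub hp1 I2]
    exact abs_integral_le_integral_abs

end

lemma heatW_lineDeriv {n : ℕ} (y h : Spc n) (t θ : ℝ) :
    HasDerivAt (fun θ : ℝ => heatW ((y + θ • h, t) : Pt n)) (inner ℝ h (gradW (y + θ • h, t))) θ := by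
  unfold heatW gradW
  by_cases ht : 0 < t
  · simp only [ht, if_true]
    have h1 : HasDerivAt (fun θ : ℝ => y + θ • h) h θ := by
      simpa using ((hasDerivAt_id θ).smul_const h).const_add y
    have h2 : HasDerivAt (fun θ : ℝ => ‖y + θ • h‖ ^ 2) (2 * inner ℝ (y + θ • h) h) θ := h1.norm_sq
    have h3 := ((h2.neg.div_const (4 * t)).exp).const_mul ((4 * π * t) ^ (-(n : ℝ) / 2))
    refine h3.congr_deriv ?_
    rw [inner_smul_right, real_inner_comm]
    simp only [Pi.neg_apply]
    field_simp
    ring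
  · simp only [ht, if_false, inner_zero_right]
    exact hasDerivAt_const _ _

lemma gradW_line_cont {n : ℕ} (y h : Spc n) (t : ℝ) :
    Continuous (fun θ : ℝ => (inner ℝ h (gradW ((y + θ • h, t) : Pt n)) : ℝ)) := by
  unfold gradW
  by_cases ht : 0 < t
  · simp only [ht, if_true]
    fun_prop
  · simp only [ht, if_false]; fun_prop

lemma heatW_ftc {n : ℕ} (y h : Spc n) (t : ℝ) :
    ∫ θ in Icc (0:ℝ) 1, inner ℝ h (gradW ((y + θ • h, t) : Pt n)) = heatW ((y + h, t) : Pt n) - heatW (y, t) := by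
  rw [integral_Icc_eq_integral_Ioc, ← intervalIntegral.integral_of_le zero_le_one,
    intervalIntegral.integral_eq_sub_of_hasDerivAt (fun θ _ => heatW_lineDeriv y h t θ)
      ((gradW_line_cont y h t).intervalIntegrable _ _)]
  simp

section
variable {n : ℕ} {δ : ℝ}

lemma cW_strip (μ : Measure (Pt n)) [IsFiniteMeasure μ] {σ : Pt n → ℝ}
    (h1 : ∀ z, |σ z| ≤ 1) (a r : ℝ) :
    ∫⁻ p in strip a r, ENNReal.ofReal |cW μ σ p| ≤ ENNReal.ofReal (r ^ 2) * μ univ := by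
  refine (lintegral_mono fun p => ?_).trans (strip_W a r μ)
  rw [← Real.norm_eq_abs, ofReal_norm_eq_enorm]
  refine (enorm_integral_le_lintegral_enorm _).trans (lintegral_mono fun z => ?_)
  rw [← ofReal_norm_eq_enorm]
  apply ENNReal.ofReal_le_ofReal
  rw [norm_mul, Real.norm_eq_abs, Real.norm_eq_abs, abs_of_nonneg (heatW_nonneg _)]
  exact mul_le_of_le_one_left (heatW_nonneg _) (h1 z)

lemma cW_absHalf_strip (μ : Measure (Pt n)) [IsFiniteMeasure μ] {σ : Pt n → ℝ} (hσ : Measurable σ)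
    (h1 : ∀ z, |σ z| ≤ 1) (a r : ℝ) (hr : 0 < r) :
    ∫⁻ p in strip a r, absHalf (cW μ σ) p ≤ ENNReal.ofReal r * (ENNReal.ofReal (32 * 3 ^ n) * 9 * μ univ) := by
  refine (lintegral_mono_ae (ae_restrict_of_ae (absHalf_cW_le μ hσ h1))).trans ((strip_K a r hr μ).trans ?_)
  rw [ENNReal.ofReal_mul (by norm_num : (0:ℝ) ≤ 9)]
  apply le_of_eq
  have : ENNReal.ofReal 9 = 9 := by norm_num
  rw [this]; ring

lemma heatW_decay (hn : 1 ≤ n) (p : Pt n) (s : ℝ) (hs : 1 ≤ s) (h : s ≤ |p.2|) : heatW p ≤ 1 / √s := by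
  unfold heatW
  split_ifs with hp
  · rw [abs_of_pos hp] at h
    have hpi := Real.pi_gt_three
    have : (4 * π * p.2) ^ (-(n : ℝ) / 2) ≤ s ^ (-(1:ℝ) / 2) := by
      have hn' : (1:ℝ) ≤ n := by exact_mod_cast hn
      calc _ ≤ s ^ (-(n : ℝ) / 2) := by
            apply Real.rpow_le_rpow_of_nonpos (by linarith) (by nlinarith) (by linarith)
        _ ≤ _ := Real.rpow_le_rpow_of_exponent_le hs (by linarith)
    calc _ ≤ s ^ (-(1:ℝ) / 2) * 1 := by
          gcongr
          rw [Real.exp_le_one_iff]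
          rw [neg_div]; simp only [Left.neg_nonpos_iff]; positivity
      _ = _ := by
          rw [mul_one, Real.sqrt_eq_rpow, one_div, ← Real.rpow_neg (by linarith)]; norm_num
  · positivity

lemma moll_decay (hn : 1 ≤ n) (μ : Measure (Pt n)) [IsFiniteMeasure μ] {σ : Pt n → ℝ} (hσ : Measurable σ)
    (h1 : ∀ z, |σ z| ≤ 1) (hδ : 0 < δ) (x : Spc n) :
    Tendsto (fun t => moll (cW μ σ) δ (x, t)) absTop (𝓝 0) := by
  have := pav_prob n hδ
  have hb : ∀ t, ENNReal.ofReal |moll (cW μ σ) δ (x, t)| ≤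
      ∫⁻ z, ∫⁻ q, ENNReal.ofReal (heatW ((x, t) + q - z)) ∂(pav n δ) ∂μ := by
    intro t
    rw [lintegral_lintegral_swap (by
      apply Measurable.aemeasurable
      simp only [Function.uncurry_def]
      fun_prop)]
    unfold moll
    rw [← Real.norm_eq_abs, ofReal_norm_eq_enorm]
    refine (enorm_integral_le_lintegral_enorm _).trans (lintegral_mono fun q => ?_)
    unfold cW
    refine (enorm_integral_le_lintegral_enorm _).trans (lintegral_mono fun z => ?_)
    rw [← ofReal_norm_eq_enorm]
    apply ENNReal.ofReal_le_ofReal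
    rw [norm_mul, Real.norm_eq_abs, Real.norm_eq_abs, abs_of_nonneg (heatW_nonneg _)]
    exact mul_le_of_le_one_left (heatW_nonneg _) (h1 z)
  have hlim : Tendsto (fun t => ∫⁻ z, ∫⁻ q, ENNReal.ofReal (heatW ((x, t) + q - z)) ∂(pav n δ) ∂μ) absTop
      (𝓝 (∫⁻ z, 0 ∂μ)) := by
    apply tendsto_lintegral_filter_of_dominated_convergence
      (fun _ => (volume (Metric.closedBall (0 : Pt n) δ))⁻¹ * (ENNReal.ofReal (√(2 * δ) ^ 2)))
    · refine Eventually.of_forall fun t => ?_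
      apply Measurable.lintegral_prod_right' (f := fun w : Pt n × Pt n => ENNReal.ofReal (heatW ((x, t) + w.2 - w.1)))
      fun_prop
    · refine Eventually.of_forall fun t => Eventually.of_forall fun z => ?_
      have h := pav_le δ hδ (fun q => ENNReal.ofReal (heatW (q - z))) (x, t)
      refine h.trans (mul_le_mul' le_rfl ?_)
      have := strip_W ((x, t).2 - δ : ℝ) (√(2 * δ)) (Measure.dirac z)
      simp only [lintegral_dirac, measure_univ, mul_one] at this
      exact this
    · rw [lintegral_const]
      exact (ENNReal.mul_lt_top (ENNReal.mul_lt_top (ENNReal.inv_lt_top.2 (pos_iff_ne_zero.2 (ball_vol_ne_zero n hδ)))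
        ENNReal.ofReal_lt_top) (measure_lt_top _ _)).ne
    · refine Eventually.of_forall fun z => ?_
      have hab : Tendsto (fun t : ℝ => |t|) absTop atTop := tendsto_comap
      have hs : Tendsto (fun t : ℝ => |t| - (|z.2| + δ)) absTop atTop := tendsto_atTop_add_const_right _ _ hab
      have hsq : Tendsto (fun t : ℝ => ENNReal.ofReal (1 / √(|t| - (|z.2| + δ)))) absTop (𝓝 0) := by
        rw [← ENNReal.ofReal_zero]
        apply ENNReal.tendsto_ofReal
        simp_rw [one_div]
        exact tendsto_inv_atTop_zero.comp ((Real.tendsto_sqrt_atTop).comp hs)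
      apply tendsto_of_tendsto_of_tendsto_of_le_of_le' tendsto_const_nhds hsq
      · exact Eventually.of_forall fun _ => zero_le
      · filter_upwards [hs.eventually_ge_atTop 1] with t ht
        calc _ ≤ ∫⁻ q, ENNReal.ofReal (1 / √(|t| - (|z.2| + δ))) ∂(pav n δ) := by
              apply lintegral_mono_ae
              have hq : ∀ᵐ q ∂(pav n δ), q ∈ Metric.closedBall (0 : Pt n) δ :=
                Measure.ae_smul_measure (ae_restrict_mem measurableSet_closedBall) _
              filter_upwards [hq] with q hq
              apply ENNReal.ofReal_le_ofReal
              apply heatW_decay hn _ _ ht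
              rw [Metric.mem_closedBall, dist_zero_right] at hq
              have h2 : |q.2| ≤ δ := (norm_snd_le q).trans hq
              simp only [Prod.snd_sub, Prod.snd_add]
              have := abs_sub_abs_le_abs_sub t (z.2 - q.2)
              have h3 := abs_sub z.2 q.2
              rw [show t + q.2 - z.2 = t - (z.2 - q.2) by ring]
              linarith
          _ = _ := by simp
  rw [lintegral_zero] at hlim
  have h0 : Tendsto (fun t => ENNReal.ofReal |moll (cW μ σ) δ (x, t)|) absTop (𝓝 0) :=
    tendsto_of_tendsto_of_tendsto_of_le_of_le tendsto_const_nhds hlim (fun _ => zero_le) hb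
  have h2 := (ENNReal.tendsto_toReal ENNReal.zero_ne_top).comp h0
  simp only [Function.comp_def, ENNReal.toReal_ofReal (abs_nonneg _), ENNReal.toReal_zero] at h2
  exact (tendsto_zero_iff_abs_tendsto_zero _).2 h2

lemma moll_xLip (μ : Measure (Pt n)) [IsFiniteMeasure μ] {σ : Pt n → ℝ} (hσ : Measurable σ)
    (h1 : ∀ z, |σ z| ≤ 1) (hG : ∀ᵐ p, ‖cG μ σ p‖ ≤ 1) (hδ : 0 < δ) (x h : Spc n) (t : ℝ) :
    |moll (cW μ σ) δ (x + h, t) - moll (cW μ σ) δ (x, t)| ≤ ‖h‖ := by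
  have := pav_prob n hδ
  set l : Measure ℝ := volume.restrict (Icc (0:ℝ) 1) with hl
  set Φ : ℝ → (Pt n × Pt n) → ℝ := fun θ w =>
    σ w.2 * inner ℝ h (gradW ((x + θ • h, t) + w.1 - w.2)) with hΦ
  have hΦm : Measurable (Function.uncurry Φ) := by
    simp only [hΦ, Function.uncurry_def]
    fun_prop
  have hI : Integrable (Function.uncurry Φ) (l.prod ((pav n δ).prod μ)) := by
    refine ⟨hΦm.aestronglyMeasurable, ?_⟩
    rw [hasFiniteIntegral_iff_norm, lintegral_prod _ (by fun_prop)]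
    set K : ENNReal := ENNReal.ofReal ‖h‖ * ((volume (Metric.closedBall (0 : Pt n) δ))⁻¹ *
      (ENNReal.ofReal (2 ^ ((n : ℝ) / 2)) * ENNReal.ofReal (9 * √(2 * δ)) * μ univ)) with hK
    have hKt : K < ⊤ := by
      apply ENNReal.mul_lt_top ENNReal.ofReal_lt_top
      refine ENNReal.mul_lt_top (ENNReal.inv_lt_top.2 (pos_iff_ne_zero.2 (ball_vol_ne_zero n hδ))) ?_
      exact ENNReal.mul_lt_top (ENNReal.mul_lt_top ENNReal.ofReal_lt_top ENNReal.ofReal_lt_top) (measure_lt_top _ _)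
    have hb : ∀ θ : ℝ, ∫⁻ w, ENNReal.ofReal ‖Function.uncurry Φ (θ, w)‖ ∂((pav n δ).prod μ) ≤ K := by
      intro θ
      set p : Pt n := (x + θ • h, t) with hp
      calc _ ≤ ∫⁻ w, ENNReal.ofReal ‖h‖ * ENNReal.ofReal ‖gradW (p + w.1 - w.2)‖ ∂((pav n δ).prod μ) := by
            refine lintegral_mono fun w => ?_
            rw [← ENNReal.ofReal_mul (norm_nonneg _)]
            apply ENNReal.ofReal_le_ofReal
            simp only [Function.uncurry_apply_pair, hΦ]
            rw [norm_mul, Real.norm_eq_abs]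
            calc _ ≤ 1 * (‖h‖ * ‖gradW (p + w.1 - w.2)‖) := by
                  gcongr
                  · exact h1 _
                  · exact norm_inner_le_norm _ _
              _ = _ := one_mul _
        _ = ENNReal.ofReal ‖h‖ * ∫⁻ q, (∫⁻ z, ENNReal.ofReal ‖gradW (p + q - z)‖ ∂μ) ∂(pav n δ) := by
            rw [lintegral_const_mul _ (by fun_prop), lintegral_prod _ (by fun_prop)]
        _ ≤ K := by
            refine mul_le_mul' le_rfl ?_
            refine (pav_le δ hδ (fun q => ∫⁻ z, ENNReal.ofReal ‖gradW (q - z)‖ ∂μ) p).trans ?_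
            exact mul_le_mul' le_rfl (strip_gradW _ _ (by positivity) μ)
    refine lt_of_le_of_lt (lintegral_mono hb) ?_
    rw [lintegral_const]
    exact ENNReal.mul_lt_top hKt (by simp [hl])
  have hswap := integral_integral_swap hI
  have hR : ∀ w : Pt n × Pt n, ∫ θ, Φ θ w ∂l = σ w.2 * heatW ((x + h, t) + w.1 - w.2) - σ w.2 * heatW ((x, t) + w.1 - w.2) := by
    intro w
    simp only [hΦ, hl]
    rw [integral_const_mul, ← mul_sub]
    congr 1
    have := heatW_ftc (x + w.1.1 - w.2.1) h (t + w.1.2 - w.2.2)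
    convert this using 1
    · congr 1; funext θ; congr 2
      ext1
      · simp; abel
      · simp
    · congr 2
      ext1
      · simp; abel
      · simp
  have hF1 : ∀ p : Pt n, ∀ᵐ q ∂(pav n δ), Integrable (fun z => σ z * heatW (p + q - z)) μ := by
    intro p
    filter_upwards [ae_translate (ae_integrable_W μ) p δ] with q hq
    exact Integrable.sig_mul hσ h1 hq
  have hmW : ∀ a r : ℝ, 0 < r → ∫⁻ p in strip a r, ENNReal.ofReal |cW μ σ p| ≤ ENNReal.ofReal (r ^ 2) * μ univ :=
    fun a r _ => cW_strip μ h1 a r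
  have hcWm := (cW_sm μ hσ).measurable
  have eL : moll (cW μ σ) δ (x + h, t) - moll (cW μ σ) δ (x, t) = ∫ w, ∫ θ, Φ θ w ∂l ∂((pav n δ).prod μ) := by
    have hpr : Integrable (fun w => ∫ θ, Φ θ w ∂l) ((pav n δ).prod μ) := hI.integral_prod_right
    rw [integral_prod _ hpr]
    unfold moll
    rw [← integral_sub (moll_integrable hcWm (measure_ne_top μ univ) hmW hδ _)
      (moll_integrable hcWm (measure_ne_top μ univ) hmW hδ _)]
    apply integral_congr_ae
    filter_upwards [hF1 (x + h, t), hF1 (x, t)] with q hq1 hq2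
    simp_rw [hR]
    unfold cW
    rw [integral_sub hq1 hq2]
  rw [eL, ← hswap, ← Real.norm_eq_abs]
  refine (norm_integral_le_of_norm_le_const (C := ‖h‖) ?_).trans ?_
  · filter_upwards [hI.prod_right_ae] with θ hθ
    have hθ' : Integrable (fun w => Φ θ w) ((pav n δ).prod μ) := hθ
    rw [integral_prod _ hθ']
    refine (norm_integral_le_of_norm_le_const (C := ‖h‖) ?_).trans (by simp)
    filter_upwards [ae_translate hG (x + θ • h, t) δ, ae_translate (ae_integrable_G μ) (x + θ • h, t) δ] with q hq1 hq2
    have hq3 : Integrable (fun z => σ z • gradW ((x + θ • h, t) + q - z)) μ :=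
      hq2.bdd_smul 1 hσ.aestronglyMeasurable (Eventually.of_forall h1)
    have : ∫ z, Function.uncurry Φ (θ, (q, z)) ∂μ = inner ℝ h (cG μ σ ((x + θ • h, t) + q)) := by
      unfold cG
      rw [← integral_inner hq3]
      congr 1; funext z
      simp only [Function.uncurry_apply_pair, hΦ]
      rw [inner_smul_right]
    refine (le_of_eq (congrArg norm this)).trans ?_
    refine (norm_inner_le_norm _ _).trans ?_
    calc _ ≤ ‖h‖ * 1 := by gcongr
      _ = _ := mul_one _
  · simp [hl]
end

lemma sqrt_add_le' {a b : ℝ} (ha : 0 ≤ a) (hb : 0 ≤ b) : √(a + b) ≤ √a + √b := by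
  rw [Real.sqrt_le_left (by positivity)]
  nlinarith [Real.sq_sqrt ha, Real.sq_sqrt hb, Real.sqrt_nonneg a, Real.sqrt_nonneg b,
    mul_nonneg (Real.sqrt_nonneg a) (Real.sqrt_nonneg b)]

/-- McShane extension for a pseudo-distance -/
lemma mcshane {α : Type*} (d : α → α → ℝ) (hd0 : ∀ p, d p p = 0) (hsymm : ∀ p q, d p q = d q p)
    (htri : ∀ p q r, d p r ≤ d p q + d q r) (E : Set α) (hE : E.Nonempty) (F : α → ℝ)
    (hF : ∀ p ∈ E, ∀ q ∈ E, |F p - F q| ≤ d p q) :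
    ∃ G : α → ℝ, (∀ p q, |G p - G q| ≤ d p q) ∧ ∀ p ∈ E, G p = F p := by
  obtain ⟨q0, hq0⟩ := hE
  have : Nonempty E := ⟨⟨q0, hq0⟩⟩
  have hbd : ∀ p, BddBelow (range fun q : E => F q + d p q) := by
    intro p
    refine ⟨F q0 - d q0 p, ?_⟩
    rintro _ ⟨q, rfl⟩
    have h1 := (abs_le.1 (hF q0 hq0 q q.2)).2
    have h2 := htri q0 p q
    simp only; linarith
  refine ⟨fun p => ⨅ q : E, (F q + d p q), ?_, ?_⟩
  · have key : ∀ p q, (⨅ r : E, (F r + d p r)) ≤ (⨅ r : E, (F r + d q r)) + d p q := by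
      intro p q
      rw [← sub_le_iff_le_add]
      apply le_ciInf
      intro r
      have := ciInf_le (hbd p) r
      have h2 := htri p q r
      linarith
    intro p q
    rw [abs_le]
    have h1 := key p q
    have h2 := key q p
    rw [hsymm q p] at h2
    constructor <;> linarith
  · intro p hp
    apply le_antisymm
    · have := ciInf_le (hbd p) ⟨p, hp⟩
      simpa [hd0] using this
    · apply le_ciInf
      intro q
      have h1 := (abs_le.1 (hF p hp q q.2)).2
      linarith

lemma cW_locInt {n : ℕ} (μ : Measure (Pt n)) [IsFiniteMeasure μ] {σ : Pt n → ℝ} (hσ : Measurable σ)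
    (h1 : ∀ z, |σ z| ≤ 1) : LocallyIntegrable (cW μ σ) := by
  intro p
  refine ⟨Metric.closedBall p 1, Metric.closedBall_mem_nhds p one_pos, ?_⟩
  have hs : IntegrableOn (cW μ σ) (strip (p.2 - 1) (√2)) := by
    refine ⟨(cW_sm μ hσ).aestronglyMeasurable, ?_⟩
    rw [hasFiniteIntegral_iff_norm]
    refine lt_of_le_of_lt (cW_strip μ h1 _ _) ?_
    exact ENNReal.mul_lt_top ENNReal.ofReal_lt_top (measure_lt_top _ _)
  refine hs.mono_set ?_
  intro q hq
  rw [Metric.mem_closedBall, dist_eq_norm] at hq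
  have := (norm_snd_le (q - p)).trans hq
  rw [Real.norm_eq_abs, abs_le, Prod.snd_sub] at this
  refine ⟨mem_univ _, ?_, ?_⟩
  · linarith
  · rw [Real.sq_sqrt (by norm_num)]; linarith

theorem lip_rep (n : ℕ) (hn : 1 ≤ n) : ∃ C > 0, ∀ (μ : Measure (Pt n)) (_ : IsFiniteMeasure μ) (σ : Pt n → ℝ),
    Measurable σ → (∀ z, |σ z| ≤ 1) → (∀ᵐ p, ‖cG μ σ p‖ ≤ 1) → ParabBMOLe (halfT (cW μ σ)) 1 →
    ∃ G : Pt n → ℝ, (∀ p q, |G p - G q| ≤ ‖p.1 - q.1‖ + C * √|p.2 - q.2|) ∧ G =ᵐ[volume] cW μ σ := by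
  obtain ⟨C, hC, hnice⟩ := nice_half n
  refine ⟨C, hC, ?_⟩
  intro μ _ σ hσ h1 hG hb
  set F := cW μ σ with hF
  have hFm : Measurable F := (cW_sm μ hσ).measurable
  have hM := measure_ne_top μ univ
  have h2 : ∀ a r : ℝ, 0 < r → ∫⁻ p in strip a r, ENNReal.ofReal |F p| ≤ ENNReal.ofReal (r ^ 2) * μ univ :=
    fun a r _ => cW_strip μ h1 a r
  have h3 := fun a r hr => cW_absHalf_strip μ hσ h1 a r hr
  have hM' : ENNReal.ofReal (32 * 3 ^ n) * 9 * μ univ ≠ ⊤ :=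
    ENNReal.mul_ne_top (ENNReal.mul_ne_top ENNReal.ofReal_ne_top (by norm_num)) hM
  have hx : ∀ δ > 0, ∀ (x y : Spc n) t, |moll F δ (x, t) - moll F δ (y, t)| ≤ ‖x - y‖ := by
    intro δ hδ x y t
    have := moll_xLip μ hσ h1 hG hδ y (x - y) t
    simpa using this
  have hmoll : ∀ δ > 0, ∀ p q, |moll F δ p - moll F δ q| ≤ ‖p.1 - q.1‖ + C * √|p.2 - q.2| := by
    intro δ hδ p q
    obtain ⟨B, hB⟩ := moll_bdd (F := F) hM h2 hδ
    obtain ⟨L, hL0, hL⟩ := moll_tLip hFm hM h2 hδ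
    have ht := hnice (moll F δ) B L hB (fun p q => by
      have a1 := hx δ hδ p.1 q.1 p.2
      have a2 := hL q.1 p.2 q.2
      calc _ = |(moll F δ (p.1, p.2) - moll F δ (q.1, p.2)) + (moll F δ (q.1, p.2) - moll F δ (q.1, q.2))| := by
            congr 1; ring
        _ ≤ _ := (abs_add_le _ _).trans (add_le_add a1 a2))
      (fun x => moll_decay hn μ hσ h1 hδ x) (moll_bmo hFm hM h2 hM' h3 hδ hb)
    have a1 := hx δ hδ p.1 q.1 p.2
    have a2 := ht q.1 p.2 q.2
    calc _ = |(moll F δ (p.1, p.2) - moll F δ (q.1, p.2)) + (moll F δ (q.1, p.2) - moll F δ (q.1, q.2))| := by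
          congr 1; ring
      _ ≤ _ := (abs_add_le _ _).trans (add_le_add a1 a2)
  have hδ0 : Tendsto (fun k : ℕ => 1 / ((k : ℝ) + 1)) atTop (𝓝[>] 0) := by
    apply tendsto_nhdsWithin_of_tendsto_nhds_of_eventually_within _ tendsto_one_div_add_atTop_nhds_zero_nat
    exact Eventually.of_forall fun k => by rw [Set.mem_Ioi]; positivity
  have hae : ∀ᵐ p, Tendsto (fun k : ℕ => moll F (1 / ((k : ℝ) + 1)) p) atTop (𝓝 (F p)) := by
    have hleb := IsUnifLocDoublingMeasure.ae_tendsto_average (μ := (volume : Measure (Pt n))) (cW_locInt μ hσ h1) 1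
    filter_upwards [hleb] with p hp
    have := hp (fun _ : ℕ => p) (fun k : ℕ => 1 / ((k : ℝ) + 1)) hδ0
      (Eventually.of_forall fun k => Metric.mem_closedBall_self (by positivity))
    simpa only [moll_eq] using this
  set E : Set (Pt n) := {p | Tendsto (fun k : ℕ => moll F (1 / ((k : ℝ) + 1)) p) atTop (𝓝 (F p))} with hE
  have hEne : E.Nonempty := hae.exists
  obtain ⟨G, hG1, hG2⟩ := mcshane (fun p q : Pt n => ‖p.1 - q.1‖ + C * √|p.2 - q.2|) (by simp)
    (fun p q => by rw [norm_sub_rev, abs_sub_comm])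
    (fun p q r => by
      have a1 := norm_sub_le_norm_sub_add_norm_sub p.1 q.1 r.1
      have a2 : √|p.2 - r.2| ≤ √|p.2 - q.2| + √|q.2 - r.2| :=
        (Real.sqrt_le_sqrt (abs_sub_le _ _ _)).trans (sqrt_add_le' (abs_nonneg _) (abs_nonneg _))
      nlinarith) E hEne F (fun p hp q hq => by
      have hp' : Tendsto (fun k : ℕ => moll F (1 / ((k : ℝ) + 1)) p) atTop (𝓝 (F p)) := hp
      have hq' : Tendsto (fun k : ℕ => moll F (1 / ((k : ℝ) + 1)) q) atTop (𝓝 (F q)) := hq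
      exact le_of_tendsto (hp'.sub hq').abs (Eventually.of_forall fun k => hmoll _ (by positivity) p q))
  exact ⟨G, hG1, by filter_upwards [hae] with p hp using hG2 p hp⟩

/-- the sign of the Jordan decomposition -/
lemma jordan_sign {n : ℕ} (ν : SignedMeasure (Pt n)) : ∃ (μ : Measure (Pt n)) (_ : IsFiniteMeasure μ) (σ : Pt n → ℝ),
    Measurable σ ∧ (∀ z, |σ z| ≤ 1) ∧
    (convW ν =ᵐ[volume] cW μ σ) ∧ (convGradW ν =ᵐ[volume] cG μ σ) ∧
    ∀ φ : Pt n → ℝ, Measurable φ → (∃ B, ∀ z, |φ z| ≤ B) → convWd ν φ =ᵐ[volume] cW μ (fun z => σ z * φ z) := by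
  set P := ν.toJordanDecomposition.posPart with hP
  set N := ν.toJordanDecomposition.negPart with hN
  obtain ⟨S, hS, hS1, hS2⟩ := ν.toJordanDecomposition.mutuallySingular
  set σ : Pt n → ℝ := S.indicator (fun _ => (-1:ℝ)) + Sᶜ.indicator (fun _ => (1:ℝ)) with hσ
  have s1 : ∀ z ∈ S, σ z = -1 := by intro z hz; simp [hσ, hz]
  have s2 : ∀ z ∉ S, σ z = 1 := by intro z hz; simp [hσ, hz]
  have hσm : Measurable σ := (measurable_const.indicator hS).add (measurable_const.indicator hS.compl)
  have hσ1 : ∀ z, |σ z| ≤ 1 := by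
    intro z; by_cases hz : z ∈ S
    · rw [s1 z hz]; simp
    · rw [s2 z hz]; simp
  have aP : ∀ᵐ z ∂P, σ z = 1 := by
    have : ∀ᵐ z ∂P, z ∉ S := measure_eq_zero_iff_ae_notMem.1 hS1
    filter_upwards [this] with z hz using s2 z hz
  have aN : ∀ᵐ z ∂N, σ z = -1 := by
    have : ∀ᵐ z ∂N, z ∉ Sᶜ := measure_eq_zero_iff_ae_notMem.1 hS2
    filter_upwards [this] with z hz using s1 z (by simpa using hz)
  have gen : ∀ (E : Type) [NormedAddCommGroup E] [NormedSpace ℝ E], ∀ f : Pt n → E, Integrable f (P + N) →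
      ∫ z, σ z • f z ∂(P + N) = ∫ z, f z ∂P - ∫ z, f z ∂N := by
    intro E _ _ f hf
    have hf' : Integrable (fun z => σ z • f z) (P + N) :=
      hf.bdd_smul 1 hσm.aestronglyMeasurable (Eventually.of_forall hσ1)
    rw [integral_add_measure hf'.left_of_add_measure hf'.right_of_add_measure, sub_eq_add_neg, ← integral_neg]
    congr 1
    · apply integral_congr_ae; filter_upwards [aP] with z hz; rw [hz, one_smul]
    · apply integral_congr_ae; filter_upwards [aN] with z hz; rw [hz, neg_one_smul]
  refine ⟨P + N, inferInstance, σ, hσm, hσ1, ?_, ?_, ?_⟩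
  · filter_upwards [ae_integrable_W (P + N)] with p hp
    exact (gen ℝ _ hp).symm
  · filter_upwards [ae_integrable_G (P + N)] with p hp
    exact (gen _ _ hp).symm
  · rintro φ hφ ⟨B, hB⟩
    filter_upwards [ae_integrable_W (P + N)] with p hp
    have := (gen ℝ _ (Integrable.sig_mul hφ hB hp)).symm
    unfold convWd sInt cW
    refine this.trans ?_
    congr 1; funext z; rw [smul_eq_mul, mul_assoc]

/-- basis vector -/
def bv {n : ℕ} (i : Fin n) : Spc n := EuclideanSpace.single i 1
/-- partial derivative -/
def Dx {n : ℕ} (φ : Pt n → ℝ) (i : Fin n) (p : Pt n) : ℝ := fderiv ℝ φ p (bv i, 0)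
/-- time derivative -/
def Dt {n : ℕ} (φ : Pt n → ℝ) (p : Pt n) : ℝ := fderiv ℝ φ p (0, 1)
/-- Laplacian -/
def Lx {n : ℕ} (φ : Pt n → ℝ) (p : Pt n) : ℝ := ∑ i, Dx (Dx φ i) i p
/-- spatial differential -/
def Ds {n : ℕ} (φ : Pt n → ℝ) (p : Pt n) (v : Spc n) : ℝ := fderiv ℝ φ p (v, 0)
/-- Gaussian -/
def gam {n : ℕ} (ξ : Spc n) : ℝ := heatW (ξ, 1)

section
variable {n : ℕ}

lemma gam_nonneg (ξ : Spc n) : 0 ≤ gam ξ := heatW_nonneg _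
lemma gam_measurable : Measurable (gam (n := n)) := by unfold gam; fun_prop
attribute [fun_prop] gam_measurable
lemma gam_integrable : Integrable (gam (n := n)) := heatW_integrable 1
lemma gam_integral : ∫ ξ : Spc n, gam ξ = 1 := heatW_integral one_pos

lemma gradW_one (ξ : Spc n) : gradW (ξ, 1) = (-(1/2) * gam ξ) • ξ := by
  simp only [gradW, gam, heatW, zero_lt_one, if_true]
  congr 1; ring

lemma gradW_eq (y : Spc n) (u : ℝ) : gradW (y, u) = (-(1 / (2 * u)) * heatW (y, u)) • y := by
  simp only [gradW, heatW]
  split_ifs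
  · congr 1; ring
  · simp

lemma gam_moment : Integrable (fun ξ : Spc n => ‖ξ‖ * gam ξ) := by
  have h : Integrable (fun ξ : Spc n => 2 * (2 ^ ((n : ℝ) / 2) * (1 / √1) * heatW (ξ, 2 * 1))) :=
    ((heatW_integrable (n := n) (2 * 1)).const_mul _).const_mul _
  refine h.mono' (by fun_prop) (Eventually.of_forall fun ξ => ?_)
  have := gradW_norm_le ξ one_pos
  rw [gradW_one, norm_smul, norm_mul, Real.norm_eq_abs (gam ξ), abs_of_nonneg (gam_nonneg ξ)] at this
  rw [norm_mul, norm_norm, Real.norm_eq_abs, abs_of_nonneg (gam_nonneg ξ)]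
  have h2 : ‖(-(1/2) : ℝ)‖ = 1/2 := by norm_num
  rw [h2] at this
  nlinarith

lemma bv_inner (i : Fin n) (v : Spc n) : inner ℝ (bv i) v = v i := by
  unfold bv; simp [EuclideanSpace.inner_single_left]

lemma vec_sum (v : Spc n) : v = ∑ i, v i • bv i := by
  have := (EuclideanSpace.basisFun (Fin n) ℝ).sum_repr v
  simpa [bv] using this.symm

lemma coord_le (v : Spc n) (i : Fin n) : |v i| ≤ ‖v‖ := by
  have := PiLp.norm_apply_le v i
  simpa using this

lemma gam_ibp (i : Fin n) {f f' : Spc n → ℝ} (hf : ∀ ξ, HasLineDerivAt ℝ f (f' ξ) ξ (bv i))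
    (hfc : Measurable f) (hfc' : Measurable f') {B : ℝ} (hB : ∀ ξ, |f ξ| ≤ B) (hB' : ∀ ξ, |f' ξ| ≤ B) :
    ∫ ξ, f ξ * (ξ i * gam ξ) = 2 * ∫ ξ, f' ξ * gam ξ := by
  have hi : Integrable (fun ξ : Spc n => ξ i * gam ξ) := by
    refine gam_moment.mono' (by fun_prop) (Eventually.of_forall fun ξ => ?_)
    rw [norm_mul, Real.norm_eq_abs, Real.norm_eq_abs, abs_of_nonneg (gam_nonneg ξ)]
    gcongr
    · exact gam_nonneg _
    · exact coord_le _ _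
  have hb : ∀ g : Spc n → ℝ, Integrable g → ∀ f : Spc n → ℝ, Measurable f → (∀ ξ, |f ξ| ≤ B) → Integrable (fun ξ => f ξ * g ξ) :=
    fun g hg f hf hB => hg.bdd_mul (c := B) hf.aestronglyMeasurable (Eventually.of_forall hB)
  have hg : ∀ ξ : Spc n, HasLineDerivAt ℝ (gam (n := n)) (-(1/2) * (ξ i * gam ξ)) ξ (bv i) := by
    intro ξ
    have := heatW_lineDeriv ξ (bv i) 1 0
    simp only [zero_smul, add_zero] at this
    rw [gradW_one, inner_smul_right, bv_inner] at this
    refine HasDerivAt.congr_deriv this ?_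
    ring
  have hi2 : Integrable (fun ξ : Spc n => -(1/2) * (ξ i * gam ξ)) := hi.const_mul _
  have := integral_bilinear_hasLineDerivAt_right_eq_neg_left_of_integrable (μ := (volume : Measure (Spc n)))
    (f := f) (f' := f') (g := gam) (g' := fun ξ => -(1/2) * (ξ i * gam ξ)) (v := bv i) (B := ContinuousLinearMap.mul ℝ ℝ)
    (hb _ gam_integrable _ hfc' hB') (hb _ hi2 _ hfc hB) (hb _ gam_integrable _ hfc hB) (fun ξ _ => hf ξ) (fun ξ _ => hg ξ)
  simp only [ContinuousLinearMap.mul_apply'] at this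
  have e : ∀ ξ : Spc n, f ξ * (-(1/2) * (ξ i * gam ξ)) = -(1/2) * (f ξ * (ξ i * gam ξ)) := fun ξ => by ring
  simp_rw [e] at this
  rw [integral_const_mul] at this
  linarith

/-- C² with compact support -/
def Good (φ : Pt n → ℝ) : Prop := ContDiff ℝ 2 φ ∧ HasCompactSupport φ

variable {φ : Pt n → ℝ}

lemma Good.diff (h : Good φ) : Differentiable ℝ φ := h.1.differentiable (by norm_num)
lemma Good.fd1 (h : Good φ) : ContDiff ℝ 1 (fderiv ℝ φ) := h.1.fderiv_right (by norm_num)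
lemma Good.fdc (h : Good φ) : Continuous (fderiv ℝ φ) := h.fd1.continuous
lemma Good.dx1 (h : Good φ) (i : Fin n) : ContDiff ℝ 1 (Dx φ i) := h.fd1.clm_apply contDiff_const
lemma Good.dxs (h : Good φ) (i : Fin n) : HasCompactSupport (Dx φ i) := h.2.fderiv_apply ℝ _
lemma Good.dxc (h : Good φ) (i : Fin n) : Continuous (Dx φ i) := (h.dx1 i).continuous
lemma Good.dtc (h : Good φ) : Continuous (Dt φ) := h.fdc.clm_apply continuous_const
lemma Good.dxxc (h : Good φ) (i : Fin n) : Continuous (Dx (Dx φ i) i) :=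
  ((h.dx1 i).continuous_fderiv (by norm_num)).clm_apply continuous_const
lemma Good.dxxs (h : Good φ) (i : Fin n) : HasCompactSupport (Dx (Dx φ i) i) := (h.dxs i).fderiv_apply ℝ _
lemma Good.lxc (h : Good φ) : Continuous (Lx φ) := continuous_finset_sum _ fun i _ => h.dxxc i
lemma Good.dsc (h : Good φ) (v : Spc n) : Continuous (fun p => Ds φ p v) := h.fdc.clm_apply continuous_const
lemma Good.ds_sum (φ : Pt n → ℝ) (p : Pt n) (v : Spc n) : Ds φ p v = ∑ i, Dx φ i p * v i := by
  unfold Ds Dx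
  conv_lhs => rw [vec_sum v]
  have : ((∑ i, v i • bv i : Spc n), (0:ℝ)) = ∑ i, v i • ((bv i : Spc n), (0:ℝ)) := by
    rw [Prod.ext_iff]; constructor
    · simp [Prod.fst_sum]
    · simp [Prod.snd_sum]
  rw [this, map_sum]
  refine Finset.sum_congr rfl fun i _ => ?_
  rw [map_smul, smul_eq_mul, mul_comm]

lemma Good.bound (h : Good φ) : ∃ B, 0 ≤ B ∧ (∀ p, |φ p| ≤ B) ∧ (∀ p, ‖fderiv ℝ φ p‖ ≤ B) ∧ (∀ i p, |Dx φ i p| ≤ B) ∧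
    (∀ i p, |Dx (Dx φ i) i p| ≤ B) ∧ (∀ p, |Lx φ p| ≤ B) ∧ (∀ p, |Dt φ p| ≤ B) := by
  obtain ⟨B0, h0⟩ := h.1.continuous.bounded_above_of_compact_support h.2
  obtain ⟨B1, h1⟩ := h.fdc.bounded_above_of_compact_support (h.2.fderiv ℝ)
  have h2 : ∃ B, ∀ i p, |Dx φ i p| ≤ B := by
    choose f hf using fun i => (h.dxc i).bounded_above_of_compact_support (h.dxs i)
    refine ⟨∑ i, |f i|, fun i p => (hf i p).trans ((le_abs_self _).trans ?_)⟩
    exact Finset.single_le_sum (f := fun i => |f i|) (fun _ _ => abs_nonneg _) (Finset.mem_univ i)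
  have h3 : ∃ B, 0 ≤ B ∧ ∀ i p, |Dx (Dx φ i) i p| ≤ B := by
    choose f hf using fun i => (h.dxxc i).bounded_above_of_compact_support (h.dxxs i)
    refine ⟨∑ i, |f i|, Finset.sum_nonneg fun _ _ => abs_nonneg _, fun i p => (hf i p).trans ((le_abs_self _).trans ?_)⟩
    exact Finset.single_le_sum (f := fun i => |f i|) (fun _ _ => abs_nonneg _) (Finset.mem_univ i)
  obtain ⟨B2, h2⟩ := h2
  obtain ⟨B3, h30, h3⟩ := h3
  have h4 : ∃ B, ∀ p, |Dt φ p| ≤ B := h.dtc.bounded_above_of_compact_support (h.2.fderiv_apply ℝ _)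
  obtain ⟨B4, h4⟩ := h4
  have h5 : ∀ p, |Lx φ p| ≤ n * B3 := by
    intro p
    refine (Finset.abs_sum_le_sum_abs _ _).trans ?_
    refine (Finset.sum_le_sum fun i _ => h3 i p).trans ?_
    simp
  have hn : 0 ≤ n * B3 := by positivity
  refine ⟨|B0| + |B1| + |B2| + B3 + n * B3 + |B4|, by positivity, ?_, ?_, ?_, ?_, ?_, ?_⟩
  all_goals have := le_abs_self B0; have := le_abs_self B1; have := le_abs_self B2; have := le_abs_self B4
  all_goals have := abs_nonneg B0; have := abs_nonneg B1; have := abs_nonneg B2; have := abs_nonneg B4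
  · intro p; have := h0 p; rw [Real.norm_eq_abs] at this; linarith
  · intro p; have := h1 p; linarith
  · intro i p; have := h2 i p; linarith
  · intro i p; have := h3 i p; linarith
  · intro p; have := h5 p; linarith
  · intro p; have := h4 p; linarith

/-- the line derivative of a differentiable function along an affine map -/
lemma Good.lineD {f : Pt n → ℝ} (hf : Differentiable ℝ f) (m : Spc n) (s u : ℝ) (i : Fin n) (ξ : Spc n) :
    HasLineDerivAt ℝ (fun ξ => f (m + s • ξ, u)) (s * Dx f i (m + s • ξ, u)) ξ (bv i) := by
  unfold HasLineDerivAt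
  have h1 : HasDerivAt (fun θ : ℝ => ((m + s • (ξ + θ • bv i), u) : Pt n)) (s • bv i, 0) 0 := by
    have : HasDerivAt (fun θ : ℝ => m + s • (ξ + θ • bv i)) (s • bv i) 0 := by
      simpa using ((((hasDerivAt_id (0:ℝ)).smul_const (bv i)).const_add ξ).const_smul s).const_add m
    exact this.prodMk (hasDerivAt_const _ _)
  have h2 : HasFDerivAt f (fderiv ℝ f (m + s • ξ, u)) (m + s • (ξ + (0:ℝ) • bv i), u) := by
    simpa using (hf (m + s • ξ, u)).hasFDerivAt
  have := h2.comp_hasDerivAt 0 h1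
  refine this.congr_deriv ?_
  unfold Dx
  have : ((s • bv i, 0) : Pt n) = s • (bv i, 0) := by simp
  rw [this, map_smul, smul_eq_mul]

/-- Gaussian integration by parts -/
lemma gauss_ibp (h : Good φ) (m : Spc n) (s u : ℝ) :
    ∫ ξ, Ds φ (m + s • ξ, u) ξ * gam ξ = 2 * s * ∫ ξ, Lx φ (m + s • ξ, u) * gam ξ := by
  obtain ⟨B, hB0, -, -, hB1, hB2, -, -⟩ := h.bound
  have hc : Continuous (fun ξ : Spc n => ((m + s • ξ, u) : Pt n)) := by fun_prop
  have hm1 : ∀ i, Measurable fun ξ : Spc n => Dx φ i (m + s • ξ, u) := fun i => ((h.dxc i).comp hc).measurable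
  have hm2 : ∀ i, Measurable fun ξ : Spc n => Dx (Dx φ i) i (m + s • ξ, u) := fun i => ((h.dxxc i).comp hc).measurable
  have key : ∀ i, ∫ ξ, Dx φ i (m + s • ξ, u) * (ξ i * gam ξ) = 2 * ∫ ξ, (s * Dx (Dx φ i) i (m + s • ξ, u)) * gam ξ := by
    intro i
    apply gam_ibp i (B := B + |s| * B) (fun ξ => Good.lineD ((h.dx1 i).differentiable (by norm_num)) m s u i ξ) (hm1 i)
      ((hm2 i).const_mul s)
    · intro ξ; have := hB1 i (m + s • ξ, u)
      have : 0 ≤ |s| * B := by positivity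
      linarith
    · intro ξ; rw [abs_mul]
      have := mul_le_mul_of_nonneg_left (hB2 i (m + s • ξ, u)) (abs_nonneg s)
      linarith
  have hi : ∀ i, Integrable (fun ξ : Spc n => ξ i * gam ξ) := by
    intro i
    refine gam_moment.mono' (by fun_prop) (Eventually.of_forall fun ξ => ?_)
    rw [norm_mul, Real.norm_eq_abs, Real.norm_eq_abs, abs_of_nonneg (gam_nonneg ξ)]
    gcongr
    · exact gam_nonneg _
    · exact coord_le _ _
  simp_rw [Good.ds_sum, Lx, Finset.sum_mul]
  rw [integral_finset_sum, integral_finset_sum, Finset.mul_sum]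
  · apply Finset.sum_congr rfl
    intro i _
    have := key i
    simp_rw [mul_assoc] at this ⊢
    rw [this, integral_const_mul]
  · intro i _
    exact gam_integrable.bdd_mul (c := B) (hm2 i).aestronglyMeasurable (Eventually.of_forall fun ξ => hB2 i _)
  · intro i _
    simp_rw [mul_assoc]
    exact (hi i).bdd_mul (c := B) (hm1 i).aestronglyMeasurable (Eventually.of_forall fun ξ => hB1 i _)

end

section
variable {n : ℕ} {φ : Pt n → ℝ}

/-- Gaussian mean -/
def gE (f : Pt n → ℝ) (m : Spc n) (s u : ℝ) : ℝ := ∫ ξ, f (m + s • ξ, u) * gam ξ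

lemma gE_integrable {f : Pt n → ℝ} (hf : Continuous f) {B : ℝ} (hB : ∀ p, |f p| ≤ B) (m : Spc n) (s u : ℝ) :
    Integrable (fun ξ => f (m + s • ξ, u) * gam ξ) := by
  have hc : Continuous (fun ξ : Spc n => ((m + s • ξ, u) : Pt n)) := by fun_prop
  exact gam_integrable.bdd_mul (c := B) (hf.comp hc).aestronglyMeasurable (Eventually.of_forall fun ξ => hB _)

lemma gE_cont {f : Pt n → ℝ} (hf : Continuous f) {B : ℝ} (hB : ∀ p, |f p| ≤ B) {m : ℝ → Spc n} {s : ℝ → ℝ}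
    (hm : Continuous m) (hs : Continuous s) : Continuous (fun u => gE f (m u) (s u) u) := by
  unfold gE
  apply continuous_of_dominated (bound := fun ξ => B * gam ξ)
  · intro u; exact (gE_integrable hf hB _ _ _).aestronglyMeasurable
  · intro u; refine Eventually.of_forall fun ξ => ?_
    rw [norm_mul, Real.norm_eq_abs, Real.norm_eq_abs, abs_of_nonneg (gam_nonneg ξ)]
    exact mul_le_mul_of_nonneg_right (hB _) (gam_nonneg _)
  · exact gam_integrable.const_mul _
  · refine Eventually.of_forall fun ξ => ?_
    have hc : Continuous (fun u : ℝ => ((m u + s u • ξ, u) : Pt n)) := by fun_prop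
    exact (hf.comp hc).mul continuous_const

lemma gE_zero (f : Pt n → ℝ) (m : Spc n) (u : ℝ) : gE f m 0 u = f (m, u) := by
  unfold gE
  simp only [zero_smul, add_zero]
  rw [integral_const_mul, gam_integral, mul_one]

lemma gauss_deriv (h : Good φ) (a b : Spc n) {s s' : ℝ → ℝ} {c d : ℝ}
    (hs : ∀ u ∈ Ioo c d, HasDerivAt s (s' u) u) (hs' : ContinuousOn s' (Ioo c d)) {u : ℝ} (hu : u ∈ Ioo c d) :
    HasDerivAt (fun u => gE φ (a + u • b) (s u) u)
      (gE (Dt φ) (a + u • b) (s u) u + gE (fun p => Ds φ p b) (a + u • b) (s u) u +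
        (2 * s u * s' u) * gE (Lx φ) (a + u • b) (s u) u) u := by
  obtain ⟨B, hB0, hBφ, hB1, -, -, hBL, hBt⟩ := h.bound
  have hno : Ioo c d ∈ 𝓝 u := isOpen_Ioo.mem_nhds hu
  have hct : ContinuousAt s' u := hs'.continuousAt hno
  obtain ⟨V, hV, hVb⟩ : ∃ V ∈ 𝓝 u, ∀ v ∈ V, v ∈ Ioo c d ∧ |s' v| ≤ |s' u| + 1 := by
    refine ⟨_, inter_mem hno (hct.abs (Iio_mem_nhds (lt_add_one |s' u|))), ?_⟩
    rintro v ⟨h1, h2⟩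
    exact ⟨h1, le_of_lt h2⟩
  set F' : ℝ → Spc n → ℝ := fun v ξ => (fderiv ℝ φ (a + v • b + s v • ξ, v) (b + s' v • ξ, 1)) * gam ξ with hF'
  have hdsb : ∀ p v, |Ds φ p v| ≤ B * ‖v‖ := by
    intro p v
    unfold Ds
    refine (((fderiv ℝ φ p).le_opNorm _)).trans ?_
    refine mul_le_mul (hB1 p) ?_ (norm_nonneg _) hB0
    simp [Prod.norm_def]
  have hc : ∀ v, Continuous (fun ξ : Spc n => ((a + v • b + s v • ξ, v) : Pt n)) := fun v => by fun_prop
  have key := hasDerivAt_integral_of_dominated_loc_of_deriv_le (μ := (volume : Measure (Spc n)))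
    (F := fun v ξ => φ (a + v • b + s v • ξ, v) * gam ξ) (F' := F') (x₀ := u) (s := V)
    (bound := fun ξ => B * ((‖b‖ + 1) * gam ξ + (|s' u| + 1) * (‖ξ‖ * gam ξ))) hV
    (Eventually.of_forall fun v => (gE_integrable h.1.continuous hBφ _ _ _).aestronglyMeasurable)
    (gE_integrable h.1.continuous hBφ _ _ _) (by
      apply AEStronglyMeasurable.mul _ (gam_measurable.aestronglyMeasurable)
      apply Continuous.aestronglyMeasurable
      exact (h.fdc.comp (hc u)).clm_apply (by fun_prop))
    (by
      refine Eventually.of_forall fun ξ v hv => ?_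
      simp only [hF']
      rw [norm_mul, Real.norm_eq_abs (gam ξ), abs_of_nonneg (gam_nonneg ξ)]
      have h1 : ‖(b + s' v • ξ, (1:ℝ))‖ ≤ ‖b‖ + 1 + (|s' u| + 1) * ‖ξ‖ := by
        have hh : ‖b + s' v • ξ‖ ≤ ‖b‖ + (|s' u| + 1) * ‖ξ‖ := by
          refine (norm_add_le _ _).trans ?_
          rw [norm_smul, Real.norm_eq_abs]
          gcongr
          exact (hVb v hv).2
        have hh2 : 0 ≤ (|s' u| + 1) * ‖ξ‖ := by positivity
        rw [Prod.norm_def]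
        apply max_le
        · simp only; linarith
        · simp only [norm_one]; linarith [norm_nonneg b]
      calc _ ≤ (B * (‖b‖ + 1 + (|s' u| + 1) * ‖ξ‖)) * gam ξ := by
            refine mul_le_mul_of_nonneg_right ?_ (gam_nonneg _)
            refine ((fderiv ℝ φ _).le_opNorm _).trans ?_
            exact mul_le_mul (hB1 _) h1 (norm_nonneg _) hB0
        _ = _ := by ring)
    (((gam_integrable.const_mul _).add (gam_moment.const_mul _)).const_mul _)
    (by
      refine Eventually.of_forall fun ξ v hv => ?_
      have h1 : HasDerivAt (fun v : ℝ => ((a + v • b + s v • ξ, v) : Pt n)) (b + s' v • ξ, 1) v := by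
        have h2 : HasDerivAt (fun v : ℝ => a + v • b + s v • ξ) (b + s' v • ξ) v := by
          have e1 : HasDerivAt (fun v : ℝ => a + v • b) b v := by
            simpa using ((hasDerivAt_id v).smul_const b).const_add a
          exact e1.add ((hs v (hVb v hv).1).smul_const ξ)
        exact h2.prodMk (hasDerivAt_id v)
      exact ((h.diff _).hasFDerivAt.comp_hasDerivAt v h1).mul_const _)
  refine key.2.congr_deriv ?_
  have i1 := gE_integrable h.dtc hBt (a + u • b) (s u) u
  have i2 := gE_integrable (h.dsc b) (fun p => hdsb p b) (a + u • b) (s u) u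
  have i3 : Integrable (fun ξ => s' u * (Ds φ (a + u • b + s u • ξ, u) ξ * gam ξ)) := by
    apply Integrable.const_mul
    refine (gam_moment.const_mul B).mono' ?_ (Eventually.of_forall fun ξ => ?_)
    · apply AEStronglyMeasurable.mul _ (gam_measurable.aestronglyMeasurable)
      apply Continuous.aestronglyMeasurable
      exact (h.fdc.comp (hc u)).clm_apply (by fun_prop)
    · rw [norm_mul, Real.norm_eq_abs, Real.norm_eq_abs, abs_of_nonneg (gam_nonneg ξ), ← mul_assoc]
      exact mul_le_mul_of_nonneg_right (hdsb _ _) (gam_nonneg _)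
  have e : ∀ ξ, F' u ξ = (Dt φ (a + u • b + s u • ξ, u) * gam ξ + Ds φ (a + u • b + s u • ξ, u) b * gam ξ) +
      s' u * (Ds φ (a + u • b + s u • ξ, u) ξ * gam ξ) := by
    intro ξ
    simp only [hF', Dt, Ds]
    have : ((b + s' u • ξ, 1) : Pt n) = (0, 1) + (b, 0) + s' u • (ξ, 0) := by simp
    rw [this, map_add, map_add, map_smul, smul_eq_mul]; ring
  simp_rw [e]
  have i12 : Integrable (fun ξ => Dt φ (a + u • b + s u • ξ, u) * gam ξ + Ds φ (a + u • b + s u • ξ, u) b * gam ξ) := i1.add i2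
  rw [integral_add i12 i3, integral_add i1 i2, integral_const_mul, gauss_ibp h]
  unfold gE
  ring

lemma gauss_ftc (h : Good φ) (a b : Spc n) {s s' κ : ℝ → ℝ} {c d : ℝ} (hcd : c ≤ d) (hsc : Continuous s)
    (hs : ∀ u ∈ Ioo c d, HasDerivAt s (s' u) u) (hs' : ContinuousOn s' (Ioo c d)) (hκc : Continuous κ)
    (hκ : ∀ u ∈ Ioo c d, 2 * s u * s' u = κ u) :
    ∫ u in c..d, (gE (Dt φ) (a + u • b) (s u) u + gE (fun p => Ds φ p b) (a + u • b) (s u) u +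
        κ u * gE (Lx φ) (a + u • b) (s u) u) = gE φ (a + d • b) (s d) d - gE φ (a + c • b) (s c) c := by
  obtain ⟨B, hB0, hBφ, hB1, -, -, hBL, hBt⟩ := h.bound
  have hdsb : ∀ p v, |Ds φ p v| ≤ B * ‖v‖ := by
    intro p v
    unfold Ds
    refine (((fderiv ℝ φ p).le_opNorm _)).trans ?_
    refine mul_le_mul (hB1 p) ?_ (norm_nonneg _) hB0
    simp [Prod.norm_def]
  have hm : Continuous (fun u : ℝ => a + u • b) := by fun_prop
  apply intervalIntegral.integral_eq_sub_of_hasDerivAt_of_le hcd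
  · exact (gE_cont h.1.continuous hBφ hm hsc).continuousOn
  · intro u hu
    have := gauss_deriv h a b hs hs' hu
    rwa [hκ u hu] at this
  · apply Continuous.intervalIntegrable
    exact ((gE_cont h.dtc hBt hm hsc).add (gE_cont (h.dsc b) (fun p => hdsb p b) hm hsc)).add
      (hκc.mul (gE_cont h.lxc hBL hm hsc))

end

section
variable {n : ℕ} {φ : Pt n → ℝ}

lemma chg_var (g : Spc n → ℝ) (m : Spc n) {s : ℝ} (hs : 0 < s) :
    ∫ y, g y = ∫ ξ, s ^ n * g (m + s • ξ) := by
  rw [integral_const_mul]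
  have h := Measure.integral_comp_smul (volume : Measure (Spc n)) (fun y => g (m + y)) s
  rw [h, integral_add_left_eq_self (μ := (volume : Measure (Spc n))) g m, smul_eq_mul, finrank_euclideanSpace_fin, abs_of_pos (by positivity),
    ← mul_assoc, mul_inv_cancel₀ (by positivity), one_mul]

lemma pow_eq_rpow_sq {s : ℝ} (hs : 0 < s) : s ^ n = (s ^ 2) ^ ((n : ℝ) / 2) := by
  rw [← Real.rpow_natCast s 2, ← Real.rpow_mul hs.le, ← Real.rpow_natCast s n]
  congr 1; push_cast; ring

lemma heat_scale (x ξ : Spc n) {s : ℝ} (hs : 0 < s) :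
    s ^ n * heatW (x - (x + s • ξ), s ^ 2) = gam ξ := by
  have h2 : 0 < s ^ 2 := by positivity
  simp only [gam, heatW, h2, zero_lt_one, if_true, mul_one]
  rw [sub_add_cancel_left, norm_neg, norm_smul, pow_eq_rpow_sq hs, Real.mul_rpow (by positivity) (by positivity),
    ← mul_assoc, mul_left_comm, ← Real.rpow_add h2]
  have e1 : (n : ℝ) / 2 + -(n : ℝ) / 2 = 0 := by ring
  rw [e1, Real.rpow_zero, mul_one]
  congr 2
  rw [mul_pow, Real.norm_eq_abs, sq_abs]
  field_simp

lemma heat_gE (f : Pt n → ℝ) (x : Spc n) {r : ℝ} (hr : 0 < r) (u : ℝ) :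
    ∫ y, heatW (x - y, r) * f (y, u) = gE f x (√r) u := by
  rw [chg_var _ x (Real.sqrt_pos.2 hr)]
  unfold gE
  congr 1; funext ξ
  rw [← heat_scale x ξ (Real.sqrt_pos.2 hr), Real.sq_sqrt hr.le]
  ring

lemma bridge (x ξ : Spc n) {t u s : ℝ} (hu : 0 < u) (hut : u < t) (hs : 0 < s) (hs2 : s ^ 2 = u * (t - u) / t) :
    s ^ n * (heatW (x - ((u / t) • x + s • ξ), t - u) * heatW ((u / t) • x + s • ξ, u)) = heatW (x, t) * gam ξ := by
  have ht : 0 < t := hu.trans hut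
  have htu : 0 < t - u := by linarith
  simp only [gam, heatW, hu, htu, ht, zero_lt_one, if_true, mul_one]
  have hx : x - ((u / t) • x + s • ξ) = ((t - u) / t) • x - s • ξ := by
    have : ((t - u) / t) • x = x - (u / t) • x := by
      rw [sub_div, div_self ht.ne', sub_smul, one_smul]
    rw [this]; abel
  rw [hx]
  have n1 : ‖((t - u) / t) • x - s • ξ‖ ^ 2 = ((t - u) / t) ^ 2 * ‖x‖ ^ 2 - 2 * ((t - u) / t) * s * inner ℝ x ξ + s ^ 2 * ‖ξ‖ ^ 2 := by
    rw [norm_sub_sq_real, norm_smul, norm_smul, inner_smul_left, inner_smul_right, mul_pow, mul_pow, Real.norm_eq_abs, Real.norm_eq_abs, sq_abs, sq_abs]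
    simp only [RCLike.conj_to_real]; ring
  have n2 : ‖(u / t) • x + s • ξ‖ ^ 2 = (u / t) ^ 2 * ‖x‖ ^ 2 + 2 * (u / t) * s * inner ℝ x ξ + s ^ 2 * ‖ξ‖ ^ 2 := by
    rw [norm_add_sq_real, norm_smul, norm_smul, inner_smul_left, inner_smul_right, mul_pow, mul_pow, Real.norm_eq_abs, Real.norm_eq_abs, sq_abs, sq_abs]
    simp only [RCLike.conj_to_real]; ring
  have eexp : -‖((t - u) / t) • x - s • ξ‖ ^ 2 / (4 * (t - u)) + -‖(u / t) • x + s • ξ‖ ^ 2 / (4 * u) =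
      -‖x‖ ^ 2 / (4 * t) + -‖ξ‖ ^ 2 / 4 := by
    rw [n1, n2, hs2]
    field_simp
    ring
  have epre : s ^ n * ((4 * π * (t - u)) ^ (-(n : ℝ) / 2) * (4 * π * u) ^ (-(n : ℝ) / 2)) =
      (4 * π * t) ^ (-(n : ℝ) / 2) * (4 * π) ^ (-(n : ℝ) / 2) := by
    rw [← Real.mul_rpow (by positivity) (by positivity), ← Real.mul_rpow (by positivity) (by positivity)]
    have : 4 * π * (t - u) * (4 * π * u) = (4 * π * t) * (4 * π) * s ^ 2 := by
      rw [hs2]; field_simp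
    rw [this, Real.mul_rpow (by positivity) (by positivity), pow_eq_rpow_sq hs, mul_left_comm, ← Real.rpow_add (by positivity)]
    have e1 : (n : ℝ) / 2 + -(n : ℝ) / 2 = 0 := by ring
    rw [e1, Real.rpow_zero, mul_one]
  calc _ = (s ^ n * ((4 * π * (t - u)) ^ (-(n : ℝ) / 2) * (4 * π * u) ^ (-(n : ℝ) / 2))) *
        (rexp (-‖((t - u) / t) • x - s • ξ‖ ^ 2 / (4 * (t - u))) * rexp (-‖(u / t) • x + s • ξ‖ ^ 2 / (4 * u))) := by ring
    _ = _ := by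
      rw [epre, ← Real.exp_add, eexp, Real.exp_add]; ring

/-- heat operator -/
def Th (φ : Pt n → ℝ) (p : Pt n) : ℝ := Dt φ p - Lx φ p

lemma Dx_zero_of {f : Pt n → ℝ} {p : Pt n} (hp : p ∉ tsupport f) (v : Pt n) : fderiv ℝ f p v = 0 := by
  have : fderiv ℝ f p = 0 := by
    by_contra h
    exact hp (support_fderiv_subset ℝ h)
  simp [this]

lemma tsupport_Dx (f : Pt n → ℝ) (i : Fin n) : tsupport (Dx f i) ⊆ tsupport f :=
  closure_minimal (fun p hp => by
    by_contra h
    exact hp (Dx_zero_of h _)) (isClosed_tsupport f)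

lemma Th_zero_of {p : Pt n} (hp : p ∉ tsupport φ) : Th φ p = 0 := by
  unfold Th Dt Lx
  rw [Dx_zero_of hp]
  rw [Finset.sum_eq_zero]
  · simp
  · intro i _
    exact Dx_zero_of (fun h => hp (tsupport_Dx φ i h)) _

lemma gE_sub {f g : Pt n → ℝ} (hf : Continuous f) (hg : Continuous g) {B : ℝ} (hB : ∀ p, |f p| ≤ B) (hB' : ∀ p, |g p| ≤ B)
    (m : Spc n) (s u : ℝ) : gE (fun p => f p - g p) m s u = gE f m s u - gE g m s u := by
  unfold gE
  rw [← integral_sub (gE_integrable hf hB _ _ _) (gE_integrable hg hB' _ _ _)]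
  congr 1; funext ξ; ring

lemma duh1 (h : Good φ) (x : Spc n) (t : ℝ) :
    ∫ u, ∫ y, heatW (x - y, t - u) * Th φ (y, u) = φ (x, t) := by
  obtain ⟨B, hB0, hBφ, hB1, -, -, hBL, hBt⟩ := h.bound
  obtain ⟨M, hM⟩ : ∃ M, ∀ p ∈ tsupport φ, ‖p‖ ≤ M := h.2.isCompact.isBounded.exists_norm_le
  have hlow : ∀ p : Pt n, p.2 < -M → p ∉ tsupport φ := by
    intro p hp hp'
    have h1 := (norm_snd_le p).trans (hM p hp')
    rw [Real.norm_eq_abs, abs_le] at h1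
    linarith
  set c := min t (-M) - 1 with hc
  have hct : c < t := by have := min_le_left t (-M); linarith
  have hcM : c < -M := by have := min_le_right t (-M); linarith
  have e1 : ∫ u, ∫ y, heatW (x - y, t - u) * Th φ (y, u) = ∫ u in Ioo c t, ∫ y, heatW (x - y, t - u) * Th φ (y, u) := by
    rw [setIntegral_eq_integral_of_forall_compl_eq_zero]
    intro u hu
    rw [Set.mem_Ioo, not_and_or, not_lt, not_lt] at hu
    rw [← integral_zero (Spc n) ℝ]
    congr 1; funext y
    rcases hu with hu | hu
    · rw [Th_zero_of (hlow _ (lt_of_le_of_lt hu hcM)), mul_zero]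
    · rw [heatW_of_nonpos _ (by linarith), zero_mul]
  have e2 : ∫ u in Ioo c t, ∫ y, heatW (x - y, t - u) * Th φ (y, u) =
      ∫ u in Ioo c t, (gE (Dt φ) (x + u • (0 : Spc n)) (√(t - u)) u + gE (fun p => Ds φ p (0 : Spc n)) (x + u • (0 : Spc n)) (√(t - u)) u +
        (-1) * gE (Lx φ) (x + u • (0 : Spc n)) (√(t - u)) u) := by
    apply setIntegral_congr_fun measurableSet_Ioo
    intro u hu
    have h0 : gE (fun p => Ds φ p (0 : Spc n)) (x + u • (0 : Spc n)) (√(t - u)) u = 0 := by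
      have : ∀ p : Pt n, Ds φ p 0 = 0 := fun p => by
        unfold Ds; exact map_zero _
      unfold gE; simp [this]
    simp only
    rw [heat_gE _ _ (by linarith [hu.2]), h0]
    unfold Th
    rw [gE_sub h.dtc h.lxc hBt hBL]
    simp; ring
  have hf := gauss_ftc h x (0 : Spc n) (s := fun u => √(t - u)) (s' := fun u => -1 / (2 * √(t - u))) (κ := fun _ => -1) hct.le
    (by fun_prop) (fun u hu => by
      have h1 : HasDerivAt (fun u : ℝ => t - u) (-1) u := by simpa using (hasDerivAt_id u).const_sub t
      exact h1.sqrt (by linarith [hu.2])) (by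
      apply ContinuousOn.div continuousOn_const (by fun_prop)
      intro u hu
      have : 0 < √(t - u) := Real.sqrt_pos.2 (by linarith [hu.2])
      positivity) continuous_const (fun u hu => by
      have : 0 < √(t - u) := Real.sqrt_pos.2 (by linarith [hu.2])
      field_simp)
  rw [intervalIntegral.integral_of_le hct.le, integral_Ioc_eq_integral_Ioo] at hf
  rw [e1, e2, hf]
  simp only [smul_zero, add_zero, sub_self, Real.sqrt_zero, gE_zero]
  have h0 : gE φ x (√(t - c)) c = 0 := by
    unfold gE
    rw [← integral_zero (Spc n) ℝ]
    congr 1; funext ξ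
    rw [image_eq_zero_of_notMem_tsupport (hlow _ hcM), zero_mul]
  rw [h0, sub_zero]

lemma duh2 (h : Good φ) (x : Spc n) {t : ℝ} (ht : 0 < t) :
    ∫ u in Ioo 0 t, ∫ y, heatW (x - y, t - u) * (heatW (y, u) * Th φ (y, u) - 2 * Ds φ (y, u) (gradW (y, u))) =
      heatW (x, t) * (φ (x, t) - φ (0, 0)) := by
  obtain ⟨B, hB0, hBφ, hB1, -, -, hBL, hBt⟩ := h.bound
  set b : Spc n := t⁻¹ • x with hb
  set s : ℝ → ℝ := fun u => √(u * (t - u) / t) with hs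
  have hq : ∀ u ∈ Ioo 0 t, 0 < u * (t - u) / t := by
    intro u hu
    have := hu.1; have : 0 < t - u := by linarith [hu.2]
    positivity
  have hdsb : ∀ p v, |Ds φ p v| ≤ B * ‖v‖ := by
    intro p v
    unfold Ds
    refine (((fderiv ℝ φ p).le_opNorm _)).trans ?_
    refine mul_le_mul (hB1 p) ?_ (norm_nonneg _) hB0
    simp [Prod.norm_def]
  have hf := gauss_ftc h (0 : Spc n) b (s := s) (s' := fun u => (1 - 2 * u / t) / (2 * s u)) (κ := fun u => 1 - 2 * u / t) ht.le
    (by fun_prop) (fun u hu => by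
      have h1 : HasDerivAt (fun u : ℝ => u * (t - u) / t) (1 - 2 * u / t) u := by
        have := (((hasDerivAt_id u).mul ((hasDerivAt_id u).const_sub t)).div_const t)
        refine this.congr_deriv ?_
        simp only [id]
        field_simp; ring
      exact h1.sqrt (hq u hu).ne') (by
      apply ContinuousOn.div (by fun_prop) (by fun_prop)
      intro u hu
      have : 0 < s u := Real.sqrt_pos.2 (hq u hu)
      positivity) (by fun_prop) (fun u hu => by
      have : 0 < s u := Real.sqrt_pos.2 (hq u hu)
      field_simp)
  rw [intervalIntegral.integral_of_le ht.le, integral_Ioc_eq_integral_Ioo] at hf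
  have hend : gE φ (0 + t • b) (s t) t - gE φ (0 + (0:ℝ) • b) (s 0) 0 = φ (x, t) - φ (0, 0) := by
    have h1 : s t = 0 := by simp [hs]
    have h2 : s 0 = 0 := by simp [hs]
    have h3 : t • b = x := by rw [hb, smul_smul, mul_inv_cancel₀ ht.ne', one_smul]
    rw [h1, h2, gE_zero, gE_zero, h3, zero_smul, zero_add, zero_add]
  rw [← hend, ← hf, ← integral_const_mul]
  apply setIntegral_congr_fun measurableSet_Ioo
  intro u hu
  have hsu : 0 < s u := Real.sqrt_pos.2 (hq u hu)
  have hs2 : s u ^ 2 = u * (t - u) / t := Real.sq_sqrt (hq u hu).le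
  have hu0 := hu.1
  simp only
  rw [chg_var _ ((u / t) • x) hsu]
  have hmb : (0 : Spc n) + u • b = (u / t) • x := by
    rw [hb, smul_smul, zero_add]; rfl
  rw [hmb]
  set m := (u / t) • x with hm
  have hc : Continuous (fun ξ : Spc n => ((m + s u • ξ, u) : Pt n)) := by fun_prop
  have e : ∀ ξ, s u ^ n * (heatW (x - (m + s u • ξ), t - u) * (heatW (m + s u • ξ, u) * Th φ (m + s u • ξ, u) -
      2 * Ds φ (m + s u • ξ, u) (gradW (m + s u • ξ, u)))) =
      heatW (x, t) * (Dt φ (m + s u • ξ, u) * gam ξ + Ds φ (m + s u • ξ, u) b * gam ξ - Lx φ (m + s u • ξ, u) * gam ξ +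
        (s u / u) * (Ds φ (m + s u • ξ, u) ξ * gam ξ)) := by
    intro ξ
    rw [gradW_eq]
    have hD : Ds φ (m + s u • ξ, u) ((-(1 / (2 * u)) * heatW (m + s u • ξ, u)) • (m + s u • ξ)) =
        (-(1 / (2 * u)) * heatW (m + s u • ξ, u)) * (u * Ds φ (m + s u • ξ, u) b + s u * Ds φ (m + s u • ξ, u) ξ) := by
      have hmb' : m = u • b := by rw [← hmb, zero_add]
      unfold Ds
      set L := fderiv ℝ φ (m + s u • ξ, u)
      have : ((((-(1 / (2 * u)) * heatW (m + s u • ξ, u)) • (m + s u • ξ) : Spc n), (0:ℝ)) : Pt n) =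
          (-(1 / (2 * u)) * heatW (m + s u • ξ, u)) • (u • (b, 0) + s u • (ξ, 0)) := by
        conv_lhs => rw [show (m + s u • ξ : Spc n) = u • b + s u • ξ by rw [hmb']]
        simp [hmb']
        exact add_comm _ _
      rw [this, map_smul, map_add, map_smul, map_smul, smul_eq_mul, smul_eq_mul, smul_eq_mul]
    rw [hD]
    have hbr := bridge x ξ hu0 hu.2 hsu hs2
    rw [← hm] at hbr
    unfold Th
    calc _ = (s u ^ n * (heatW (x - (m + s u • ξ), t - u) * heatW (m + s u • ξ, u))) *
          (Dt φ (m + s u • ξ, u) + Ds φ (m + s u • ξ, u) b - Lx φ (m + s u • ξ, u) + s u / u * Ds φ (m + s u • ξ, u) ξ) := by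
          field_simp; ring
      _ = _ := by rw [hbr]; ring
  simp_rw [e]
  have i1 := gE_integrable h.dtc hBt m (s u) u
  have i2 := gE_integrable (h.dsc b) (fun p => hdsb p b) m (s u) u
  have i4 := gE_integrable h.lxc hBL m (s u) u
  have i3 : Integrable (fun ξ => s u / u * (Ds φ (m + s u • ξ, u) ξ * gam ξ)) := by
    apply Integrable.const_mul
    refine (gam_moment.const_mul B).mono' ?_ (Eventually.of_forall fun ξ => ?_)
    · apply AEStronglyMeasurable.mul _ (gam_measurable.aestronglyMeasurable)
      apply Continuous.aestronglyMeasurable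
      exact (h.fdc.comp hc).clm_apply (by fun_prop)
    · rw [norm_mul, Real.norm_eq_abs, Real.norm_eq_abs, abs_of_nonneg (gam_nonneg ξ), ← mul_assoc]
      exact mul_le_mul_of_nonneg_right (hdsb _ _) (gam_nonneg _)
  have i12 : Integrable (fun ξ => Dt φ (m + s u • ξ, u) * gam ξ + Ds φ (m + s u • ξ, u) b * gam ξ) := i1.add i2
  have i124 : Integrable (fun ξ => Dt φ (m + s u • ξ, u) * gam ξ + Ds φ (m + s u • ξ, u) b * gam ξ - Lx φ (m + s u • ξ, u) * gam ξ) := i12.sub i4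
  rw [integral_const_mul, integral_add i124 i3, integral_sub i12 i4, integral_add i1 i2, integral_const_mul, gauss_ibp h]
  have hsq : s u / u * (2 * s u) = 2 - 2 * u / t := by
    have : s u / u * (2 * s u) = 2 * s u ^ 2 / u := by ring
    rw [this, hs2]; field_simp
  have : s u / u * (2 * s u * ∫ ξ, Lx φ (m + s u • ξ, u) * gam ξ) = (2 - 2 * u / t) * ∫ ξ, Lx φ (m + s u • ξ, u) * gam ξ := by
    rw [← hsq]; ring
  rw [this]
  unfold gE
  ring
end

section
variable {n : ℕ} {φ : Pt n → ℝ}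

lemma Good.shift (h : Good φ) (z : Pt n) : Good (fun q => φ (q + z)) :=
  ⟨h.1.comp (contDiff_id.add contDiff_const), h.2.comp_homeomorph (Homeomorph.addRight z)⟩

lemma fderiv_sh (f : Pt n → ℝ) (z q : Pt n) : fderiv ℝ (fun q => f (q + z)) q = fderiv ℝ f (q + z) :=
  fderiv_comp_add_right z

lemma Dx_sh (f : Pt n → ℝ) (z : Pt n) (i : Fin n) : Dx (fun q => f (q + z)) i = fun q => Dx f i (q + z) := by
  funext q; unfold Dx; rw [fderiv_sh]

lemma Th_sh (f : Pt n → ℝ) (z q : Pt n) : Th (fun q => f (q + z)) q = Th f (q + z) := by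
  unfold Th Dt Lx
  simp_rw [Dx_sh]
  rw [fderiv_sh]

lemma Ds_sh (f : Pt n → ℝ) (z q : Pt n) (v : Spc n) : Ds (fun q => f (q + z)) q v = Ds f (q + z) v := by
  unfold Ds; rw [fderiv_sh]

/-- the Duhamel kernel -/
def Ak (φ : Pt n → ℝ) (y z : Pt n) : ℝ := heatW (y - z) * Th φ y - 2 * Ds φ y (gradW (y - z))

lemma duh3 (h : Good φ) (p z : Pt n) :
    ∫ u, ∫ y, heatW (p - (y, u)) * Ak φ (y, u) z = heatW (p - z) * (φ p - φ z) := by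
  rw [← integral_add_right_eq_self _ z.2]
  have e : ∀ u, ∫ y, heatW (p - (y, u + z.2)) * Ak φ (y, u + z.2) z =
      ∫ y, heatW ((p - z).1 - y, (p - z).2 - u) * (heatW (y, u) * Th (fun q => φ (q + z)) (y, u) -
        2 * Ds (fun q => φ (q + z)) (y, u) (gradW (y, u))) := by
    intro u
    rw [← integral_add_right_eq_self (μ := (volume : Measure (Spc n))) _ z.1]
    congr 1; funext y
    have e1 : p - (y + z.1, u + z.2) = ((p - z).1 - y, (p - z).2 - u) := by
      ext1
      · simp; abel
      · simp; ring
    have e2 : ((y + z.1, u + z.2) : Pt n) = (y, u) + z := rfl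
    rw [e1, e2]
    unfold Ak
    rw [add_sub_cancel_right, Th_sh, Ds_sh]
  simp_rw [e]
  have hz : ∀ u, u ∉ Ioo 0 (p - z).2 → ∫ y, heatW ((p - z).1 - y, (p - z).2 - u) * (heatW (y, u) * Th (fun q => φ (q + z)) (y, u) -
        2 * Ds (fun q => φ (q + z)) (y, u) (gradW (y, u))) = 0 := by
    intro u hu
    rw [← integral_zero (Spc n) ℝ]
    congr 1; funext y
    by_cases h1 : 0 < u
    · have : (p - z).2 ≤ u := by
        by_contra h2; exact hu ⟨h1, not_le.1 h2⟩
      rw [heatW_of_nonpos _ (by linarith), zero_mul]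
    · have : gradW (y, u) = 0 := by simp [gradW, h1]
      rw [this, heatW_of_nonpos _ (not_lt.1 h1)]
      unfold Ds
      rw [show ((0 : Spc n), (0:ℝ)) = (0 : Pt n) from rfl, map_zero]
      simp
  rw [← setIntegral_eq_integral_of_forall_compl_eq_zero hz]
  rcases lt_or_ge 0 (p - z).2 with ht | ht
  · rw [duh2 (h.shift z) _ ht]
    congr 2
    · congr 1; ext1 <;> simp
    · congr 1; ext1 <;> simp
  · rw [Ioo_eq_empty (not_lt.2 ht)]
    rw [show heatW (p - z) = 0 from heatW_of_nonpos (p - z).1 ht]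
    simp

lemma Good.thc (h : Good φ) : Continuous (Th φ) := h.dtc.sub h.lxc
lemma Good.ds2 (h : Good φ) : Continuous (fun q : Pt n × Spc n => Ds φ q.1 q.2) := by
  unfold Ds
  exact (h.fdc.comp continuous_fst).clm_apply (by fun_prop)

lemma Ds_zero_of {p : Pt n} (hp : p ∉ tsupport φ) (v : Spc n) : Ds φ p v = 0 := Dx_zero_of hp _

/-- the continuous linear form -/
def DsL (φ : Pt n → ℝ) (p : Pt n) : Spc n →L[ℝ] ℝ := (fderiv ℝ φ p).comp (ContinuousLinearMap.inl ℝ (Spc n) ℝ)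
lemma DsL_apply (φ : Pt n → ℝ) (p : Pt n) (v : Spc n) : DsL φ p v = Ds φ p v := rfl

lemma Ds_smul (φ : Pt n → ℝ) (p : Pt n) (a : ℝ) (v : Spc n) : Ds φ p (a • v) = a * Ds φ p v := by
  rw [← DsL_apply, map_smul]; rfl

lemma repr1 (μ : Measure (Pt n)) [IsFiniteMeasure μ] {σ : Pt n → ℝ} (hσ : Measurable σ)
    (h1 : ∀ z, |σ z| ≤ 1) (h : Good φ) :
    ∀ᵐ p, Integrable (fun y => heatW (p - y) * (cW μ σ y * Th φ y - 2 * Ds φ y (cG μ σ y))) ∧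
     φ p * cW μ σ p - cW μ (fun z => σ z * φ z) p =
      ∫ y, heatW (p - y) * (cW μ σ y * Th φ y - 2 * Ds φ y (cG μ σ y)) := by
  obtain ⟨B, hB0, hBφ, hB1, -, -, hBL, hBt⟩ := h.bound
  obtain ⟨M, hM⟩ : ∃ M, ∀ p ∈ tsupport φ, ‖p‖ ≤ M := h.2.isCompact.isBounded.exists_norm_le
  have hThm := h.thc.measurable
  have hDsm := h.ds2.measurable
  set a : Pt n → Pt n → ENNReal := fun y z => (tsupport φ).indicator (fun y => ENNReal.ofReal (2 * B) * (ENNReal.ofReal (heatW (y - z)) + ENNReal.ofReal ‖gradW (y - z)‖)) y with ha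
  have hAm : Measurable (fun q : Pt n × Pt n => Ak φ q.1 q.2) := by
    unfold Ak
    have : Measurable (fun q : Pt n × Pt n => Ds φ q.1 (gradW (q.1 - q.2))) :=
      hDsm.comp (measurable_fst.prodMk (gradW_measurable.comp (measurable_fst.sub measurable_snd)))
    fun_prop
  have hAa : ∀ y z, ENNReal.ofReal |Ak φ y z| ≤ a y z := by
    intro y z
    simp only [ha]
    by_cases hy : y ∈ tsupport φ
    · rw [indicator_of_mem hy, ← ENNReal.ofReal_add (heatW_nonneg _) (norm_nonneg _), ← ENNReal.ofReal_mul (by positivity)]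
      apply ENNReal.ofReal_le_ofReal
      unfold Ak
      have e1 : |Th φ y| ≤ 2 * B := by
        unfold Th; have := abs_sub (Dt φ y) (Lx φ y); linarith [hBt y, hBL y]
      have e2 : |Ds φ y (gradW (y - z))| ≤ B * ‖gradW (y - z)‖ := by
        unfold Ds
        refine ((fderiv ℝ φ y).le_opNorm _).trans ?_
        refine (mul_le_mul_of_nonneg_right (hB1 y) (norm_nonneg _)).trans_eq ?_
        simp [Prod.norm_def]
      have e3 := abs_sub (heatW (y - z) * Th φ y) (2 * Ds φ y (gradW (y - z)))
      rw [abs_mul, abs_mul, abs_of_nonneg (heatW_nonneg _), abs_two] at e3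
      have e4 := mul_le_mul_of_nonneg_left e1 (heatW_nonneg (y - z))
      linarith
    · rw [indicator_of_notMem hy]
      unfold Ak
      rw [Th_zero_of hy, Ds_zero_of hy]; simp
  have ham : Measurable (fun q : Pt n × Pt n => a q.1 q.2) := by
    simp only [ha]
    have := (isClosed_tsupport φ).measurableSet
    have e : (fun q : Pt n × Pt n => (tsupport φ).indicator (fun y => ENNReal.ofReal (2 * B) * (ENNReal.ofReal (heatW (y - q.2)) + ENNReal.ofReal ‖gradW (y - q.2)‖)) q.1) =
       (Prod.fst ⁻¹' tsupport φ).indicator (fun q : Pt n × Pt n => ENNReal.ofReal (2 * B) * (ENNReal.ofReal (heatW (q.1 - q.2)) + ENNReal.ofReal ‖gradW (q.1 - q.2)‖)) := by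
      funext q; by_cases hq : q.1 ∈ tsupport φ
      · rw [indicator_of_mem hq, indicator_of_mem (by exact hq)]
      · rw [indicator_of_notMem hq, indicator_of_notMem (by exact hq)]
    rw [e]
    exact Measurable.indicator (by fun_prop) (measurable_fst this)
  set H : Pt n → ENNReal := fun y => ∫⁻ z, a y z ∂μ with hH
  have hHm : Measurable H := Measurable.lintegral_prod_right' ham
  have hHfin : ∫⁻ y, H y < ⊤ := by
    have hsub : tsupport φ ⊆ strip (-|M| - 1) (|M| + 2) := by
      intro q hq
      refine ⟨trivial, ?_⟩
      have e1 := (norm_snd_le q).trans (hM q hq)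
      rw [Real.norm_eq_abs] at e1
      have := abs_le.1 (e1.trans (le_abs_self M))
      constructor
      · linarith
      · nlinarith [abs_nonneg M]
    have hr : 0 < |M| + 2 := by positivity
    have e : ∀ y, H y ≤ (strip (-|M| - 1) (|M| + 2)).indicator (fun y => ENNReal.ofReal (2 * B) * ((∫⁻ z, ENNReal.ofReal (heatW (y - z)) ∂μ) + ∫⁻ z, ENNReal.ofReal ‖gradW (y - z)‖ ∂μ)) y := by
      intro y
      by_cases hy : y ∈ tsupport φ
      · rw [indicator_of_mem (hsub hy)]
        simp only [hH, ha, indicator_of_mem hy]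
        rw [lintegral_const_mul _ (by fun_prop), lintegral_add_left (by fun_prop)]
      · simp only [hH, ha, indicator_of_notMem hy]; simp
    refine (lintegral_mono e).trans_lt ?_
    rw [lintegral_indicator (strip_measurable _ _), lintegral_const_mul' _ _ ENNReal.ofReal_ne_top]
    refine ENNReal.mul_lt_top ENNReal.ofReal_lt_top ?_
    rw [lintegral_add_left]
    · refine ENNReal.add_lt_top.2 ⟨(strip_W _ _ μ).trans_lt (ENNReal.mul_lt_top ENNReal.ofReal_lt_top (measure_lt_top _ _)),
        (strip_gradW _ _ hr μ).trans_lt (ENNReal.mul_lt_top (ENNReal.mul_lt_top ENNReal.ofReal_lt_top ENNReal.ofReal_lt_top) (measure_lt_top _ _))⟩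
    · exact Measurable.lintegral_prod_right' (f := fun q : Pt n × Pt n => ENNReal.ofReal (heatW (q.1 - q.2))) (by fun_prop)
  have hfm : IsFiniteMeasure (volume.withDensity H) := isFiniteMeasure_withDensity hHfin.ne
  have hWm : ∀ p : Pt n, Measurable (fun y => heatW (p - y)) := fun p => by fun_prop
  filter_upwards [ae_integrable_W (volume.withDensity H), ae_integrable_W μ] with p hp hpμ
  have h_integrable : Integrable (fun q : Pt n × Pt n => σ q.2 * (heatW (p - q.1) * Ak φ q.1 q.2)) (volume.prod μ) := by
    refine ⟨by fun_prop, ?_⟩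
    rw [hasFiniteIntegral_iff_norm]
    have e2 : ∫⁻ y, ENNReal.ofReal (heatW (p - y)) ∂(volume.withDensity H) < ⊤ := by
      have := hp.2
      rw [hasFiniteIntegral_iff_norm] at this
      refine lt_of_eq_of_lt (lintegral_congr fun y => ?_) this
      rw [Real.norm_eq_abs, abs_of_nonneg (heatW_nonneg _)]
    rw [lintegral_withDensity_eq_lintegral_mul _ hHm (by fun_prop)] at e2
    refine lt_of_le_of_lt ?_ e2
    rw [lintegral_prod _ (by fun_prop)]
    refine lintegral_mono fun y => ?_
    simp only [Pi.mul_apply]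
    rw [mul_comm, hH, ← lintegral_const_mul' _ _ ENNReal.ofReal_ne_top]
    refine lintegral_mono fun z => ?_
    rw [norm_mul, norm_mul]
    refine (ENNReal.ofReal_le_ofReal (mul_le_of_le_one_left (by positivity) (h1 z))).trans ?_
    rw [ENNReal.ofReal_mul (norm_nonneg _), Real.norm_eq_abs, abs_of_nonneg (heatW_nonneg _), Real.norm_eq_abs]
    exact mul_le_mul' le_rfl (hAa y z)
  have hL : ∀ᵐ y, ∫ z, σ z * (heatW (p - y) * Ak φ y z) ∂μ = heatW (p - y) * (cW μ σ y * Th φ y - 2 * Ds φ y (cG μ σ y)) := by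
    filter_upwards [ae_integrable_W μ, ae_integrable_G μ] with y hy hy2
    have i1 := Integrable.sig_mul hσ h1 hy
    have i2 : Integrable (fun z => σ z • gradW (y - z)) μ := hy2.bdd_smul 1 hσ.aestronglyMeasurable (Eventually.of_forall h1)
    have i3 : Integrable (fun z => Ds φ y (σ z • gradW (y - z))) μ := (DsL φ y).integrable_comp i2
    have e3 : ∫ z, Ds φ y (σ z • gradW (y - z)) ∂μ = Ds φ y (cG μ σ y) := (DsL φ y).integral_comp_comm i2
    calc ∫ z, σ z * (heatW (p - y) * Ak φ y z) ∂μ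
        = ∫ z, heatW (p - y) * ((σ z * heatW (y - z)) * Th φ y - 2 * Ds φ y (σ z • gradW (y - z))) ∂μ := by
          congr 1; funext z; rw [Ds_smul]; unfold Ak; ring
      _ = _ := by
          rw [integral_const_mul, integral_sub (i1.mul_const _) (i3.const_mul 2), integral_mul_const, integral_const_mul, e3]
          rfl
  have hR : ∀ᵐ z ∂μ, ∫ y, σ z * (heatW (p - y) * Ak φ y z) = σ z * (heatW (p - z) * (φ p - φ z)) := by
    filter_upwards [h_integrable.swap.prod_right_ae] with z hz
    by_cases hs : σ z = 0
    · simp [hs]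
    · have hz' : Integrable (fun y => heatW (p - y) * Ak φ y z) := by
        have := hz.const_mul (σ z)⁻¹
        refine this.congr (Eventually.of_forall fun y => ?_)
        simp only [Function.comp, Prod.swap]
        rw [← mul_assoc, inv_mul_cancel₀ hs, one_mul]
      rw [integral_const_mul, ← duh3 h p z]
      congr 1
      exact integral_prod_symm (μ := (volume : Measure (Spc n))) (ν := (volume : Measure ℝ)) _ hz'
  constructor
  · exact h_integrable.integral_prod_left.congr hL
  · rw [← integral_congr_ae hL, integral_integral_swap h_integrable, integral_congr_ae hR]
    unfold cW
    have j1 : Integrable (fun z => φ p * (σ z * heatW (p - z))) μ := (Integrable.sig_mul hσ h1 hpμ).const_mul _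
    have j2 : Integrable (fun z => σ z * φ z * heatW (p - z)) μ := by
      refine Integrable.sig_mul (B := B) (hσ.mul h.1.continuous.measurable) (fun z => ?_) hpμ
      show |σ z * φ z| ≤ B
      rw [abs_mul]
      calc _ ≤ 1 * B := mul_le_mul (h1 z) (hBφ z) (abs_nonneg _) zero_le_one
        _ = B := one_mul _
    rw [← integral_const_mul, ← integral_sub j1 j2]
    congr 1; funext z; ring

lemma repr2 (μ : Measure (Pt n)) [IsFiniteMeasure μ] {σ : Pt n → ℝ} (hσ : Measurable σ)
    (h1 : ∀ z, |σ z| ≤ 1) (h : Good φ) (c : ℝ) :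
    ∀ᵐ p, cW μ (fun z => σ z * φ z) p = φ p * (cW μ σ p - c) -
      ∫ y, heatW (p - y) * ((cW μ σ y - c) * Th φ y - 2 * Ds φ y (cG μ σ y)) := by
  obtain ⟨B, hB0, hBφ, hB1, -, -, hBL, hBt⟩ := h.bound
  have hfin : IsFiniteMeasure (volume.restrict (tsupport φ)) :=
    ⟨by rw [Measure.restrict_apply_univ]; exact h.2.isCompact.measure_lt_top⟩
  filter_upwards [repr1 μ hσ h1 h, ae_integrable_W (volume.restrict (tsupport φ))] with p hp hW
  have i1 : Integrable (fun y => heatW (p - y) * Th φ y) := by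
    have : IntegrableOn (fun y => heatW (p - y) * Th φ y) (tsupport φ) := by
      refine hW.mul_bdd (c := 2 * B) h.thc.aestronglyMeasurable (Eventually.of_forall fun y => ?_)
      rw [Real.norm_eq_abs]
      unfold Th; have := abs_sub (Dt φ y) (Lx φ y); linarith [hBt y, hBL y]
    refine (integrableOn_iff_integrable_of_support_subset ?_).1 this
    intro y hy
    by_contra h2
    exact hy (by simp [Th_zero_of h2])
  have e1 : ∫ y, heatW (p - y) * Th φ y = φ p := by
    rw [← duh1 h p.1 p.2]
    exact integral_prod_symm (μ := (volume : Measure (Spc n))) (ν := (volume : Measure ℝ)) _ i1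
  have e2 : ∀ y, heatW (p - y) * ((cW μ σ y - c) * Th φ y - 2 * Ds φ y (cG μ σ y)) =
     heatW (p - y) * (cW μ σ y * Th φ y - 2 * Ds φ y (cG μ σ y)) - c * (heatW (p - y) * Th φ y) := fun y => by ring
  simp_rw [e2]
  rw [integral_sub hp.1 (i1.const_mul c), integral_const_mul, e1, ← hp.2]
  ring
end

section
variable {n : ℕ} {G : Pt n → ℝ} {C : ℝ}

/-- parabolic Lipschitz -/
def PLip (G : Pt n → ℝ) (C : ℝ) : Prop := ∀ p q : Pt n, |G p - G q| ≤ ‖p.1 - q.1‖ + C * √|p.2 - q.2|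

lemma PLip.cont (h : PLip G C) : Continuous G := by
  rw [continuous_iff_continuousAt]
  intro q
  rw [ContinuousAt, tendsto_iff_norm_sub_tendsto_zero]
  have hc : Continuous (fun p : Pt n => ‖p.1 - q.1‖ + C * √|p.2 - q.2|) := by fun_prop
  have h0 : Tendsto (fun p : Pt n => ‖p.1 - q.1‖ + C * √|p.2 - q.2|) (𝓝 q) (𝓝 0) := by
    have := hc.tendsto q
    simpa using this
  exact squeeze_zero (fun _ => norm_nonneg _) (fun p => h p q) h0

/-- difference kernel -/
def kd (G : Pt n → ℝ) (p : Pt n) (ρ : ℝ) : ℝ := (G (p.1, p.2 + ρ) - G p) / |ρ| ^ (3 / 2 : ℝ)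
/-- near part -/
def Tr (r : ℝ) (G : Pt n → ℝ) (p : Pt n) : ℝ := ∫ ρ in Ioo (-r) r, kd G p ρ

lemma kd_meas (hG : Measurable G) : Measurable (fun q : Pt n × ℝ => kd G q.1 q.2) := by
  unfold kd; fun_prop

lemma halfT_kd (G : Pt n → ℝ) (p : Pt n) : halfT G p = ∫ ρ, kd G p ρ := by
  rw [halfT_eq_E1]; rfl

lemma absHalf_kd (G : Pt n → ℝ) (p : Pt n) : absHalf G p = ∫⁻ ρ, ENNReal.ofReal ‖kd G p ρ‖ := by
  unfold absHalf kd
  refine lintegral_congr fun ρ => ?_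
  rw [norm_div, Real.norm_eq_abs, Real.norm_eq_abs, abs_of_nonneg (by positivity : 0 ≤ |ρ| ^ (3 / 2 : ℝ))]

lemma PLip.osc (h : PLip G C) (hC : 0 ≤ C) (Q : PCube n) {p q : Pt n} (hp : p ∈ Q.toSet) (hq : q ∈ Q.toSet) (ρ : ℝ) :
    |G (p.1, p.2 + ρ) - G (q.1, q.2 + ρ)| ≤ (√n + C) * Q.len := by
  refine (h _ _).trans ?_
  have hl := Q.len_pos
  have e1 : ‖p.1 - q.1‖ ≤ √n * Q.len := sbox_dist hl.le fun i => by
    rw [abs_le]; constructor <;> linarith [(hp.1 i).1, (hp.1 i).2, (hq.1 i).1, (hq.1 i).2]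
  have e2 : √|p.2 + ρ - (q.2 + ρ)| ≤ Q.len := by
    apply Real.sqrt_le_iff.2 ⟨hl.le, ?_⟩
    rw [abs_le]; constructor <;> linarith [hp.2.1, hp.2.2, hq.2.1, hq.2.2]
  have := mul_le_mul_of_nonneg_left e2 hC
  simp only
  linarith

lemma PLip.shiftQ (h : PLip G C) (hC : 0 ≤ C) (Q : PCube n) (ρ : ℝ) :
    |∫ p in Q.toSet, (G (p.1, p.2 + ρ) - G p)| ≤ Q.len ^ n * (|ρ| * (C * Q.len)) := by
  have hl := Q.len_pos
  have hc := h.cont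
  have h_integrable : IntegrableOn (fun p : Pt n => G (p.1, p.2 + ρ) - G p) Q.toSet := by
    refine Integrable.of_bound (C := C * √|ρ|) (by fun_prop) (Eventually.of_forall fun p => ?_)
    have := h (p.1, p.2 + ρ) p
    simpa using this
  rw [PCube.toSet_eq] at h_integrable ⊢
  have e : ∫ p in sbox Q.corner Q.len ×ˢ Icc Q.time (Q.time + Q.len ^ 2), (G (p.1, p.2 + ρ) - G p) =
      ∫ x in sbox Q.corner Q.len, ∫ t in Icc Q.time (Q.time + Q.len ^ 2), (G (x, t + ρ) - G (x, t)) :=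
    setIntegral_prod (μ := (volume : Measure (Spc n))) (ν := (volume : Measure ℝ)) _ h_integrable
  rw [e, ← Real.norm_eq_abs]
  have hv : volume (sbox Q.corner Q.len) < ⊤ := by rw [sbox_volume]; exact ENNReal.pow_lt_top ENNReal.ofReal_lt_top
  have key : ∀ x ∈ sbox Q.corner Q.len, ‖∫ t in Icc Q.time (Q.time + Q.len ^ 2), (G (x, t + ρ) - G (x, t))‖ ≤ |ρ| * (C * Q.len) := by
    intro x _
    set a := Q.time
    set b := Q.time + Q.len ^ 2 with hb
    have hab : a ≤ b := by simp only [hb]; nlinarith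
    have hg : Continuous (fun t => G (x, t)) := by fun_prop
    have hii : ∀ u v : ℝ, IntervalIntegrable (fun t => G (x, t)) volume u v := fun u v => hg.intervalIntegrable _ _
    have hii2 : ∀ d u v : ℝ, IntervalIntegrable (fun t => G (x, t + d)) volume u v := fun d u v =>
      Continuous.intervalIntegrable (by fun_prop) _ _
    rw [integral_Icc_eq_integral_Ioc, ← intervalIntegral.integral_of_le hab, intervalIntegral.integral_sub (hii2 ρ a b) (hii a b),
      intervalIntegral.integral_comp_add_right (fun t => G (x, t))]
    have e2 : (∫ t in a + ρ..b + ρ, G (x, t)) - ∫ t in a..b, G (x, t) =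
        ∫ t in a..a + ρ, (G (x, t + Q.len ^ 2) - G (x, t)) := by
      rw [intervalIntegral.integral_sub (hii2 _ _ _) (hii _ _), intervalIntegral.integral_comp_add_right (fun t => G (x, t))]
      have j1 := intervalIntegral.integral_add_adjacent_intervals (hii a b) (hii b (b + ρ))
      have j2 := intervalIntegral.integral_add_adjacent_intervals (hii a (a + ρ)) (hii (a + ρ) (b + ρ))
      have j3 : a + ρ + Q.len ^ 2 = b + ρ := by simp only [hb]; ring
      rw [j3]
      linarith
    rw [e2]
    have := intervalIntegral.norm_integral_le_of_norm_le_const (a := a) (b := a + ρ) (f := fun t => G (x, t + Q.len ^ 2) - G (x, t)) (C := C * Q.len)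
      (fun t _ => by
        have := h (x, t + Q.len ^ 2) (x, t)
        simp only [sub_self, norm_zero, zero_add, add_sub_cancel_left] at this
        rwa [abs_of_nonneg (by positivity : 0 ≤ Q.len ^ 2), Real.sqrt_sq hl.le] at this)
    rw [add_sub_cancel_left] at this
    linarith
  have := norm_setIntegral_le_of_norm_le_const hv key
  refine this.trans_eq ?_
  rw [Measure.real, sbox_volume, ENNReal.toReal_pow, ENNReal.toReal_ofReal hl.le]
  ring

lemma PLip.Tr_bound (h : PLip G C) (hC : 0 ≤ C) (Q : PCube n) (hfin : ∫⁻ p in Q.toSet, absHalf G p ≠ ⊤)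
    (hB : ParabBMOLe (halfT G) 1) :
    IntegrableOn (Tr (Q.len ^ 2) G) Q.toSet ∧
    ∫ p in Q.toSet, |Tr (Q.len ^ 2) G p| ≤ (2 * (1 + 16 * (√n + C)) + 8 * C) * Q.len ^ (n + 2) := by
  have hl := Q.len_pos
  have hc := h.cont
  set r := Q.len ^ 2 with hr
  have hr0 : 0 < r := by positivity
  have hsr : √r = Q.len := Real.sqrt_sq hl.le
  set P := volume.restrict Q.toSet with hP
  have hI : Integrable (fun q : Pt n × ℝ => kd G q.1 q.2) (P.prod volume) := by
    refine ⟨(kd_meas hc.measurable).aestronglyMeasurable, ?_⟩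
    rw [hasFiniteIntegral_iff_norm, lintegral_prod _ (by have := kd_meas hc.measurable; fun_prop)]
    simp_rw [← absHalf_kd]
    exact lt_top_iff_ne_top.2 hfin
  have hI1 : Integrable (fun q : Pt n × ℝ => kd G q.1 q.2) (P.prod (volume.restrict (Ioo (-r) r))) :=
    hI.mono_measure (Measure.prod_mono le_rfl Measure.restrict_le_self)
  have hDi : Integrable (halfT G) P := by
    have := hI.integral_prod_left
    exact this.congr (Eventually.of_forall fun p => (halfT_kd G p).symm)
  have hTi : Integrable (Tr r G) P := hI1.integral_prod_left
  refine ⟨hTi, ?_⟩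
  -- mean
  have hmean : |∫ p, Tr r G p ∂P| ≤ 8 * C * Q.len ^ (n + 2) := by
    unfold Tr
    rw [integral_integral_swap hI1, ← Real.norm_eq_abs]
    have hb : ∀ᵐ ρ ∂(volume.restrict (Ioo (-r) r)), ‖∫ p, kd G p ρ ∂P‖ ≤ (Q.len ^ n * (C * Q.len) * r) * mker r ρ := by
      filter_upwards [ae_restrict_mem measurableSet_Ioo] with ρ hρ
      unfold kd
      rw [integral_div, Real.norm_eq_abs]
      have h1 := h.shiftQ hC Q ρ
      have hρr : |ρ| ≤ r := (abs_lt.2 hρ).le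
      apply div_ker_le
      · refine h1.trans ?_
        calc Q.len ^ n * (|ρ| * (C * Q.len)) = (Q.len ^ n * (C * Q.len)) * |ρ| := by ring
          _ ≤ _ := mul_le_mul_of_nonneg_left hρr (by positivity)
      · refine h1.trans (le_of_eq ?_)
        field_simp
    refine (norm_integral_le_of_norm_le ((mker_integrable hr0).const_mul _).integrableOn hb).trans ?_
    refine (setIntegral_le_integral ((mker_integrable hr0).const_mul _) (Eventually.of_forall fun ρ => by
      have := mker_nonneg hr0 ρ
      simp only [Pi.zero_apply]; positivity)).trans ?_
    rw [integral_const_mul, mker_integral hr0, hsr, hr]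
    apply le_of_eq
    field_simp
    ring
  -- oscillation
  have hgood : ∀ᵐ p ∂P, Integrable (kd G p) volume := hI.prod_right_ae
  have hmem : ∀ᵐ p ∂P, p ∈ Q.toSet := ae_restrict_mem Q.measurable
  set fA : Pt n → ℝ := fun p => ∫ ρ in (Ioo (-r) r)ᶜ, kd G p ρ with hfA
  have hsplit : ∀ p, Integrable (kd G p) volume → halfT G p = Tr r G p + fA p := by
    intro p hp
    rw [halfT_kd]
    exact (integral_add_compl measurableSet_Ioo hp).symm
  have hosc : ∀ p q, p ∈ Q.toSet → q ∈ Q.toSet → Integrable (kd G p) volume → Integrable (kd G q) volume →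
      |fA p - fA q| ≤ 16 * (√n + C) := by
    intro p q hp hq ip iq
    simp only [hfA]
    rw [← integral_sub ip.integrableOn iq.integrableOn, ← Real.norm_eq_abs]
    have hb : ∀ᵐ ρ ∂(volume.restrict (Ioo (-r) r)ᶜ), ‖kd G p ρ - kd G q ρ‖ ≤ (2 * ((√n + C) * Q.len)) * mker r ρ := by
      filter_upwards [ae_restrict_mem measurableSet_Ioo.compl] with ρ hρ
      have hρr : r ≤ |ρ| := by
        by_contra hh; exact hρ (abs_lt.1 (not_le.1 hh))
      unfold kd
      rw [← sub_div, Real.norm_eq_abs]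
      have e0 : |G (p.1, p.2 + ρ) - G p - (G (q.1, q.2 + ρ) - G q)| ≤ 2 * ((√n + C) * Q.len) := by
        have e1 := abs_le.1 (h.osc hC Q hp hq ρ)
        have e2 := abs_le.1 (h.osc hC Q hp hq 0)
        simp only [add_zero] at e2
        rw [abs_le]; constructor <;> linarith [e1.1, e1.2, e2.1, e2.2]
      apply div_ker_le e0
      refine e0.trans (le_mul_of_one_le_right (by positivity) ?_)
      rwa [one_le_div hr0]
    refine (norm_integral_le_of_norm_le ((mker_integrable hr0).const_mul _).integrableOn hb).trans ?_
    refine (setIntegral_le_integral ((mker_integrable hr0).const_mul _) (Eventually.of_forall fun ρ => by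
      have := mker_nonneg hr0 ρ
      simp only [Pi.zero_apply]; positivity)).trans ?_
    rw [integral_const_mul, mker_integral hr0, hsr]
    apply le_of_eq
    field_simp
    ring
  have hPne : P ≠ 0 := by
    intro h0
    have : P univ = 0 := by rw [h0]; rfl
    rw [hP, Measure.restrict_apply_univ] at this
    exact Q.volume_ne_zero this
  have : (ae P).NeBot := ae_neBot.2 hPne
  obtain ⟨q, hq1, hq2⟩ := (hgood.and hmem).exists
  set d := ⨍ p in Q.toSet, halfT G p with hd
  set w := d - fA q with hw
  have hpt : ∀ᵐ p ∂P, |Tr r G p - w| ≤ |halfT G p - d| + 16 * (√n + C) := by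
    filter_upwards [hgood, hmem] with p hp1 hp2
    have e1 := hsplit p hp1
    have e2 := hosc p q hp2 hq2 hp1 hq1
    have : Tr r G p - w = (halfT G p - d) - (fA p - fA q) := by rw [hw]; linarith
    rw [this]
    exact (abs_sub _ _).trans (by linarith)
  have hvol : P.real univ = Q.len ^ (n + 2) := by
    rw [measureReal_restrict_apply_univ, PCube.volume_real]
  have hDd : ∫ p, |halfT G p - d| ∂P ≤ Q.len ^ (n + 2) := by
    have := hB Q
    rw [PCube.average_eq] at this
    rw [inv_mul_le_iff₀ (by positivity), mul_one] at this
    exact this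
  have iT : Integrable (fun p => Tr r G p - w) P := hTi.sub (integrable_const w)
  have iD : Integrable (fun p => |halfT G p - d|) P := (hDi.sub (integrable_const d)).abs
  have h1 : ∫ p, |Tr r G p - w| ∂P ≤ (1 + 16 * (√n + C)) * Q.len ^ (n + 2) := by
    refine (integral_mono_ae iT.abs (iD.add (integrable_const _)) hpt).trans ?_
    simp only [Pi.add_apply]
    rw [integral_add iD (integrable_const _), integral_const, hvol, smul_eq_mul]
    linarith
  have h2 : |w| * Q.len ^ (n + 2) ≤ 8 * C * Q.len ^ (n + 2) + (1 + 16 * (√n + C)) * Q.len ^ (n + 2) := by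
    have e1 : ∫ p, (Tr r G p - w) ∂P = (∫ p, Tr r G p ∂P) - Q.len ^ (n + 2) * w := by
      rw [integral_sub hTi (integrable_const _), integral_const, hvol, smul_eq_mul]
    have e2 : |∫ p, (Tr r G p - w) ∂P| ≤ ∫ p, |Tr r G p - w| ∂P := abs_integral_le_integral_abs
    have e3 : w * Q.len ^ (n + 2) = (∫ p, Tr r G p ∂P) - ∫ p, (Tr r G p - w) ∂P := by rw [e1]; ring
    have e4 : |w| * Q.len ^ (n + 2) = |w * Q.len ^ (n + 2)| := by
      rw [abs_mul, abs_of_pos (by positivity : 0 < Q.len ^ (n + 2))]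
    rw [e4, e3]
    exact (abs_sub _ _).trans (by linarith)
  calc ∫ p, |Tr r G p| ∂P ≤ ∫ p, (|Tr r G p - w| + |w|) ∂P := by
        refine integral_mono hTi.abs (iT.abs.add (integrable_const _)) fun p => ?_
        have := abs_add_le (Tr r G p - w) w
        simpa using this
    _ = ∫ p, |Tr r G p - w| ∂P + Q.len ^ (n + 2) * |w| := by
        rw [integral_add iT.abs (integrable_const _), integral_const, hvol, smul_eq_mul]
    _ ≤ _ := by linarith
end

section
variable {n : ℕ} {φ : Pt n → ℝ} {Q : PCube n}

lemma Adm.good (h : Admissible φ Q) : Good φ := by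
  refine ⟨h.1, ?_⟩
  have hb : Bornology.IsBounded Q.toSet := by
    rw [Metric.isBounded_iff_subset_closedBall ((WithLp.toLp 2 Q.corner : Spc n), Q.time)]
    refine ⟨√n * Q.len + Q.len ^ 2, fun p hp => ?_⟩
    have hl := Q.len_pos
    rw [Metric.mem_closedBall, dist_eq_norm, Prod.norm_def]
    have h0 : 0 ≤ √n * Q.len := by positivity
    apply max_le
    · have e1 : ‖p.1 - (WithLp.toLp 2 Q.corner : Spc n)‖ ≤ √n * Q.len := sbox_dist hl.le fun i => by
        have := hp.1 i
        simp only
        rw [abs_le]; constructor <;> linarith [this.1, this.2]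
      have : 0 ≤ Q.len ^ 2 := by positivity
      simp only [Prod.fst_sub]; linarith
    · simp only [Prod.snd_sub, Real.norm_eq_abs]
      rw [abs_le]; constructor <;> linarith [hp.2.1, hp.2.2]
  exact Metric.isCompact_of_isClosed_isBounded (isClosed_tsupport φ) (hb.subset h.2.1)

lemma Dx_lineDeriv {f : Pt n → ℝ} (hf : Differentiable ℝ f) (p : Pt n) (i : Fin n) (h : ℝ) :
    HasDerivAt (fun h' : ℝ => f (p.1 + h' • (EuclideanSpace.single i 1 : Spc n), p.2)) (Dx f i (p.1 + h • bv i, p.2)) h := by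
  have h1 : HasDerivAt (fun h' : ℝ => ((p.1 + h' • (bv i : Spc n), p.2) : Pt n)) (bv i, 0) h := by
    refine HasDerivAt.prodMk ?_ (hasDerivAt_const _ _)
    have := ((hasDerivAt_id h).smul_const (bv i : Spc n)).const_add p.1
    simpa using this
  exact ((hf _).hasFDerivAt.comp_hasDerivAt h h1)

lemma lapx_eq (h : Good φ) (p : Pt n) : lapx φ p = Lx φ p := by
  unfold lapx Lx
  refine Finset.sum_congr rfl fun i _ => ?_
  unfold dir2
  have e : (fun h => deriv (fun h' : ℝ => φ (p.1 + h' • (EuclideanSpace.single i 1 : Spc n), p.2)) h) =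
      fun h => Dx φ i (p.1 + h • (EuclideanSpace.single i 1 : Spc n), p.2) := by
    funext θ; exact (Dx_lineDeriv h.diff p i θ).deriv
  rw [e, (Dx_lineDeriv ((h.dx1 i).differentiable (by norm_num)) p i 0).deriv]
  simp

lemma Dt_hasDeriv (h : Good φ) (x : Spc n) (t : ℝ) : HasDerivAt (fun s => φ (x, s)) (Dt φ (x, t)) t := by
  have h1 : HasDerivAt (fun s : ℝ => ((x, s) : Pt n)) (0, 1) t := (hasDerivAt_const _ _).prodMk (hasDerivAt_id t)
  exact (h.diff _).hasFDerivAt.comp_hasDerivAt t h1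

lemma Adm.dt (h : Admissible φ Q) (p : Pt n) : |Dt φ p| ≤ 1 / Q.len ^ 2 := by
  have := h.2.2.2 p
  rw [(Dt_hasDeriv (Adm.good h) p.1 p.2).deriv] at this
  exact (le_add_of_nonneg_left (abs_nonneg _)).trans this

lemma Adm.th (h : Admissible φ Q) (p : Pt n) : |Th φ p| ≤ 1 / Q.len ^ 2 := by
  have := h.2.2.2 p
  rw [(Dt_hasDeriv (Adm.good h) p.1 p.2).deriv, lapx_eq (Adm.good h)] at this
  unfold Th
  refine (abs_sub _ _).trans ?_
  rw [add_comm]; exact this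

lemma Adm.ds (h : Admissible φ Q) (p : Pt n) (v : Spc n) : |Ds φ p v| ≤ 1 / Q.len * ‖v‖ := by
  have h2 : HasFDerivAt (fun y : Spc n => φ (y, p.2)) (DsL φ p) p.1 := by
    have h1 : HasFDerivAt (fun y : Spc n => ((y, p.2) : Pt n)) (ContinuousLinearMap.inl ℝ (Spc n) ℝ) p.1 :=
      hasFDerivAt_prodMk_left p.1 p.2
    exact ((Adm.good h).diff (p.1, p.2)).hasFDerivAt.comp p.1 h1
  have h3 := h.2.2.1 p
  rw [h2.fderiv] at h3
  exact ((DsL φ p).le_opNorm v).trans (mul_le_mul_of_nonneg_right h3 (norm_nonneg _))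

lemma Adm.tlip (h : Admissible φ Q) (x : Spc n) (s t : ℝ) : |φ (x, s) - φ (x, t)| ≤ |s - t| / Q.len ^ 2 := by
  have := Convex.norm_image_sub_le_of_norm_hasDerivWithin_le (f := fun s => φ (x, s)) (s := univ) (C := 1 / Q.len ^ 2)
    (fun u _ => (Dt_hasDeriv (Adm.good h) x u).hasDerivWithinAt) (fun u _ => Adm.dt h _) convex_univ (mem_univ t) (mem_univ s)
  rw [Real.norm_eq_abs, Real.norm_eq_abs] at this
  refine this.trans_eq ?_
  ring

lemma Adm.zero (h : Admissible φ Q) {p : Pt n} (hp : p ∉ Q.toSet) : φ p = 0 :=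
  image_eq_zero_of_notMem_tsupport fun hh => hp (h.2.1 hh)

lemma Adm.bound (h : Admissible φ Q) (p : Pt n) : |φ p| ≤ 2 := by
  have hl := Q.len_pos
  have hl2 : 0 < Q.len ^ 2 := by positivity
  by_cases hp : p ∈ Q.toSet
  · have e1 : φ (p.1, p.2 + 2 * Q.len ^ 2) = 0 := Adm.zero h fun hh => by
      have h1 := hh.2.2
      have h2 := hp.2.1
      simp only at h1
      linarith
    have e2 := Adm.tlip h p.1 p.2 (p.2 + 2 * Q.len ^ 2)
    rw [e1, sub_zero] at e2
    refine e2.trans_eq ?_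
    rw [sub_add_cancel_left, abs_neg, abs_of_pos (by positivity)]
    field_simp
  · rw [Adm.zero h hp]; simp

end

section
variable {n : ℕ} {φ : Pt n → ℝ} {Q : PCube n} {G : Pt n → ℝ} {C : ℝ}

/-- base point -/
def PCube.base (Q : PCube n) : Pt n := ((WithLp.toLp 2 Q.corner : Spc n), Q.time)

lemma PCube.base_mem (Q : PCube n) : Q.base ∈ Q.toSet := by
  have hl := Q.len_pos
  have h2 : 0 ≤ Q.len ^ 2 := by positivity
  refine ⟨fun i => ?_, ?_⟩
  · simp only [PCube.base]; constructor <;> linarith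
  · simp only [PCube.base]; constructor <;> linarith

/-- localized function -/
def Sf (φ G : Pt n → ℝ) (Q : PCube n) (p : Pt n) : ℝ := φ p * (G p - G Q.base)

/-- enlarged set -/
def PCube.Jset (Q : PCube n) : Set (Pt n) :=
  sbox Q.corner Q.len ×ˢ Icc (Q.time - Q.len ^ 2) (Q.time + 2 * Q.len ^ 2)

lemma Jset_meas (Q : PCube n) : MeasurableSet Q.Jset := (sbox_measurable _ _).prod measurableSet_Icc

lemma Jset_vol (Q : PCube n) : volume Q.Jset = ENNReal.ofReal (3 * Q.len ^ (n + 2)) := by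
  have hl := Q.len_pos
  unfold PCube.Jset
  rw [Measure.volume_eq_prod, Measure.prod_prod, sbox_volume, Real.volume_Icc, ← ENNReal.ofReal_pow hl.le,
    ← ENNReal.ofReal_mul (by positivity)]
  congr 1; ring

lemma Sf_bound (h : PLip G C) (hC : 0 ≤ C) (hA : Admissible φ Q) (p : Pt n) :
    |Sf φ G Q p| ≤ Q.toSet.indicator (fun _ => 2 * ((√n + C) * Q.len)) p := by
  unfold Sf
  by_cases hp : p ∈ Q.toSet
  · rw [indicator_of_mem hp, abs_mul]
    have := h.osc hC Q hp Q.base_mem 0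
    simp only [add_zero] at this
    exact mul_le_mul (Adm.bound hA p) this (abs_nonneg _) (by norm_num)
  · rw [indicator_of_notMem hp, Adm.zero hA hp]; simp

lemma Sf_bound' (h : PLip G C) (hC : 0 ≤ C) (hA : Admissible φ Q) (p : Pt n) :
    |Sf φ G Q p| ≤ 2 * ((√n + C) * Q.len) := by
  have hl := Q.len_pos
  refine (Sf_bound h hC hA p).trans (indicator_le_self' (fun _ _ => by positivity) _)

lemma Sf_pt (h : PLip G C) (hC : 0 ≤ C) (hA : Admissible φ Q) (p : Pt n) (hp : Integrable (kd G p)) :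
    ENNReal.ofReal |halfT (Sf φ G Q) p| ≤
      (∫⁻ ρ, (ENNReal.ofReal |Sf φ G Q (p.1, p.2 + ρ)| + ENNReal.ofReal |Sf φ G Q p|) * ENNReal.ofReal (mker (Q.len ^ 2) ρ))
      + Q.Jset.indicator (fun _ => ENNReal.ofReal (8 * (√n + 2 * C))) p
      + Q.toSet.indicator (fun p => 2 * ENNReal.ofReal |Tr (Q.len ^ 2) G p|) p := by
  have hl := Q.len_pos
  set S := Sf φ G Q with hS
  set r := Q.len ^ 2 with hr
  have hr0 : 0 < r := by positivity
  have hsr : √r = Q.len := Real.sqrt_sq hl.le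
  have hc := h.cont
  have hφc : Continuous φ := hA.1.continuous
  have hSm : Measurable S := by
    have : Continuous S := by rw [hS]; unfold Sf; fun_prop
    exact this.measurable
  have hkS : Measurable (kd S p) := (kd_meas hSm).comp (measurable_const.prodMk measurable_id)
  have hM := mker_integrable hr0
  -- near kernel
  set N : ℝ → ℝ := fun ρ => ((φ (p.1, p.2 + ρ) - φ p) * (G (p.1, p.2 + ρ) - G Q.base)) / |ρ| ^ (3 / 2 : ℝ) with hN
  have hNm : Measurable N := by
    have := hc.measurable
    have := hφc.measurable
    rw [hN]; fun_prop
  have hdec : ∀ ρ, kd S p ρ = N ρ + φ p * kd G p ρ := by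
    intro ρ
    simp only [hN, hS, kd, Sf]; ring
  have hNb : ∀ ρ ∈ Ioo (-r) r, |N ρ| ≤ Q.Jset.indicator (fun _ => (√n + 2 * C) * Q.len) p * mker r ρ := by
    intro ρ hρ
    have hρr : |ρ| < r := abs_lt.2 hρ
    by_cases hJ : p ∈ Q.Jset
    · rw [indicator_of_mem hJ]
      have e1 : |G (p.1, p.2 + ρ) - G Q.base| ≤ (√n + 2 * C) * Q.len := by
        refine (h _ _).trans ?_
        have e1 : ‖p.1 - Q.base.1‖ ≤ √n * Q.len := sbox_dist hl.le fun i => by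
          have := hJ.1 i
          simp only [PCube.base]
          rw [abs_le]; constructor <;> linarith [this.1, this.2]
        have e2 : √|p.2 + ρ - Q.base.2| ≤ 2 * Q.len := by
          apply Real.sqrt_le_iff.2 ⟨by positivity, ?_⟩
          have := hJ.2
          simp only [PCube.base]
          rw [show (2 * Q.len) ^ 2 = 4 * r by rw [hr]; ring]
          rw [abs_le]; constructor <;> linarith [this.1, this.2, hρ.1, hρ.2]
        have := mul_le_mul_of_nonneg_left e2 hC
        simp only
        linarith
      have e2 : |φ (p.1, p.2 + ρ) - φ p| ≤ |ρ| / r := by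
        have := Adm.tlip hA p.1 (p.2 + ρ) p.2
        rwa [add_sub_cancel_left] at this
      have e3 : |(φ (p.1, p.2 + ρ) - φ p) * (G (p.1, p.2 + ρ) - G Q.base)| ≤ (√n + 2 * C) * Q.len * (|ρ| / r) := by
        rw [abs_mul, mul_comm]
        exact mul_le_mul e1 e2 (abs_nonneg _) (by positivity)
      refine div_ker_le (e3.trans ?_) e3
      refine mul_le_of_le_one_right (by positivity) ?_
      rw [div_le_one hr0]; exact hρr.le
    · rw [indicator_of_notMem hJ, zero_mul]
      have z1 : φ p = 0 := Adm.zero hA fun hh => hJ ⟨hh.1, by constructor <;> linarith [hh.2.1, hh.2.2]⟩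
      have z2 : φ (p.1, p.2 + ρ) = 0 := Adm.zero hA fun hh => hJ ⟨hh.1, by
        have h1 := hh.2.1
        have h2 := hh.2.2
        simp only at h1 h2
        constructor <;> linarith [hρ.1, hρ.2]⟩
      simp only [hN, z1, z2]; simp
  have iN : IntegrableOn N (Ioo (-r) r) := by
    refine (hM.const_mul (Q.Jset.indicator (fun _ => (√n + 2 * C) * Q.len) p)).integrableOn.mono' hNm.aestronglyMeasurable ?_
    filter_upwards [ae_restrict_mem measurableSet_Ioo] with ρ hρ using hNb ρ hρ
  have iF : IntegrableOn (kd S p) (Ioo (-r) r)ᶜ := by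
    refine (hM.const_mul (2 * (2 * ((√n + C) * Q.len)))).integrableOn.mono' hkS.aestronglyMeasurable ?_
    filter_upwards [ae_restrict_mem measurableSet_Ioo.compl] with ρ hρ
    have hρr : r ≤ |ρ| := by
      by_contra hh; exact hρ (abs_lt.1 (not_le.1 hh))
    have e0 : |S (p.1, p.2 + ρ) - S p| ≤ 2 * (2 * ((√n + C) * Q.len)) := by
      refine (abs_sub _ _).trans ?_
      linarith [Sf_bound' h hC hA p, Sf_bound' h hC hA (p.1, p.2 + ρ)]
    refine div_ker_le e0 (e0.trans (le_mul_of_one_le_right (by positivity) ?_))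
    rwa [one_le_div hr0]
  have iNr : IntegrableOn (kd S p) (Ioo (-r) r) := by
    have : IntegrableOn (fun ρ => N ρ + φ p * kd G p ρ) (Ioo (-r) r) := iN.add (hp.integrableOn.const_mul _)
    exact this.congr (Eventually.of_forall fun ρ => (hdec ρ).symm)
  have iS : Integrable (kd S p) := by
    rw [← integrableOn_univ, ← union_compl_self (Ioo (-r) r)]
    exact iNr.union iF
  have e : halfT S p = (∫ ρ in Ioo (-r) r, N ρ) + φ p * Tr r G p + ∫ ρ in (Ioo (-r) r)ᶜ, kd S p ρ := by
    rw [halfT_kd, ← integral_add_compl measurableSet_Ioo iS]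
    congr 1
    simp_rw [hdec]
    rw [integral_add iN (hp.integrableOn.const_mul _), integral_const_mul]
    rfl
  have b1 : ENNReal.ofReal |∫ ρ in Ioo (-r) r, N ρ| ≤ Q.Jset.indicator (fun _ => ENNReal.ofReal (8 * (√n + 2 * C))) p := by
    have : |∫ ρ in Ioo (-r) r, N ρ| ≤ Q.Jset.indicator (fun _ => (√n + 2 * C) * Q.len) p * (8 / Q.len) := by
      have hb : ∀ᵐ ρ ∂(volume.restrict (Ioo (-r) r)), ‖N ρ‖ ≤ Q.Jset.indicator (fun _ => (√n + 2 * C) * Q.len) p * mker r ρ := by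
        filter_upwards [ae_restrict_mem measurableSet_Ioo] with ρ hρ using hNb ρ hρ
      rw [← Real.norm_eq_abs]
      refine (norm_integral_le_of_norm_le (hM.const_mul _).integrableOn hb).trans ?_
      refine (setIntegral_le_integral (hM.const_mul _) (Eventually.of_forall fun ρ => by
        have := mker_nonneg hr0 ρ
        have h3 : 0 ≤ Q.Jset.indicator (fun _ => (√n + 2 * C) * Q.len) p := indicator_nonneg (fun _ _ => by positivity) _
        simp only [Pi.zero_apply]; positivity)).trans ?_
      rw [integral_const_mul, mker_integral hr0, hsr]
    refine (ENNReal.ofReal_le_ofReal this).trans ?_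
    by_cases hJ : p ∈ Q.Jset
    · rw [indicator_of_mem hJ, indicator_of_mem hJ]
      apply ENNReal.ofReal_le_ofReal
      apply le_of_eq; field_simp
    · rw [indicator_of_notMem hJ, indicator_of_notMem hJ]; simp
  have b2 : ENNReal.ofReal |φ p * Tr r G p| ≤ Q.toSet.indicator (fun p => 2 * ENNReal.ofReal |Tr r G p|) p := by
    by_cases hq : p ∈ Q.toSet
    · rw [indicator_of_mem hq, abs_mul, ENNReal.ofReal_mul (abs_nonneg _)]
      refine mul_le_mul' ?_ le_rfl
      exact (ENNReal.ofReal_le_ofReal (Adm.bound hA p)).trans_eq (by norm_num)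
    · rw [indicator_of_notMem hq, Adm.zero hA hq]; simp
  have b3 : ENNReal.ofReal |∫ ρ in (Ioo (-r) r)ᶜ, kd S p ρ| ≤
      ∫⁻ ρ, (ENNReal.ofReal |S (p.1, p.2 + ρ)| + ENNReal.ofReal |S p|) * ENNReal.ofReal (mker r ρ) := by
    rw [← Real.norm_eq_abs, ofReal_norm_eq_enorm]
    refine (enorm_integral_le_lintegral_enorm _).trans ?_
    refine (setLIntegral_mono' (g := fun ρ => (ENNReal.ofReal |S (p.1, p.2 + ρ)| + ENNReal.ofReal |S p|) * ENNReal.ofReal (mker r ρ))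
      measurableSet_Ioo.compl fun ρ hρ => ?_).trans (setLIntegral_le_lintegral _ _)
    have hρr : r ≤ |ρ| := by
      by_contra hh; exact hρ (abs_lt.1 (not_le.1 hh))
    rw [← ENNReal.ofReal_add (abs_nonneg _) (abs_nonneg _), ← ENNReal.ofReal_mul (by positivity), ← ofReal_norm_eq_enorm, Real.norm_eq_abs]
    apply ENNReal.ofReal_le_ofReal
    have e0 := abs_sub (S (p.1, p.2 + ρ)) (S p)
    refine div_ker_le e0 (e0.trans (le_mul_of_one_le_right (by positivity) ?_))
    rwa [one_le_div hr0]
  rw [e]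
  refine (ENNReal.ofReal_le_ofReal ((abs_add_le _ _).trans (add_le_add (abs_add_le _ _) le_rfl))).trans ?_
  rw [ENNReal.ofReal_add (by positivity) (abs_nonneg _), ENNReal.ofReal_add (abs_nonneg _) (abs_nonneg _)]
  calc _ ≤ _ := add_le_add (add_le_add b1 b2) b3
    _ = _ := by ring

lemma Sf_int (h : PLip G C) (hC : 0 ≤ C) (hA : Admissible φ Q) (hae : ∀ᵐ p, Integrable (kd G p))
    (hfin : ∫⁻ p in Q.toSet, absHalf G p ≠ ⊤) (hB : ParabBMOLe (halfT G) 1) :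
    ∫⁻ p, ENNReal.ofReal |halfT (Sf φ G Q) p| ≤
      ENNReal.ofReal ((32 * (√n + C) + 24 * (√n + 2 * C) + 2 * (2 * (1 + 16 * (√n + C)) + 8 * C)) * Q.len ^ (n + 2)) := by
  have hl := Q.len_pos
  have hr0 : 0 < Q.len ^ 2 := by positivity
  obtain ⟨iT, bT⟩ := h.Tr_bound hC Q hfin hB
  have hc := h.cont
  have hφc : Continuous φ := hA.1.continuous
  have hSm : Measurable (Sf φ G Q) := by
    have : Continuous (Sf φ G Q) := by unfold Sf; fun_prop
    exact this.measurable
  refine (lintegral_mono_ae (hae.mono fun p hp => Sf_pt h hC hA p hp)).trans ?_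
  have m1 : Measurable (fun q : Pt n × ℝ => (ENNReal.ofReal |Sf φ G Q (q.1.1, q.1.2 + q.2)| + ENNReal.ofReal |Sf φ G Q q.1|) * ENNReal.ofReal (mker (Q.len ^ 2) q.2)) := by
    fun_prop
  have m1' : Measurable (fun p : Pt n => ∫⁻ ρ, (ENNReal.ofReal |Sf φ G Q (p.1, p.2 + ρ)| + ENNReal.ofReal |Sf φ G Q p|) * ENNReal.ofReal (mker (Q.len ^ 2) ρ)) :=
    Measurable.lintegral_prod_right' (ν := (volume : Measure ℝ)) m1
  have m2 : Measurable (Q.Jset.indicator (fun _ => ENNReal.ofReal (8 * (√n + 2 * C)))) := measurable_const.indicator (Jset_meas Q)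
  rw [lintegral_add_left (by exact m1'.add m2), lintegral_add_left m1', lintegral_indicator (Jset_meas Q), lintegral_indicator Q.measurable,
    setLIntegral_const, Jset_vol]
  have c3 : ∫⁻ p in Q.toSet, 2 * ENNReal.ofReal |Tr (Q.len ^ 2) G p| ≤ ENNReal.ofReal (2 * (2 * (1 + 16 * (√n + C)) + 8 * C) * Q.len ^ (n + 2)) := by
    rw [lintegral_const_mul' _ _ (by norm_num), ← ofReal_integral_eq_lintegral_ofReal iT.abs (Eventually.of_forall fun _ => abs_nonneg _)]
    have two : ∀ x : ℝ, 2 * ENNReal.ofReal x = ENNReal.ofReal (2 * x) := fun x => by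
      rw [ENNReal.ofReal_mul (by norm_num)]; norm_num
    rw [two]
    apply ENNReal.ofReal_le_ofReal
    rw [mul_assoc]
    exact mul_le_mul_of_nonneg_left bT (by norm_num)
  have c2 : ENNReal.ofReal (8 * (√n + 2 * C)) * ENNReal.ofReal (3 * Q.len ^ (n + 2)) = ENNReal.ofReal (24 * (√n + 2 * C) * Q.len ^ (n + 2)) := by
    rw [← ENNReal.ofReal_mul (by positivity)]; congr 1; ring
  have hS1 : ∫⁻ p, ENNReal.ofReal |Sf φ G Q p| ≤ ENNReal.ofReal (2 * ((√n + C) * Q.len) * Q.len ^ (n + 2)) := by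
    calc _ ≤ ∫⁻ p, Q.toSet.indicator (fun _ => ENNReal.ofReal (2 * ((√n + C) * Q.len))) p := by
          refine lintegral_mono fun p => (ENNReal.ofReal_le_ofReal (Sf_bound h hC hA p)).trans ?_
          by_cases hp : p ∈ Q.toSet
          · rw [indicator_of_mem hp, indicator_of_mem hp]
          · rw [indicator_of_notMem hp, indicator_of_notMem hp]; simp
      _ = _ := by
          rw [lintegral_indicator Q.measurable, setLIntegral_const, Q.volume_eq, ← ENNReal.ofReal_mul (by positivity)]
  have c1 : ∫⁻ p, ∫⁻ ρ, (ENNReal.ofReal |Sf φ G Q (p.1, p.2 + ρ)| + ENNReal.ofReal |Sf φ G Q p|) * ENNReal.ofReal (mker (Q.len ^ 2) ρ) ≤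
      ENNReal.ofReal (32 * (√n + C) * Q.len ^ (n + 2)) := by
    rw [lintegral_lintegral_swap m1.aemeasurable]
    have e : ∀ ρ, ∫⁻ p, (ENNReal.ofReal |Sf φ G Q (p.1, p.2 + ρ)| + ENNReal.ofReal |Sf φ G Q p|) * ENNReal.ofReal (mker (Q.len ^ 2) ρ) =
        (2 * ∫⁻ p, ENNReal.ofReal |Sf φ G Q p|) * ENNReal.ofReal (mker (Q.len ^ 2) ρ) := by
      intro ρ
      rw [lintegral_mul_const' _ _ ENNReal.ofReal_ne_top, lintegral_add_left (by fun_prop)]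
      congr 1
      have : ∫⁻ p : Pt n, ENNReal.ofReal |Sf φ G Q (p.1, p.2 + ρ)| = ∫⁻ p, ENNReal.ofReal |Sf φ G Q p| := by
        rw [← lintegral_add_right_eq_self (μ := (volume : Measure (Pt n))) (fun p => ENNReal.ofReal |Sf φ G Q p|) ((0 : Spc n), ρ)]
        refine lintegral_congr fun p => ?_
        congr 3
        ext1 <;> simp
      rw [this, two_mul]
    simp_rw [e]
    rw [lintegral_const_mul _ (by fun_prop), mker_lintegral hr0, Real.sqrt_sq hl.le]
    refine (mul_le_mul' (mul_le_mul' le_rfl hS1) le_rfl).trans (le_of_eq ?_)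
    rw [show (2 : ENNReal) = ENNReal.ofReal 2 by norm_num, ← ENNReal.ofReal_mul (by norm_num), ← ENNReal.ofReal_mul (by positivity)]
    congr 1
    field_simp
    ring
  rw [c2]
  refine (add_le_add (add_le_add c1 le_rfl) c3).trans (le_of_eq ?_)
  rw [← ENNReal.ofReal_add (by positivity) (by positivity), ← ENNReal.ofReal_add (by positivity) (by positivity)]
  congr 1; ring
end

section
variable {n : ℕ} {φ : Pt n → ℝ} {Q : PCube n} {G : Pt n → ℝ} {C : ℝ}

lemma absHalf_congr_ae {F F' : Pt n → ℝ} (h : F =ᵐ[volume] F') : absHalf F =ᵐ[volume] absHalf F' := by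
  filter_upwards [h, ae_line_add h] with p h1 h2
  unfold absHalf
  refine lintegral_congr_ae ?_
  filter_upwards [h2] with ρ hρ
  rw [hρ, h1]

lemma kd_int {F : Pt n → ℝ} (hF : Measurable F) {p : Pt n} (hp : absHalf F p < ⊤) : Integrable (kd F p) := by
  refine ⟨((kd_meas hF).comp (measurable_const.prodMk measurable_id)).aestronglyMeasurable, ?_⟩
  rw [hasFiniteIntegral_iff_norm, ← absHalf_kd]; exact hp

lemma halfT_sub_le {F V : Pt n → ℝ} (hV : Measurable V) (p : Pt n) :
    ENNReal.ofReal |halfT (fun q => F q - V q) p| ≤ ENNReal.ofReal |halfT F p| + absHalf V p := by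
  by_cases hv : absHalf V p < ⊤
  · have iV := kd_int hV hv
    have e : kd (fun q => F q - V q) p = fun ρ => kd F p ρ - kd V p ρ := by
      funext ρ; unfold kd; ring
    by_cases iF : Integrable (kd F p)
    · have : halfT (fun q => F q - V q) p = halfT F p - halfT V p := by
        rw [halfT_kd, halfT_kd, halfT_kd, e, integral_sub iF iV]
      rw [this]
      refine (ENNReal.ofReal_le_ofReal (abs_sub _ _)).trans ?_
      rw [ENNReal.ofReal_add (abs_nonneg _) (abs_nonneg _)]
      exact add_le_add le_rfl (halfT_abs_le V p)
    · have : halfT (fun q => F q - V q) p = 0 := by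
        rw [halfT_kd]
        apply integral_undef
        intro hh
        apply iF
        have := hh.add iV
        rw [e] at this
        refine this.congr (Eventually.of_forall fun ρ => ?_)
        simp
      rw [this]; simp
  · rw [not_lt, top_le_iff] at hv
    rw [hv]; simp

lemma cube_sub_strip (R : PCube n) : R.toSet ⊆ strip R.time R.len := fun _ hp => ⟨trivial, hp.2⟩

lemma len_le {Q R : PCube n} (h : Q.toSet ⊆ R.toSet) : Q.len ≤ R.len := by
  have h1 := (h Q.base_mem).2.1
  have h2 : ((Q.base.1, Q.time + Q.len ^ 2) : Pt n) ∈ Q.toSet :=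
    ⟨Q.base_mem.1, by have : 0 ≤ Q.len ^ 2 := by positivity
                      constructor <;> simp only <;> linarith⟩
  have h3 := (h h2).2.2
  simp only [PCube.base] at h1 h3
  exact le_of_sq_le_sq (by linarith) R.len_pos.le

lemma V_rep {h : Pt n → ℝ} (hm : Measurable h) {b : ℝ} (hb : 0 < b) (Q : PCube n)
    (hh : ∀ᵐ y, |h y| ≤ Q.toSet.indicator (fun _ => b) y) :
    ∃ (μ : Measure (Pt n)) (_ : IsFiniteMeasure μ) (σ : Pt n → ℝ), Measurable σ ∧ (∀ z, |σ z| ≤ 1) ∧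
      μ univ = ENNReal.ofReal (b * Q.len ^ (n + 2)) ∧ ∀ p, ∫ y, heatW (p - y) * h y = cW μ σ p := by
  refine ⟨ENNReal.ofReal b • volume.restrict Q.toSet, ?_, fun y => max (-1) (min 1 (h y / b)), by fun_prop, ?_, ?_, ?_⟩
  · exact Measure.smul_finite _ ENNReal.ofReal_ne_top
  · intro z
    exact abs_le.2 ⟨le_max_left _ _, max_le (by norm_num) (min_le_left _ _)⟩
  · rw [Measure.smul_apply, Measure.restrict_apply_univ, Q.volume_eq, smul_eq_mul, ← ENNReal.ofReal_mul hb.le]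
  · intro p
    unfold cW
    rw [integral_smul_measure, ENNReal.toReal_ofReal hb.le, smul_eq_mul, ← integral_const_mul,
      ← integral_indicator Q.measurable]
    refine integral_congr_ae ?_
    filter_upwards [hh] with y hy
    by_cases hq : y ∈ Q.toSet
    · rw [indicator_of_mem hq] at hy ⊢
      have h1 := abs_le.1 hy
      have e1 : h y / b ≤ 1 := by rw [div_le_one hb]; exact h1.2
      have e2 : -1 ≤ h y / b := by rw [le_div_iff₀ hb]; linarith
      rw [min_eq_right e1, max_eq_right e2]
      field_simp
    · rw [indicator_of_notMem hq] at hy ⊢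
      have : h y = 0 := abs_eq_zero.1 (le_antisymm hy (abs_nonneg _))
      rw [this, mul_zero]
end

theorem keylemma (n : ℕ) (hn : 1 ≤ n) :
    ∃ C : ℝ, 0 < C ∧ ∀ ν : SignedMeasure (Pt n),
      (∀ p, ‖convGradW ν p‖ ≤ 1) → ParabBMOLe (halfT (convW ν)) 1 →
      ∀ Q R : PCube n, Q.toSet ⊆ R.toSet →
      ∀ φ : Pt n → ℝ, Admissible φ Q →
      ∫ p in R.toSet, |halfT (convWd ν φ) p| ≤ C * R.len ^ (n + 2) := by
  obtain ⟨C, hC, hrep⟩ := lip_rep n hn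
  set K1 : ℝ := 32 * (√n + C) + 24 * (√n + 2 * C) + 2 * (2 * (1 + 16 * (√n + C)) + 8 * C) with hK1
  set K2 : ℝ := 32 * 3 ^ n * 9 * (√n + C + 2) with hK2
  have hK1p : 0 < K1 := by positivity
  have hK2p : 0 < K2 := by positivity
  refine ⟨K1 + K2, by positivity, ?_⟩
  intro ν hg hb Q R hQR φ hA
  have hl := Q.len_pos
  have hRl := R.len_pos
  have hQRl := len_le hQR
  have hgood := Adm.good hA
  obtain ⟨μ, hμ, σ, hσ, h1, eW, eG, eφ⟩ := jordan_sign ν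
  have hg' : ∀ᵐ p, ‖cG μ σ p‖ ≤ 1 := by
    filter_upwards [eG] with p hp
    rw [← hp]; exact hg p
  have hb' : ParabBMOLe (halfT (cW μ σ)) 1 := bmo_congr_ae (halfT_congr_ae eW) hb
  obtain ⟨G, hGl, hGe⟩ := hrep μ hμ σ hσ h1 hg' hb'
  have hP : PLip G C := hGl
  have hbG : ParabBMOLe (halfT G) 1 := bmo_congr_ae (halfT_congr_ae hGe.symm) hb'
  have haG := absHalf_congr_ae hGe
  have hstripG : ∀ a r : ℝ, 0 < r → ∫⁻ p in strip a r, absHalf G p ≠ ⊤ := by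
    intro a r hr
    rw [lintegral_congr_ae (ae_restrict_of_ae haG)]
    refine ne_top_of_le_ne_top ?_ (cW_absHalf_strip μ hσ h1 a r hr)
    have := measure_ne_top μ univ
    finiteness
  have hGm := hP.cont.measurable
  have hfin : ∫⁻ p in Q.toSet, absHalf G p ≠ ⊤ :=
    ne_top_of_le_ne_top (hstripG Q.time Q.len hl) (lintegral_mono_set (cube_sub_strip Q))
  have hae : ∀ᵐ p, Integrable (kd G p) :=
    (ae_lt_top_of_strip (absHalf_measurable hGm) hstripG).mono fun p hp => kd_int hGm hp
  have hSint := Sf_int hP hC.le hA hae hfin hbG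
  -- the remainder
  set c := G Q.base with hc
  set h : Pt n → ℝ := fun y => (cW μ σ y - c) * Th φ y - 2 * Ds φ y (cG μ σ y) with hh
  have hhm : Measurable h := by
    have m1 := (cW_sm μ hσ).measurable
    have m2 := (cG_sm μ hσ).measurable
    have m3 := hgood.thc.measurable
    have m4 : Measurable (fun y => Ds φ y (cG μ σ y)) := hgood.ds2.measurable.comp (measurable_id.prodMk m2)
    rw [hh]; fun_prop
  set b : ℝ := (√n + C + 2) / Q.len with hbdef
  have hb0 : 0 < b := by positivity
  have hhb : ∀ᵐ y, |h y| ≤ Q.toSet.indicator (fun _ => b) y := by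
    filter_upwards [hGe, hg'] with y hy hgy
    by_cases hq : y ∈ Q.toSet
    · rw [indicator_of_mem hq]
      simp only [hh]
      rw [← hy]
      have e1 := hP.osc hC.le Q hq Q.base_mem 0
      simp only [add_zero] at e1
      have e2 := Adm.th hA y
      have e3 := Adm.ds hA y (cG μ σ y)
      have e4 : |(G y - c) * Th φ y| ≤ ((√n + C) * Q.len) * (1 / Q.len ^ 2) := by
        rw [abs_mul]; exact mul_le_mul e1 e2 (abs_nonneg _) (by positivity)
      have e5 : |2 * Ds φ y (cG μ σ y)| ≤ 2 * (1 / Q.len) := by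
        rw [abs_mul, abs_two]
        refine mul_le_mul_of_nonneg_left (e3.trans ?_) (by norm_num)
        exact mul_le_of_le_one_right (by positivity) hgy
      refine (abs_sub _ _).trans ((add_le_add e4 e5).trans (le_of_eq ?_))
      rw [hbdef]; field_simp
    · have hq' : y ∉ tsupport φ := fun hh => hq (hA.2.1 hh)
      rw [indicator_of_notMem hq]
      simp only [hh]
      rw [Th_zero_of hq', Ds_zero_of hq']; simp
  obtain ⟨μ', hμ', σ', hσ', h1', hμu, hV⟩ := V_rep hhm hb0 Q hhb
  set V := cW μ' σ' with hVdef
  have hVm : Measurable V := (cW_sm μ' hσ').measurable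
  have hφm : Measurable φ := hA.1.continuous.measurable
  have hrepr : convWd ν φ =ᵐ[volume] fun p => Sf φ G Q p - V p := by
    filter_upwards [eφ φ hφm ⟨2, Adm.bound hA⟩, repr2 μ hσ h1 hgood c, hGe] with p p1 p2 p3
    rw [p1, p2, hV p, ← p3]
    rfl
  have hT := halfT_congr_ae hrepr
  have hVint : ∫⁻ p in R.toSet, absHalf V p ≤ ENNReal.ofReal (K2 * R.len ^ (n + 2)) := by
    refine (lintegral_mono_set (cube_sub_strip R)).trans ((cW_absHalf_strip μ' hσ' h1' R.time R.len hRl).trans ?_)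
    rw [hμu]
    have n9 : (9 : ENNReal) = ENNReal.ofReal 9 := by norm_num
    rw [n9, ← ENNReal.ofReal_mul (by positivity), ← ENNReal.ofReal_mul (by positivity), ← ENNReal.ofReal_mul (by positivity)]
    apply ENNReal.ofReal_le_ofReal
    have e : R.len * (32 * 3 ^ n * 9 * (b * Q.len ^ (n + 2))) = K2 * (R.len * Q.len ^ (n + 1)) := by
      rw [hbdef, hK2]; field_simp
      ring
    rw [e]
    refine mul_le_mul_of_nonneg_left ?_ hK2p.le
    calc R.len * Q.len ^ (n + 1) ≤ R.len * R.len ^ (n + 1) :=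
          mul_le_mul_of_nonneg_left (pow_le_pow_left₀ hl.le hQRl _) hRl.le
      _ = R.len ^ (n + 2) := by ring
  have htot : ∫⁻ p in R.toSet, ENNReal.ofReal ‖|halfT (convWd ν φ) p|‖ ≤ ENNReal.ofReal ((K1 + K2) * R.len ^ (n + 2)) := by
    calc _ ≤ ∫⁻ p in R.toSet, (ENNReal.ofReal |halfT (Sf φ G Q) p| + absHalf V p) := by
          refine lintegral_mono_ae (ae_restrict_of_ae ?_)
          filter_upwards [hT] with p hp
          rw [norm_abs_eq_norm, Real.norm_eq_abs, hp]
          exact halfT_sub_le hVm p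
      _ = (∫⁻ p in R.toSet, ENNReal.ofReal |halfT (Sf φ G Q) p|) + ∫⁻ p in R.toSet, absHalf V p :=
          lintegral_add_right _ (absHalf_measurable hVm)
      _ ≤ ENNReal.ofReal (K1 * R.len ^ (n + 2)) + ENNReal.ofReal (K2 * R.len ^ (n + 2)) := by
          refine add_le_add ((setLIntegral_le_lintegral _ _).trans (hSint.trans (ENNReal.ofReal_le_ofReal ?_))) hVint
          exact mul_le_mul_of_nonneg_left (pow_le_pow_left₀ hl.le hQRl _) hK1p.le
      _ = _ := by
          rw [← ENNReal.ofReal_add (by positivity) (by positivity)]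
          congr 1; ring
  refine (le_abs_self _).trans ?_
  rw [← Real.norm_eq_abs]
  refine (norm_integral_le_lintegral_norm _).trans ?_
  exact ENNReal.toReal_le_of_le_ofReal (by positivity) htot
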